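/- Let α : [0,1] → ℝ² be a continuous injective map. Then there exists a homeomorphism h of ℝ² onto itself such that h(α(t)) = (t, 0) for all t ∈ [0,1]. -/

import Mathlib

open Metric Set

/-- The plane `ℝ²`. -/
abbrev Plane := EuclideanSpace ℝ (Fin 2)

open Filter Topology unitInterval

theorem exp_constOn {X : Type*} [TopologicalSpace X] {S : Set X} (hS : IsPreconnected S)
    {N : X → ℂ} (hN : ContinuousOn N S) (h : ∀ x ∈ S, ∀ y ∈ S, Complex.exp (N x) = Complex.exp
        (N y))
    {x y : X} (hx : x ∈ S) (hy : y ∈ S) : N x = N y := by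
  have := isPreconnected_iff_preconnectedSpace.mp hS
  have := Complex.isCoveringMap_exp.const_of_comp (g := fun z : S ↦ N z)
    (continuousOn_iff_continuous_domRestrict.mp hN)
    (fun a b ↦ Subtype.ext (h a a.2 b b.2)) ⟨x, hx⟩ ⟨y, hy⟩
  exact this

open Classical in
/-- The total variation of a continuous logarithm of `f` along the unit interval. -/
noncomputable def logVar (f : I → ℂ) : ℂ :=
  if h : ∃ L : I → ℂ, Continuous L ∧ ∀ t, Complex.exp (L t) = f t
    then h.choose 1 - h.choose 0 else 0

theorem logVar_eq {f L : I → ℂ} (hL : Continuous L) (h : ∀ t, Complex.exp (L t) = f t) :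
    logVar f = L 1 - L 0 := by
  have h' : ∃ L : I → ℂ, Continuous L ∧ ∀ t, Complex.exp (L t) = f t := ⟨L, hL, h⟩
  rw [logVar, dif_pos h']
  obtain ⟨h1, h2⟩ := h'.choose_spec
  have := exp_constOn (S := univ) (N := fun t ↦ h'.choose t - L t) isPreconnected_univ
    (h1.sub hL).continuousOn
    (fun x _ y _ ↦ by
      have hne : ∀ t, f t ≠ 0 := fun t ↦ h t ▸ Complex.exp_ne_zero _
      simp [Complex.exp_sub, h, h2, hne]) (mem_univ 1) (mem_univ 0)
  linear_combination this

theorem exists_log_family {X : Type*} [TopologicalSpace X] {F : X → I → ℂ}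
    (hF : Continuous (Function.uncurry F)) (h0 : ∀ x t, F x t ≠ 0) :
    ∃ L : X → I → ℂ, Continuous (Function.uncurry L) ∧
      ∀ x t, Complex.exp (L x t) = F x t / F x 0 := by
  let H : C(I × X, {z : ℂ // z ≠ 0}) :=
    ⟨fun p ↦ ⟨F p.2 p.1 / F p.2 0, div_ne_zero (h0 _ _) (h0 _ _)⟩, by
      refine Continuous.subtype_mk (Continuous.div ?_ ?_ fun p ↦ h0 _ _) _
      · exact hF.comp (continuous_snd.prodMk continuous_fst)
      · exact hF.comp (continuous_snd.prodMk continuous_const)⟩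
  have H0 : ∀ a, H (0, a) = ⟨_, Complex.exp_ne_zero ((ContinuousMap.const X (0 : ℂ)) a)⟩ := by
    intro a
    simp [H, h0]
  let L := Complex.isCoveringMap_exp.liftHomotopy H (ContinuousMap.const X (0 : ℂ)) H0
  refine ⟨fun x t ↦ L (t, x), L.continuous.comp continuous_swap, fun x t ↦ ?_⟩
  have := congrFun (Complex.isCoveringMap_exp.liftHomotopy_lifts H _ H0) (t, x)
  exact congrArg Subtype.val this

theorem exists_log {f : I → ℂ} (hf : Continuous f) (h0 : ∀ t, f t ≠ 0) :
    ∃ L : I → ℂ, Continuous L ∧ ∀ t, Complex.exp (L t) = f t := by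
  obtain ⟨L, hL, h⟩ := exists_log_family (X := Unit) (F := fun _ ↦ f)
    (hf.comp continuous_snd) (fun _ ↦ h0)
  refine ⟨fun t ↦ L () t + Complex.log (f 0), ?_, fun t ↦ ?_⟩
  · exact (hL.comp (Continuous.prodMk_right ())).add continuous_const
  · rw [Complex.exp_add, h, Complex.exp_log (h0 0), div_mul_cancel₀ _ (h0 0)]

theorem continuous_logVar {X : Type*} [TopologicalSpace X] {F : X → I → ℂ}
    (hF : Continuous (Function.uncurry F)) (h0 : ∀ x t, F x t ≠ 0) :
    Continuous fun x ↦ logVar (F x) := by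
  obtain ⟨L, hL, h⟩ := exists_log_family hF h0
  have : (fun x ↦ logVar (F x)) = fun x ↦ L x 1 - L x 0 := by
    ext x
    rw [logVar_eq (L := fun t ↦ L x t + Complex.log (F x 0))]
    · ring
    · exact (hL.comp (Continuous.prodMk_right x)).add continuous_const
    · intro t
      rw [Complex.exp_add, h, Complex.exp_log (h0 _ 0), div_mul_cancel₀ _ (h0 _ 0)]
  rw [this]
  exact (hL.comp (Continuous.prodMk_left 1)).sub (hL.comp (Continuous.prodMk_left 0))

theorem continuousOn_logVar {X : Type*} [TopologicalSpace X] {S : Set X} {F : X → I → ℂ}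
    (hF : ContinuousOn (Function.uncurry F) (S ×ˢ univ)) (h0 : ∀ x ∈ S, ∀ t, F x t ≠ 0) :
    ContinuousOn (fun x ↦ logVar (F x)) S := by
  rw [continuousOn_iff_continuous_domRestrict]
  refine continuous_logVar (F := fun (x : S) t ↦ F x t) ?_ fun x ↦ h0 x x.2
  refine hF.comp_continuous (f := fun p : S × I ↦ (p.1.1, p.2)) (by fun_prop) fun p ↦ ?_
  exact ⟨p.1.2, mem_univ _⟩

theorem logVar_mul {f g : I → ℂ} (hf : Continuous f) (hg : Continuous g) (hf0 : ∀ t, f t ≠ 0)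
    (hg0 : ∀ t, g t ≠ 0) : logVar (fun t ↦ f t * g t) = logVar f + logVar g := by
  obtain ⟨L, hL, h⟩ := exists_log hf hf0
  obtain ⟨M, hM, h'⟩ := exists_log hg hg0
  rw [logVar_eq hL h, logVar_eq hM h', logVar_eq (L := fun t ↦ L t + M t) (hL.add hM)
    fun t ↦ by rw [Complex.exp_add, h, h']]
  ring

theorem exp_logVar {f : I → ℂ} (hf : Continuous f) (hf0 : ∀ t, f t ≠ 0) :
    Complex.exp (logVar f) = f 1 / f 0 := by
  obtain ⟨L, hL, h⟩ := exists_log hf hf0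
  rw [logVar_eq hL h, Complex.exp_sub, h, h]

theorem logVar_of_slitPlane {f : I → ℂ} (hf : Continuous f) (h : ∀ t, f t ∈ Complex.slitPlane) :
    logVar f = Complex.log (f 1) - Complex.log (f 0) :=
  logVar_eq (hf.clog h) fun t ↦ Complex.exp_log (Complex.slitPlane_ne_zero (h t))

theorem logVar_const_mul {f : I → ℂ} {c : ℂ} (hc : c ≠ 0) (hf : Continuous f)
    (h : ∀ t, f t ∈ Complex.slitPlane) :
    logVar (fun t ↦ c * f t) = Complex.log (f 1) - Complex.log (f 0) := by
  rw [logVar_mul continuous_const hf (fun _ ↦ hc) fun t ↦ Complex.slitPlane_ne_zero (h t),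
    logVar_of_slitPlane hf h, logVar_eq (L := fun _ ↦ Complex.log c) continuous_const
      fun _ ↦ Complex.exp_log hc]
  ring

theorem one_add_mem_slitPlane {z : ℂ} (hz : ‖z‖ < 1) : 1 + z ∈ Complex.slitPlane :=
  Complex.mem_slitPlane_of_norm_lt_one hz

theorem logVar_ball {J : I → ℂ} {c w : ℂ} {ρ : ℝ} (hJ : Continuous J) (h : ∀ t, J t ∈ ball c ρ)
    (hw : w ∉ ball c ρ) :
    logVar (fun t ↦ J t - w) = Complex.log (1 + (J 1 - c) / (c - w)) -
      Complex.log (1 + (J 0 - c) / (c - w)) := by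
  have hρ : 0 < ρ := pos_of_mem_ball (h 0)
  have hcw : c - w ≠ 0 := by
    rintro h0
    exact hw (by rw [← sub_eq_zero.mp h0]; exact mem_ball_self hρ)
  have := logVar_const_mul (f := fun t ↦ 1 + (J t - c) / (c - w)) hcw (by fun_prop) fun t ↦ by
    refine one_add_mem_slitPlane ?_
    rw [norm_div, div_lt_one (norm_pos_iff.mpr hcw), ← dist_eq_norm]
    refine (mem_ball.mp (h t)).trans_le ?_
    rw [mem_ball, not_lt, dist_comm] at hw
    rwa [← dist_eq_norm]
  rw [← this]
  congr 1
  ext t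
  field_simp
  ring

theorem deriv_ne_zero_of_injOn {U : Set ℂ} (hU : IsOpen U) {f : ℂ → ℂ}
    (hf : DifferentiableOn ℂ f U) (hi : InjOn f U) {a : ℂ} (ha : a ∈ U) : deriv f a ≠ 0 := by
  intro hd
  have hUa := hU.mem_nhds ha
  have han : AnalyticAt ℂ (fun z ↦ f z - f a) a := (hf.analyticAt hUa).sub analyticAt_const
  have hne : ¬ ∀ᶠ z in 𝓝 a, f z - f a = 0 := by
    intro h
    obtain ⟨z, ⟨hz1, hz2⟩, hz3⟩ := ((eventually_nhdsWithin_of_eventually_nhds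
      (h.and (show ∀ᶠ z in 𝓝 a, z ∈ U from hUa))).and
      (show ∀ᶠ z in 𝓝[≠] a, z ∈ ({a}ᶜ : Set ℂ) from self_mem_nhdsWithin)).exists
    exact hz3 (hi hz2 ha (sub_eq_zero.mp hz1))
  obtain ⟨n, g, hg, hg0, hfg⟩ := han.exists_eventuallyEq_pow_smul_nonzero_iff.mpr hne
  have hn0 : n ≠ 0 := by
    rintro rfl
    have := hfg.self_of_nhds
    simp at this
    exact hg0 this.symm
  have hn1 : n ≠ 1 := by
    rintro rfl
    have h1 : HasDerivAt (fun z ↦ f z - f a) 0 a := by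
      have := ((hf.differentiableAt hUa).hasDerivAt.sub_const (f a))
      rwa [hd] at this
    have h2 := ((hasDerivAt_id a).sub_const a).mul hg.differentiableAt.hasDerivAt
    have h3 := h1.congr_of_eventuallyEq (f₁ := fun z ↦ (z - a) * g z)
      (hfg.mono fun z hz ↦ by simpa using hz.symm)
    have := h3.unique h2
    simp at this
    exact hg0 this.symm
  set k : ℂ → ℂ := fun z ↦ (z - a) * Complex.exp (Complex.log (g z / g a) / n) with hk
  have hslit : g a / g a ∈ Complex.slitPlane := by simp [hg0]
  have hka : AnalyticAt ℂ (fun z ↦ Complex.exp (Complex.log (g z / g a) / n)) a :=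
    (((hg.div analyticAt_const hg0).clog hslit).div analyticAt_const (by simpa using hn0)).cexp
  have hkd : HasStrictDerivAt k 1 a := by
    have h1 : HasStrictDerivAt (fun z : ℂ ↦ z - a) 1 a := (hasStrictDerivAt_id a).sub_const a
    have := HasStrictDerivAt.fun_mul h1 hka.hasStrictDerivAt
    simpa [hg0] using this
  have hmap := hkd.map_nhds_eq one_ne_zero
  have hk0 : k a = 0 := by simp [hk]
  rw [hk0] at hmap
  have hV : {z | z ∈ U ∧ f z - f a = (z - a) ^ n • g z ∧ g z ≠ 0} ∈ 𝓝 a :=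
    (show ∀ᶠ z in 𝓝 a, z ∈ U from hUa).and (hfg.and (hg.continuousAt.eventually_ne hg0))
  set V := {z | z ∈ U ∧ f z - f a = (z - a) ^ n • g z ∧ g z ≠ 0}
  have hkV : k '' V ∈ 𝓝 (0 : ℂ) := hmap ▸ image_mem_map hV
  have hω := Complex.isPrimitiveRoot_exp n hn0
  set ω := Complex.exp (2 * Real.pi * Complex.I / n)
  have hω1 : ω ≠ 1 := hω.ne_one (by omega)
  have hkV' : ∀ᶠ w in 𝓝 (0 : ℂ), ω * w ∈ k '' V := by
    have : Tendsto (fun w ↦ ω * w) (𝓝 0) (𝓝 0) := by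
      simpa using (continuous_const_mul ω).tendsto 0
    exact this hkV
  obtain ⟨w, ⟨⟨z2, hz2, hz12⟩, ⟨z1, hz1, rfl⟩⟩, hw⟩ :=
    ((eventually_nhdsWithin_of_eventually_nhds
      (hkV'.and (show ∀ᶠ w in 𝓝 (0 : ℂ), w ∈ k '' V from hkV))).and
      (show ∀ᶠ w in 𝓝[≠] (0 : ℂ), w ∈ ({0}ᶜ : Set ℂ) from self_mem_nhdsWithin)).exists
  have hpow : ∀ z ∈ V, k z ^ n = (f z - f a) / g a := by
    intro z hz
    have hn0' : (n : ℂ) ≠ 0 := by exact_mod_cast hn0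
    rw [hz.2.1, hk]
    simp only
    rw [mul_pow, ← Complex.exp_nat_mul, mul_div_cancel₀ _ hn0',
      Complex.exp_log (div_ne_zero hz.2.2 hg0), smul_eq_mul, mul_div_assoc]
  have hfe : f z1 = f z2 := by
    have h1 := hpow z1 hz1
    have h2 := hpow z2 hz2
    rw [hz12, mul_pow, hω.pow_eq_one, one_mul, h1] at h2
    have := (div_left_inj' hg0).mp h2
    exact sub_left_injective this
  have := hi hz1.1 hz2.1 hfe
  rw [this] at hz12 hw
  have : (ω - 1) * k z2 = 0 := by linear_combination -hz12
  rcases mul_eq_zero.mp this with h | h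
  · exact hω1 (sub_eq_zero.mp h)
  · exact hw h

theorem continuousAt_dslope_diag {f : ℂ → ℂ} {a : ℂ} (hf : AnalyticAt ℂ f a) :
    ContinuousAt (Function.uncurry (dslope f)) (a, a) := by
  have hs := hf.hasStrictDerivAt
  have hd : ContinuousAt (deriv f) a := hf.deriv.continuousAt
  rw [ContinuousAt, Metric.tendsto_nhds]
  intro ε hε
  have h1 := (hs.isLittleO.def (half_pos hε))
  have h2 : ∀ᶠ p : ℂ × ℂ in 𝓝 (a, a), dist (deriv f p.1) (deriv f a) < ε :=
    (Metric.tendsto_nhds.mp (hd.tendsto.comp (continuous_fst.tendsto (a, a))) ε hε)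
  filter_upwards [h1, h2] with p hp1 hp2
  obtain ⟨x, y⟩ := p
  simp only [Function.uncurry_apply_pair, dslope_same] at *
  by_cases hxy : y = x
  · subst hxy
    simpa using hp2
  · rw [dslope_of_ne _ hxy, slope_def_field, dist_eq_norm]
    have hxy' : x - y ≠ 0 := sub_ne_zero.mpr (Ne.symm hxy)
    have hyx' : y - x ≠ 0 := sub_ne_zero.mpr hxy
    have : (f y - f x) / (y - x) - deriv f a = (f x - f y - (x - y) * deriv f a) / (x - y) := by
      field_simp
      ring
    rw [this, norm_div, div_lt_iff₀ (norm_pos_iff.mpr hxy')]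
    simp only [ContinuousLinearMap.toSpanSingleton_apply, smul_eq_mul] at hp1
    refine hp1.trans_lt ?_
    have := norm_pos_iff.mpr hxy'
    gcongr
    linarith

/-- The upper unit semicircle. -/
noncomputable def semi (t : ℝ) : ℂ := Complex.exp (t * Real.pi * Complex.I)

theorem continuous_semi : Continuous semi := by unfold semi; fun_prop

theorem norm_semi (t : ℝ) : ‖semi t‖ = 1 := by
  rw [semi, ← Complex.ofReal_mul, Complex.norm_exp_ofReal_mul_I]

theorem semi_im (t : ℝ) : (semi t).im = Real.sin (t * Real.pi) := by
  rw [semi, ← Complex.ofReal_mul, Complex.exp_ofReal_mul_I_im]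

theorem semi_im_pos {t : ℝ} (h0 : 0 < t) (h1 : t < 1) : 0 < (semi t).im := by
  rw [semi_im]
  exact Real.sin_pos_of_pos_of_lt_pi (by positivity) (by nlinarith [Real.pi_pos])

theorem semi_zero : semi 0 = 1 := by simp [semi]
theorem semi_one : semi 1 = -1 := by simp [semi]

theorem logVar_semi_sub_in {z : ℂ} (hz : ‖z‖ < 1) : logVar (fun t : I ↦ semi t - z) =
    Real.pi * Complex.I + (Complex.log (1 + z) - Complex.log (1 - z)) := by
  have h0 : ∀ t, semi t ≠ 0 := fun t ↦ by rw [← norm_pos_iff, norm_semi]; exact one_pos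
  have hs : ∀ t : I, 1 - z / semi t ∈ Complex.slitPlane := fun t ↦ by
    rw [sub_eq_add_neg]
    exact one_add_mem_slitPlane (by rwa [norm_neg, norm_div, norm_semi, div_one])
  have hc : Continuous fun t : I ↦ semi t := continuous_semi.comp continuous_subtype_val
  have hc' : Continuous fun t : I ↦ 1 - z / semi t :=
    continuous_const.sub (continuous_const.div hc fun t ↦ h0 t)
  have : (fun t : I ↦ semi t - z) = fun t : I ↦ semi t * (1 - z / semi t) := by
    ext t
    field_simp [h0 t]
  rw [this, logVar_mul hc hc' (fun t ↦ h0 t) (fun t ↦ Complex.slitPlane_ne_zero (hs t)),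
    logVar_of_slitPlane hc' hs, logVar_eq (f := fun t : I ↦ semi t)
      (L := fun t : I ↦ t * Real.pi * Complex.I) (by fun_prop) fun t ↦ rfl]
  simp [semi_zero, semi_one, div_neg]

theorem logVar_semi_sub_out {z : ℂ} (hz : 1 < ‖z‖) : logVar (fun t : I ↦ semi t - z) =
    Complex.log (1 + z⁻¹) - Complex.log (1 - z⁻¹) := by
  have hz0 : z ≠ 0 := by rintro rfl; simp at hz; linarith
  have hc : Continuous fun t : I ↦ 1 - semi t / z :=
    continuous_const.sub ((continuous_semi.comp continuous_subtype_val).div_const z)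
  have := logVar_const_mul (c := -z) (neg_ne_zero.mpr hz0) hc fun t ↦ by
    rw [sub_eq_add_neg]
    refine one_add_mem_slitPlane ?_
    rw [norm_neg, norm_div, norm_semi]
    exact (div_lt_one (by linarith)).mpr hz
  have h2 : (fun t : I ↦ semi t - z) = fun t : I ↦ -z * (1 - semi t / z) := by
    ext t
    field_simp
    ring
  rw [h2, this]
  simp [semi_zero, semi_one, neg_div]

theorem isPreconnected_halfPlane_in : IsPreconnected {z : ℂ | 0 < z.im ∧ ‖z‖ < 1} := by
  have : {z : ℂ | 0 < z.im ∧ ‖z‖ < 1} = {z : ℂ | 0 < z.im} ∩ ball 0 1 := by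
    ext z; simp
  rw [this]
  exact ((convex_halfSpace_im_gt 0).inter (convex_ball _ _)).isPreconnected

theorem isPreconnected_halfPlane_out : IsPreconnected {z : ℂ | 0 < z.im ∧ 1 < ‖z‖} := by
  have : {z : ℂ | 0 < z.im ∧ 1 < ‖z‖} = (·⁻¹) '' ({z : ℂ | z.im < 0} ∩ ball 0 1) := by
    ext z
    simp only [mem_ofPred_eq, mem_image, mem_inter_iff, mem_ball, dist_zero_right]
    constructor
    · rintro ⟨h1, h2⟩
      refine ⟨z⁻¹, ⟨?_, ?_⟩, inv_inv z⟩
      · rw [Complex.inv_im]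
        have : 0 < Complex.normSq z := Complex.normSq_pos.mpr (by rintro rfl; simp at h1)
        exact div_neg_of_neg_of_pos (by linarith) this
      · rw [norm_inv]; exact inv_lt_one_of_one_lt₀ h2
    · rintro ⟨w, ⟨h1, h2⟩, rfl⟩
      have hw : w ≠ 0 := by rintro rfl; simp at h1
      constructor
      · rw [Complex.inv_im]
        exact div_pos (by linarith) (Complex.normSq_pos.mpr hw)
      · rw [norm_inv]; exact one_lt_inv_iff₀.mpr ⟨norm_pos_iff.mpr hw, h2⟩
  rw [this]
  refine ((convex_halfSpace_im_lt 0).inter (convex_ball _ _)).isPreconnected.image _ ?_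
  intro w hw
  have hw : w ≠ 0 := by rintro rfl; simp at hw
  exact (continuousAt_inv₀ hw).continuousWithinAt

theorem crosscut_unit {Ψ : ℂ → ℂ} (hd : DifferentiableOn ℂ Ψ {z | 0 < z.im})
    (hi : InjOn Ψ {z | 0 < z.im}) {J T : I → ℂ} (hJ : Continuous J)
    (hJΨ : ∀ t : I, 0 < (t : ℝ) → (t : ℝ) < 1 → J t = Ψ (semi t))
    (hJ0 : J 0 ∉ Ψ '' {z | 0 < z.im}) (hJ1 : J 1 ∉ Ψ '' {z | 0 < z.im})
    (hT : Continuous T) (hTn : ∀ t, T t ∉ Ψ '' {z | 0 < z.im})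
    (hT0 : T 0 = J 1) (hT1 : T 1 = J 0) {z w : ℂ} (hz : 0 < z.im) (hz1 : ‖z‖ < 1)
    (hw : 0 < w.im) (hw1 : 1 < ‖w‖) :
    logVar (fun t ↦ J t - Ψ z) + logVar (fun t ↦ T t - Ψ z) ≠
      logVar (fun t ↦ J t - Ψ w) + logVar (fun t ↦ T t - Ψ w) := by
  set H : Set ℂ := {z | 0 < z.im} with hH
  have hHo : IsOpen H := isOpen_lt continuous_const Complex.continuous_im
  have hintg : ∀ t : I, 0 < (semi t).im → 0 < (t : ℝ) ∧ (t : ℝ) < 1 := by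
    intro t ht
    constructor
    · rcases t.2.1.eq_or_lt with h | h
      · rw [← h, semi_zero] at ht; simp at ht
      · exact h
    · rcases t.2.2.eq_or_lt with h | h
      · rw [h, semi_one] at ht; simp at ht
      · exact h
  have hJH : ∀ t : I, J t ∈ Ψ '' H → 0 < (t : ℝ) ∧ (t : ℝ) < 1 := by
    intro t ht
    constructor
    · rcases t.2.1.eq_or_lt with h | h
      · have : t = 0 := Subtype.ext h.symm
        exact absurd (this ▸ ht) hJ0
      · exact h
    · rcases t.2.2.eq_or_lt with h | h
      · have : t = 1 := Subtype.ext h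
        exact absurd (this ▸ ht) hJ1
      · exact h
  have hsemi : Continuous fun t : I ↦ semi t := continuous_semi.comp continuous_subtype_val
  let Q : ℂ → I → ℂ := fun z t ↦ if semi t = z then deriv Ψ z else (J t - Ψ z) / (semi t - z)
  have hQc : ContinuousOn (Function.uncurry Q) (H ×ˢ univ) := by
    rintro ⟨z, t⟩ ⟨hz, -⟩
    refine ContinuousAt.continuousWithinAt ?_
    have hΨ : ContinuousAt Ψ z := (hd.differentiableAt (hHo.mem_nhds hz)).continuousAt
    by_cases h : semi t = z
    · obtain ⟨h0, h1⟩ := hintg t (h ▸ hz)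
      have hc := continuousAt_dslope_diag (hd.analyticAt (hHo.mem_nhds hz))
      have hc2 : ContinuousAt (fun p : ℂ × I ↦ Function.uncurry (dslope Ψ) (p.1, semi p.2))
          (z, t) := by
        refine ContinuousAt.comp (g := Function.uncurry (dslope Ψ))
          (f := fun p : ℂ × I ↦ (p.1, semi p.2)) ?_ ?_
        · simpa only [h] using hc
        · exact (continuous_fst.prodMk (hsemi.comp continuous_snd)).continuousAt
      refine hc2.congr ?_
      have h0' : ∀ᶠ p : ℂ × I in 𝓝 (z, t), 0 < (p.2 : ℝ) :=
        (by fun_prop : Continuous fun p : ℂ × I ↦ (p.2 : ℝ)).continuousAt.eventually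
            (lt_mem_nhds h0)
      have h1' : ∀ᶠ p : ℂ × I in 𝓝 (z, t), (p.2 : ℝ) < 1 :=
        (by fun_prop : Continuous fun p : ℂ × I ↦ (p.2 : ℝ)).continuousAt.eventually
            (gt_mem_nhds h1)
      filter_upwards [h0', h1'] with p hp0 hp1
      obtain ⟨x, y⟩ := p
      simp only [Function.uncurry_apply_pair, Q]
      split_ifs with hxy
      · rw [hxy, dslope_same]
      · rw [dslope_of_ne _ hxy, slope_def_field, hJΨ y hp0 hp1]
    · have hev : ∀ᶠ p : ℂ × I in 𝓝 (z, t), semi p.2 - p.1 ≠ 0 := by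
        refine ContinuousAt.eventually_ne ?_ (sub_ne_zero.mpr h)
        exact ((hsemi.comp continuous_snd).sub continuous_fst).continuousAt
      have hc : ContinuousAt (fun p : ℂ × I ↦ (J p.2 - Ψ p.1) / (semi p.2 - p.1)) (z, t) := by
        refine ContinuousAt.div ?_ ?_ (sub_ne_zero.mpr h)
        · refine (hJ.comp continuous_snd).continuousAt.sub ?_
          exact ContinuousAt.comp (f := fun p : ℂ × I ↦ p.1) hΨ continuousAt_fst
        · exact ((hsemi.comp continuous_snd).sub continuous_fst).continuousAt
      refine hc.congr ?_
      filter_upwards [hev] with p hp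
      simp only [Function.uncurry, Q, if_neg (sub_ne_zero.mp hp)]
  have hQ0 : ∀ z ∈ H, ∀ t, Q z t ≠ 0 := by
    intro z hz t
    simp only [Q]
    split_ifs with h
    · exact deriv_ne_zero_of_injOn hHo hd hi hz
    · refine div_ne_zero ?_ (sub_ne_zero.mpr h)
      intro h'
      obtain ⟨h0, h1⟩ := hJH t (sub_eq_zero.mp h' ▸ mem_image_of_mem _ hz)
      rw [hJΨ t h0 h1, sub_eq_zero] at h'
      exact h (hi (semi_im_pos h0 h1) hz h')
  have hTne : ∀ z ∈ H, ∀ t, T t - Ψ z ≠ 0 := fun z hz t h ↦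
    hTn t (sub_eq_zero.mp h ▸ mem_image_of_mem _ hz)
  set E : ℂ → ℂ := fun z ↦ logVar (Q z) + logVar (fun t ↦ T t - Ψ z) with hE
  have hEc : ContinuousOn E H := by
    refine (continuousOn_logVar hQc hQ0).add (continuousOn_logVar ?_ hTne)
    exact (hT.comp continuous_snd).continuousOn.sub
      (hd.continuousOn.comp continuousOn_fst fun p hp ↦ hp.1)
  set N : ℂ → ℂ := fun z ↦ logVar (fun t ↦ J t - Ψ z) + logVar (fun t ↦ T t - Ψ z) with hN
  have hQt : ∀ z ∈ H, Continuous (Q z) := fun z hz ↦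
    hQc.comp_continuous (Continuous.prodMk_right z) fun t ↦ ⟨hz, mem_univ _⟩
  have hNE : ∀ z ∈ H, ‖z‖ ≠ 1 → N z = E z + logVar (fun t : I ↦ semi t - z) := by
    intro z hz hz1
    have hne : ∀ t : I, semi t ≠ z := fun t h ↦ hz1 (h ▸ norm_semi t)
    have : (fun t ↦ J t - Ψ z) = fun t ↦ Q z t * (semi t - z) := by
      ext t
      simp only [Q, if_neg (hne t)]
      rw [div_mul_cancel₀ _ (sub_ne_zero.mpr (hne t))]
    simp only [hN, hE]
    rw [this, logVar_mul (hQt z hz) (g := fun t : I ↦ semi t - z) (hsemi.sub continuous_const)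
        (hQ0 z hz)
      fun t ↦ sub_ne_zero.mpr (hne t)]
    ring
  have hNexp : ∀ z ∈ H, ‖z‖ ≠ 1 → Complex.exp (N z) = 1 := by
    intro z hz hz1
    have hne : ∀ t : I, J t - Ψ z ≠ 0 := fun t h ↦ by
      obtain ⟨h0, h1⟩ := hJH t (sub_eq_zero.mp h ▸ mem_image_of_mem _ hz)
      rw [hJΨ t h0 h1, sub_eq_zero] at h
      have := hi (semi_im_pos h0 h1) hz h
      exact hz1 (this ▸ norm_semi t)
    simp only [hN]
    rw [Complex.exp_add, exp_logVar (f := fun t ↦ J t - Ψ z) (hJ.sub continuous_const) hne,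
      exp_logVar (f := fun t ↦ T t - Ψ z) (hT.sub continuous_const) (hTne z hz), hT0, hT1]
    have := hne 0
    have := hne 1
    field_simp
  have hin : ∀ z ∈ H, ‖z‖ < 1 → N z = E z +
      (Real.pi * Complex.I + (Complex.log (1 + z) - Complex.log (1 - z))) := fun z hz hz1 ↦ by
    rw [hNE z hz hz1.ne, logVar_semi_sub_in hz1]
  have hout : ∀ z ∈ H, 1 < ‖z‖ → N z = E z +
      (Complex.log (1 + z⁻¹) - Complex.log (1 - z⁻¹)) := fun z hz hz1 ↦ by
    rw [hNE z hz hz1.ne', logVar_semi_sub_out hz1]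
  have hlog : ∀ z : ℂ, ‖z‖ < 1 ∨ 0 < z.im ∨ z.im < 0 →
      ContinuousAt (fun z ↦ Complex.log (1 + z) - Complex.log (1 - z)) z := by
    intro z hz
    have h1 : 1 + z ∈ Complex.slitPlane := by
      rcases hz with h | h | h
      · exact one_add_mem_slitPlane h
      · exact Or.inr (by simpa using h.ne')
      · exact Or.inr (by simpa using h.ne)
    have h2 : 1 - z ∈ Complex.slitPlane := by
      rcases hz with h | h | h
      · rw [sub_eq_add_neg]; exact one_add_mem_slitPlane (by rwa [norm_neg])
      · exact Or.inr (by simpa using h.ne')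
      · exact Or.inr (by simpa using h.ne)
    exact ((continuousAt_const.add continuousAt_id).clog h1).sub
      ((continuousAt_const.sub continuousAt_id).clog h2)
  have hNin : ∀ z w, 0 < z.im → ‖z‖ < 1 → 0 < w.im → ‖w‖ < 1 → N z = N w := by
    intro z w hz hz1 hw hw1
    refine exp_constOn isPreconnected_halfPlane_in (N := N) ?_ ?_ ⟨hz, hz1⟩ ⟨hw, hw1⟩
    · refine ContinuousOn.congr (f := fun z ↦ E z +
        (Real.pi * Complex.I + (Complex.log (1 + z) - Complex.log (1 - z)))) ?_
        fun z hz ↦ hin z hz.1 hz.2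
      refine (hEc.mono fun z hz ↦ hz.1).add (continuousOn_const.add ?_)
      exact fun z hz ↦ (hlog z (Or.inl hz.2)).continuousWithinAt
    · intro z hz w hw
      rw [hNexp z hz.1 hz.2.ne, hNexp w hw.1 hw.2.ne]
  have hNout : ∀ z w, 0 < z.im → 1 < ‖z‖ → 0 < w.im → 1 < ‖w‖ → N z = N w := by
    intro z w hz hz1 hw hw1
    refine exp_constOn isPreconnected_halfPlane_out (N := N) ?_ ?_ ⟨hz, hz1⟩ ⟨hw, hw1⟩
    · refine ContinuousOn.congr (f := fun z ↦ E z +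
        (Complex.log (1 + z⁻¹) - Complex.log (1 - z⁻¹))) ?_ fun z hz ↦ hout z hz.1 hz.2
      refine (hEc.mono fun z hz ↦ hz.1).add ?_
      intro z hz
      refine (ContinuousAt.comp (f := fun z : ℂ ↦ z⁻¹)
        (hlog z⁻¹ (Or.inl ?_)) (continuousAt_inv₀ ?_)).continuousWithinAt
      · rw [norm_inv]; exact inv_lt_one_of_one_lt₀ hz.2
      · rintro rfl; simpa using hz.1
    · intro z hz w hw
      rw [hNexp z hz.1 hz.2.ne', hNexp w hw.1 hw.2.ne']
  intro heq
  have hI : Complex.I ∈ H := by simp [hH]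
  have hpath : ContinuousAt (fun s : ℝ ↦ (s : ℂ) * Complex.I) 1 := by fun_prop
  have hE1 : ContinuousAt (fun s : ℝ ↦ E ((s : ℂ) * Complex.I)) 1 := by
    refine ContinuousAt.comp (g := E) (f := fun s : ℝ ↦ (s : ℂ) * Complex.I) ?_ hpath
    simpa using hEc.continuousAt (hHo.mem_nhds hI)
  have hpos : ∀ᶠ s : ℝ in 𝓝 1, 0 < s := lt_mem_nhds one_pos
  have lim1 : E Complex.I + (Real.pi * Complex.I +
      (Complex.log (1 + Complex.I) - Complex.log (1 - Complex.I))) = N z := by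
    have hc : ContinuousAt (fun s : ℝ ↦ E ((s : ℂ) * Complex.I) + (Real.pi * Complex.I +
      (Complex.log (1 + (s : ℂ) * Complex.I) - Complex.log (1 - (s : ℂ) * Complex.I)))) 1 := by
      refine hE1.add (continuousAt_const.add ?_)
      exact ContinuousAt.comp (f := fun s : ℝ ↦ (s : ℂ) * Complex.I)
        (hlog _ (Or.inr (Or.inl (by simp)))) hpath
    have ht := hc.tendsto.mono_left (nhdsWithin_le_nhds (s := Iio (1 : ℝ)))
    simp only [Complex.ofReal_one, one_mul] at ht
    refine tendsto_nhds_unique ht (tendsto_const_nhds.congr' ?_)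
    filter_upwards [eventually_nhdsWithin_of_eventually_nhds hpos,
        self_mem_nhdsWithin] with s hs hs1
    have h1 : 0 < ((s : ℂ) * Complex.I).im := by simpa using hs
    have h2 : ‖(s : ℂ) * Complex.I‖ < 1 := by simpa [abs_of_pos hs] using hs1
    rw [← hin _ h1 h2]
    exact hNin _ _ hz hz1 h1 h2
  have lim2 : E Complex.I + (Complex.log (1 + -Complex.I) - Complex.log (1 - -Complex.I)) = N w :=
      by
    have hc : ContinuousAt (fun s : ℝ ↦ E ((s : ℂ) * Complex.I) +
      (Complex.log (1 + ((s : ℂ) * Complex.I)⁻¹) - Complex.log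
          (1 - ((s : ℂ) * Complex.I)⁻¹))) 1 := by
      refine hE1.add ?_
      exact ContinuousAt.comp (f := fun s : ℝ ↦ ((s : ℂ) * Complex.I)⁻¹)
        (hlog _ (Or.inr (Or.inr (by simp)))) (hpath.inv₀ (by simp))
    have ht := hc.tendsto.mono_left (nhdsWithin_le_nhds (s := Ioi (1 : ℝ)))
    simp only [Complex.ofReal_one, one_mul, Complex.inv_I] at ht
    refine tendsto_nhds_unique ht (tendsto_const_nhds.congr' ?_)
    filter_upwards [eventually_nhdsWithin_of_eventually_nhds hpos,
        self_mem_nhdsWithin] with s hs hs1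
    have h1 : 0 < ((s : ℂ) * Complex.I).im := by simpa using hs
    have h2 : 1 < ‖(s : ℂ) * Complex.I‖ := by simpa [abs_of_pos hs] using hs1
    rw [← hout _ h1 h2]
    exact hNout _ _ hw hw1 h1 h2
  have hfin := lim1.trans (Eq.trans heq lim2.symm)
  have := congrArg Complex.im hfin
  simp [Complex.log_im] at this
  have ha : 0 ≤ Complex.arg (1 + Complex.I) := Complex.arg_nonneg_iff.mpr (by simp)
  have hb : Complex.arg (1 + -Complex.I) < 0 := Complex.arg_neg_iff.mpr (by simp)
  rw [← sub_eq_add_neg] at hb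
  simp only [← sub_eq_add_neg] at this
  linarith [Real.pi_pos]

open MeasureTheory ENNReal in
theorem lintegral_enorm_deriv_sq_lt_top {Ψ : ℂ → ℂ} (hd : DifferentiableOn ℂ Ψ {z | 0 < z.im})
    (hi : InjOn Ψ {z | 0 < z.im}) (hb : Bornology.IsBounded (Ψ '' {z | 0 < z.im})) :
    ∫⁻ z in {z : ℂ | 0 < z.im}, ‖deriv Ψ z‖ₑ ^ 2 < ⊤ := by
  have hHo : IsOpen {z : ℂ | 0 < z.im} := isOpen_lt continuous_const Complex.continuous_im
  have h1 := lintegral_abs_det_fderiv_eq_addHaar_image (volume : Measure ℂ) hHo.measurableSet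
    (f' := fun z ↦ (ContinuousLinearMap.toSpanSingleton ℂ (deriv Ψ z)).restrictScalars ℝ)
    (fun z hz ↦ ((hd.differentiableAt (hHo.mem_nhds hz)).hasDerivAt.hasFDerivAt.restrictScalars
      ℝ).hasFDerivWithinAt) hi
  have h2 : ∀ z, ENNReal.ofReal |((ContinuousLinearMap.toSpanSingleton ℂ
      (deriv Ψ z)).restrictScalars ℝ).det| = ‖deriv Ψ z‖ₑ ^ 2 := by
    intro z
    rw [ContinuousLinearMap.det, ContinuousLinearMap.coe_restrictScalars,
      LinearMap.det_restrictScalars]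
    simp [Algebra.norm_complex_apply, Complex.normSq_eq_norm_sq]
  simp only [h2] at h1
  rw [h1]
  exact hb.measure_lt_top

open MeasureTheory ENNReal in
theorem exists_short_arc {Ψ : ℂ → ℂ} (hd : DifferentiableOn ℂ Ψ {z | 0 < z.im})
    (hi : InjOn Ψ {z | 0 < z.im}) (hb : Bornology.IsBounded (Ψ '' {z | 0 < z.im}))
    {ε : ℝ} (hε : 0 < ε) : ∃ r, 0 < r ∧ r < ε ∧
      ∫⁻ θ in Ioo 0 Real.pi, ‖deriv Ψ (Complex.polarCoord.symm (r, θ))‖ₑ * ENNReal.ofReal r <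
        ENNReal.ofReal ε := by
  have hHo : IsOpen {z : ℂ | 0 < z.im} := isOpen_lt continuous_const Complex.continuous_im
  by_contra! hcon
  set G : ℂ → ℝ≥0∞ := fun z ↦ ‖deriv Ψ z‖ₑ with hG
  have hGm : Measurable G := (measurable_deriv Ψ).enorm
  set F : ℂ → ℝ≥0∞ := {z : ℂ | 0 < z.im}.indicator (fun z ↦ G z ^ 2) with hF
  have hsm : Measurable fun p : ℝ × ℝ ↦ Complex.polarCoord.symm p := by
    simp only [Complex.polarCoord_symm_apply]
    fun_prop
  have h1 : ∫⁻ z, F z < ⊤ := by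
    rw [hF, lintegral_indicator hHo.measurableSet]
    exact lintegral_enorm_deriv_sq_lt_top hd hi hb
  rw [← Complex.lintegral_comp_polarCoord_symm] at h1
  have h2 : ∫⁻ p in Ioo 0 ε ×ˢ Ioo 0 Real.pi,
      ENNReal.ofReal p.1 * G (Complex.polarCoord.symm p) ^ 2 < ⊤ := by
    refine lt_of_le_of_lt ?_ h1
    calc ∫⁻ p in Ioo 0 ε ×ˢ Ioo 0 Real.pi, ENNReal.ofReal p.1 * G (Complex.polarCoord.symm p) ^ 2
        = ∫⁻ p in Ioo 0 ε ×ˢ Ioo 0 Real.pi, ENNReal.ofReal p.1 • F (Complex.polarCoord.symm p) := by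
          refine setLIntegral_congr_fun (measurableSet_Ioo.prod measurableSet_Ioo) fun p hp ↦ ?_
          simp only [hF]
          rw [indicator_of_mem, smul_eq_mul]
          rw [mem_ofPred_eq, Complex.polarCoord_symm_apply]
          have := Real.sin_pos_of_mem_Ioo hp.2
          have h0 := hp.1.1
          simp only [Complex.mul_im, Complex.add_im, Complex.add_re, Complex.ofReal_re,
            Complex.ofReal_im, Complex.mul_re, Complex.I_re, Complex.I_im]
          nlinarith [mul_pos h0 this]
      _ ≤ _ := by
          refine lintegral_mono_set (prod_mono (fun x hx ↦ hx.1) ?_)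
          exact fun x hx ↦ ⟨by linarith [hx.1, Real.pi_pos], hx.2⟩
  rw [Measure.volume_eq_prod, ← Measure.prod_restrict, lintegral_prod] at h2
  swap
  · have hm1 : Measurable fun p : ℝ × ℝ ↦ ENNReal.ofReal p.1 := by fun_prop
    exact (hm1.mul ((hGm.comp hsm).pow_const 2)).aemeasurable
  have h3 : ∀ r ∈ Ioo 0 ε, ENNReal.ofReal (ε ^ 2 / Real.pi) * ‖r⁻¹‖ₑ ≤
      ∫⁻ θ in Ioo 0 Real.pi, ENNReal.ofReal r * G (Complex.polarCoord.symm (r, θ)) ^ 2 := by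
    intro r hr
    have hc := hcon r hr.1 hr.2
    have hm : Measurable fun θ : ℝ ↦ G (Complex.polarCoord.symm (r, θ)) :=
      hGm.comp (hsm.comp (by fun_prop))
    rw [lintegral_mul_const _ hm] at hc
    rw [lintegral_const_mul _ (hm.pow_const 2)]
    have hcs := ENNReal.lintegral_mul_le_Lp_mul_Lq (volume.restrict (Ioo 0 Real.pi))
      Real.HolderConjugate.two_two hm.aemeasurable (aemeasurable_const (b := (1 : ℝ≥0∞)))
    simp only [Pi.mul_apply, mul_one, ENNReal.one_rpow, lintegral_const,
      Measure.restrict_apply_univ, Real.volume_Ioo, sub_zero, one_mul] at hcs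
    set A := ∫⁻ θ in Ioo 0 Real.pi, G (Complex.polarCoord.symm (r, θ)) with hA
    have hcs2 : A ^ 2 ≤ (∫⁻ θ in Ioo 0 Real.pi, G (Complex.polarCoord.symm (r, θ)) ^ 2) *
        ENNReal.ofReal Real.pi := by
      have := pow_le_pow_left' hcs 2
      rw [mul_pow, ← ENNReal.rpow_natCast, ← ENNReal.rpow_natCast, ← ENNReal.rpow_natCast,
        ← ENNReal.rpow_mul, ← ENNReal.rpow_mul] at this
      norm_num at this
      simpa using this
    set B := ∫⁻ θ in Ioo 0 Real.pi, G (Complex.polarCoord.symm (r, θ)) ^ 2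
    have hr0 : ENNReal.ofReal r ≠ 0 := by simpa using hr.1
    have hp0 : ENNReal.ofReal Real.pi ≠ 0 := by simpa using Real.pi_pos
    have h5 : ENNReal.ofReal ε ^ 2 ≤ B * ENNReal.ofReal Real.pi * ENNReal.ofReal r ^ 2 := by
      refine (pow_le_pow_left' hc 2).trans ?_
      rw [mul_pow]
      gcongr
    rw [enorm_inv hr.1.ne', Real.enorm_of_nonneg hr.1.le, ENNReal.ofReal_div_of_pos Real.pi_pos,
      ENNReal.ofReal_pow hε.le, ← div_eq_mul_inv]
    rw [ENNReal.div_le_iff_le_mul (Or.inl hr0) (Or.inl ofReal_ne_top),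
      ENNReal.div_le_iff_le_mul (Or.inl hp0) (Or.inl ofReal_ne_top)]
    refine h5.trans (le_of_eq (by ring))
  have h4 := (setLIntegral_mono' measurableSet_Ioo h3).trans_lt h2
  rw [lintegral_const_mul' _ _ ofReal_ne_top] at h4
  have h6 : ∫⁻ r in Ioo 0 ε, ‖r⁻¹‖ₑ < ⊤ := by
    refine lt_top_iff_ne_top.mpr fun h ↦ ?_
    rw [h, ENNReal.mul_top] at h4
    · exact lt_irrefl _ h4
    · rw [ne_eq, ENNReal.ofReal_eq_zero, not_le]
      have := Real.pi_pos
      positivity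
  have h7 : IntegrableOn (fun r : ℝ ↦ r⁻¹) (Ioo 0 ε) :=
    ⟨measurable_inv.aestronglyMeasurable, h6⟩
  have h8 : IntervalIntegrable (fun r : ℝ ↦ r⁻¹) volume 0 ε := by
    rw [intervalIntegrable_iff_integrableOn_Ioo_of_le hε.le]
    exact h7
  rw [intervalIntegrable_inv_iff] at h8
  rcases h8 with h | h
  · exact hε.ne h
  · exact h left_mem_uIcc

open MeasureTheory ENNReal in
theorem exists_short_semicircle_zero {Ψ : ℂ → ℂ} (hd : DifferentiableOn ℂ Ψ {z | 0 < z.im})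
    (hi : InjOn Ψ {z | 0 < z.im}) (hb : Bornology.IsBounded (Ψ '' {z | 0 < z.im}))
    {ε : ℝ} (hε : 0 < ε) : ∃ r, 0 < r ∧ r < ε ∧ ∃ J : I → ℂ, Continuous J ∧
      (∀ t : I, 0 < (t : ℝ) → (t : ℝ) < 1 → J t = Ψ (r * semi t)) ∧
      ∀ s t, dist (J s) (J t) < ε := by
  have hHo : IsOpen {z : ℂ | 0 < z.im} := isOpen_lt continuous_const Complex.continuous_im
  obtain ⟨r, hr0, hrε, hL⟩ := exists_short_arc hd hi hb hε
  refine ⟨r, hr0, hrε, ?_⟩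
  have hπ := Real.pi_pos
  have hpol : ∀ θ : ℝ, Complex.polarCoord.symm (r, θ) = r * Complex.exp (θ * Complex.I) := by
    intro θ
    rw [Complex.polarCoord_symm_apply, Complex.exp_mul_I]
    simp
  set g : ℝ → ℂ := (Ioo 0 Real.pi).indicator fun θ ↦
    deriv Ψ (r * Complex.exp (θ * Complex.I)) *
        (r * Complex.exp (θ * Complex.I) * Complex.I) with hg
  have hgm : Measurable g := by
    refine Measurable.indicator ?_ measurableSet_Ioo
    exact ((measurable_deriv Ψ).comp (by fun_prop)).mul (by fun_prop)
  have hgn : ∫⁻ θ, ‖g θ‖ₑ < ENNReal.ofReal ε := by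
    simp only [hg, enorm_indicator_eq_indicator_enorm]
    rw [lintegral_indicator measurableSet_Ioo]
    refine lt_of_le_of_lt (le_of_eq ?_) hL
    refine lintegral_congr fun θ ↦ ?_
    rw [hpol, enorm_mul]
    congr 1
    rw [← ofReal_norm]
    simp [Complex.norm_exp_ofReal_mul_I, abs_of_pos hr0]
  have hgi : Integrable g := ⟨hgm.aestronglyMeasurable, hgn.trans ofReal_lt_top⟩
  have hHm : ∀ θ ∈ Ioo 0 Real.pi, 0 < ((r : ℂ) * Complex.exp (θ * Complex.I)).im := by
    intro θ hθ
    rw [Complex.im_ofReal_mul, Complex.exp_ofReal_mul_I_im]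
    exact mul_pos hr0 (Real.sin_pos_of_mem_Ioo hθ)
  have hder : ∀ θ ∈ Ioo 0 Real.pi,
      HasDerivAt (fun θ : ℝ ↦ Ψ (r * Complex.exp (θ * Complex.I))) (g θ) θ := by
    intro θ hθ
    rw [hg, indicator_of_mem hθ]
    have h1 : HasDerivAt (fun θ : ℝ ↦ (r : ℂ) * Complex.exp (θ * Complex.I))
        (r * Complex.exp (θ * Complex.I) * Complex.I) θ := by
      have := (((Complex.ofRealCLM.hasDerivAt (x := θ)).mul_const Complex.I).cexp).const_mul (r : ℂ)
      simpa [mul_assoc] using this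
    exact HasDerivAt.comp_of_eq θ
      ((hd.differentiableAt (hHo.mem_nhds (hHm θ hθ))).hasDerivAt) h1 rfl
  have hFTC : ∀ θ ∈ Ioo 0 Real.pi, ∫ x in (Real.pi / 2)..θ, g x =
      Ψ (r * Complex.exp (θ * Complex.I)) -
        Ψ (r * Complex.exp ((Real.pi / 2 : ℝ) * Complex.I)) := by
    intro θ hθ
    refine intervalIntegral.integral_eq_sub_of_hasDerivAt (fun x hx ↦ hder x ?_)
      hgi.intervalIntegrable
    exact (ordConnected_Ioo.uIcc_subset ⟨by linarith, by linarith⟩ hθ) hx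
  refine ⟨fun t ↦ Ψ (r * Complex.exp ((Real.pi / 2 : ℝ) * Complex.I)) +
    ∫ x in (Real.pi / 2)..(t * Real.pi), g x, ?_, ?_, ?_⟩
  · refine continuous_const.add ?_
    exact (intervalIntegral.continuous_primitive (fun a b ↦ hgi.intervalIntegrable) _).comp
      (by fun_prop)
  · intro t h0 h1
    beta_reduce
    rw [hFTC (t * Real.pi) ⟨by positivity, by nlinarith⟩, semi]
    push_cast
    ring
  · intro s t
    rw [dist_add_left, dist_eq_norm,
      intervalIntegral.integral_interval_sub_left hgi.intervalIntegrable hgi.intervalIntegrable]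
    refine (intervalIntegral.norm_integral_le_integral_norm_uIoc).trans_lt ?_
    have h1 : ∫ x in uIoc (t * Real.pi : ℝ) (s * Real.pi), ‖g x‖ ≤ ∫ x, ‖g x‖ :=
      setIntegral_le_integral hgi.norm (Eventually.of_forall fun x ↦ norm_nonneg _)
    refine h1.trans_lt ?_
    rw [integral_norm_eq_lintegral_enorm hgm.aestronglyMeasurable]
    exact (ENNReal.lt_ofReal_iff_toReal_lt (hgn.trans ofReal_lt_top).ne).mp hgn

theorem exists_short_semicircle {Ψ : ℂ → ℂ} (hd : DifferentiableOn ℂ Ψ {z | 0 < z.im})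
    (hi : InjOn Ψ {z | 0 < z.im}) (hb : Bornology.IsBounded (Ψ '' {z | 0 < z.im})) (x : ℝ)
    {ε : ℝ} (hε : 0 < ε) : ∃ r, 0 < r ∧ r < ε ∧ ∃ J : I → ℂ, Continuous J ∧
      (∀ t : I, 0 < (t : ℝ) → (t : ℝ) < 1 → J t = Ψ (x + r * semi t)) ∧
      ∀ s t, dist (J s) (J t) < ε := by
  have hm : MapsTo (fun z : ℂ ↦ x + z) {z | 0 < z.im} {z | 0 < z.im} := fun z hz ↦ by
    simpa using hz
  exact exists_short_semicircle_zero (Ψ := fun z ↦ Ψ (x + z))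
    (hd.comp (by fun_prop) hm) (hi.comp (add_right_injective _).injOn hm)
    (hb.subset (by rintro _ ⟨z, hz, rfl⟩; exact ⟨_, hm hz, rfl⟩)) hε

theorem crosscut {Ψ : ℂ → ℂ} (hd : DifferentiableOn ℂ Ψ {z | 0 < z.im})
    (hi : InjOn Ψ {z | 0 < z.im}) (x : ℝ) {r : ℝ} (hr : 0 < r) {J T : I → ℂ} (hJ : Continuous J)
    (hJΨ : ∀ t : I, 0 < (t : ℝ) → (t : ℝ) < 1 → J t = Ψ (x + r * semi t))
    (hJ0 : J 0 ∉ Ψ '' {z | 0 < z.im}) (hJ1 : J 1 ∉ Ψ '' {z | 0 < z.im})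
    (hT : Continuous T) (hTn : ∀ t, T t ∉ Ψ '' {z | 0 < z.im})
    (hT0 : T 0 = J 1) (hT1 : T 1 = J 0) {z w : ℂ} (hz : 0 < z.im) (hz1 : dist z x < r)
    (hw : 0 < w.im) (hw1 : r < dist w x) :
    logVar (fun t ↦ J t - Ψ z) + logVar (fun t ↦ T t - Ψ z) ≠
      logVar (fun t ↦ J t - Ψ w) + logVar (fun t ↦ T t - Ψ w) := by
  have hr' : (r : ℂ) ≠ 0 := by exact_mod_cast hr.ne'
  have hm : MapsTo (fun z : ℂ ↦ x + r * z) {z | 0 < z.im} {z | 0 < z.im} := fun z hz ↦ by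
    simpa using mul_pos hr hz
  have hinv : ∀ z : ℂ, (x : ℂ) + r * ((z - x) / r) = z := fun z ↦ by field_simp; ring
  have himg : (fun z ↦ Ψ (x + r * z)) '' {z | 0 < z.im} ⊆ Ψ '' {z | 0 < z.im} := by
    rintro _ ⟨z, hz, rfl⟩; exact ⟨_, hm hz, rfl⟩
  have him : ∀ z : ℂ, 0 < z.im → 0 < ((z - x) / r).im := fun z hz ↦ by
    rw [Complex.div_ofReal_im]; simpa using div_pos hz hr
  have hn : ∀ z : ℂ, ‖(z - x) / r‖ = dist z x / r := fun z ↦ by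
    rw [norm_div, dist_eq_norm, Complex.norm_real, Real.norm_of_nonneg hr.le]
  have := crosscut_unit (Ψ := fun z ↦ Ψ (x + r * z)) (hd.comp (by fun_prop) hm)
    (hi.comp (fun a _ b _ h ↦ by simpa [hr'] using h) hm) hJ hJΨ (fun h ↦ hJ0 (himg h))
    (fun h ↦ hJ1 (himg h)) hT (fun t h ↦ hTn t (himg h)) hT0 hT1 (him z hz)
    (by rw [hn]; exact (div_lt_one hr).mpr hz1) (him w hw)
        (by rw [hn]; exact (one_lt_div hr).mpr hw1)
  simpa only [hinv] using this

/-- `Ψ` maps the upper half plane conformally onto a bounded domain whose frontier lies in the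
uniformly locally path connected set `X` disjoint from the domain. -/
structure IsUniformization (Ψ : ℂ → ℂ) (X : Set ℂ) : Prop where
  diff : DifferentiableOn ℂ Ψ {z | 0 < z.im}
  inj : InjOn Ψ {z | 0 < z.im}
  bdd : Bornology.IsBounded (Ψ '' {z | 0 < z.im})
  frontier_subset : frontier (Ψ '' {z | 0 < z.im}) ⊆ X
  notMem : ∀ p ∈ X, p ∉ Ψ '' {z | 0 < z.im}
  ulc : ∀ ε > 0, ∃ η > 0, ∀ p ∈ X, ∀ q ∈ X, dist p q < η → JoinedIn (X ∩ ball p ε) p q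

theorem isOpen_halfPlane : IsOpen {z : ℂ | 0 < z.im} :=
  isOpen_lt continuous_const Complex.continuous_im

theorem image_mem_nhds_of_injOn {U : Set ℂ} (hU : IsOpen U) {f : ℂ → ℂ}
    (hf : DifferentiableOn ℂ f U) (hi : InjOn f U) {a : ℂ} (ha : a ∈ U) {V : Set ℂ}
    (hV : V ∈ 𝓝 a) : f '' V ∈ 𝓝 (f a) := by
  have h := (hf.analyticAt (hU.mem_nhds ha)).hasStrictDerivAt.map_nhds_eq
    (deriv_ne_zero_of_injOn hU hf hi ha)
  rw [← h]
  exact image_mem_map hV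

namespace IsUniformization

variable {Ψ : ℂ → ℂ} {X : Set ℂ}

theorem limit_mem (h : IsUniformization Ψ X) {ι : Type*} {l : Filter ι} [l.NeBot] {u : ι → ℂ}
    {x p : ℂ} (hx : x.im = 0) (hu : ∀ᶠ i in l, 0 < (u i).im) (hux : Tendsto u l (𝓝 x))
    (hp : Tendsto (fun i ↦ Ψ (u i)) l (𝓝 p)) : p ∈ X := by
  refine h.frontier_subset ⟨?_, fun hintg ↦ ?_⟩
  · exact mem_closure_of_tendsto hp (hu.mono fun i hi ↦ mem_image_of_mem _ hi)
  · obtain ⟨z, hz, rfl⟩ := interior_subset hintg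
    have hz' : 0 < z.im := hz
    have hV : {w : ℂ | z.im / 2 < w.im} ∩ {w | 0 < w.im} ∈ 𝓝 z :=
      inter_mem ((isOpen_lt continuous_const Complex.continuous_im).mem_nhds
        (show z.im / 2 < z.im by linarith)) (isOpen_halfPlane.mem_nhds hz)
    have h1 := hp (image_mem_nhds_of_injOn isOpen_halfPlane h.diff h.inj hz hV)
    have h2 : ∀ᶠ i in l, (u i).im < z.im / 2 :=
      (Complex.continuous_im.tendsto x |>.comp hux).eventually
        (gt_mem_nhds (by rw [hx]; linarith))
    obtain ⟨i, ⟨⟨w, hw, hwi⟩, hi2⟩, hi3⟩ :=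
      ((show ∀ᶠ i in l, Ψ (u i) ∈ Ψ '' _ from h1).and h2 |>.and hu).exists
    have := h.inj hw.2 hi3 hwi
    have h3 := hw.1
    rw [this, mem_ofPred_eq] at h3
    linarith

theorem semicircle_zero_mem (h : IsUniformization Ψ X) (x : ℝ) {r : ℝ} (hr : 0 < r) {J : I → ℂ}
    (hJ : Continuous J)
    (hJΨ : ∀ t : I, 0 < (t : ℝ) → (t : ℝ) < 1 → J t = Ψ (x + r * semi t)) : J 0 ∈ X ∧ J 1 ∈ X := by
  have hpos : ∀ t : ℝ, 0 < t → t < 1 → 0 < ((x : ℂ) + r * semi t).im := fun t h0 h1 ↦ by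
    simpa using mul_pos hr (semi_im_pos h0 h1)
  have hc : Continuous fun t : ℝ ↦ (x : ℂ) + r * semi t :=
    continuous_const.add (continuous_const.mul continuous_semi)
  have hJe : Continuous (Set.IccExtend zero_le_one J) := hJ.Icc_extend'
  have hev0 : ∀ᶠ t : ℝ in 𝓝[>] 0, 0 < t ∧ t < 1 := Ioo_mem_nhdsGT one_pos
  have hev1 : ∀ᶠ t : ℝ in 𝓝[<] 1, 0 < t ∧ t < 1 := Ioo_mem_nhdsLT one_pos
  have hJt : ∀ t : ℝ, 0 < t ∧ t < 1 → IccExtend zero_le_one J t = Ψ (x + r * semi t) := fun t ht ↦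
      by
    rw [IccExtend_of_mem _ _ ⟨ht.1.le, ht.2.le⟩]
    exact hJΨ _ ht.1 ht.2
  constructor
  · refine h.limit_mem (l := 𝓝[>] (0 : ℝ)) (u := fun t ↦ x + r * semi t) (x := x + r * semi 0) ?_
      (hev0.mono fun t ht ↦ hpos t ht.1 ht.2) ((hc.tendsto 0).mono_left nhdsWithin_le_nhds) ?_
    · simp [semi_zero]
    · have h1 := (hJe.tendsto 0).mono_left (nhdsWithin_le_nhds (s := Ioi 0))
      rw [IccExtend_of_mem _ _ ⟨le_rfl, zero_le_one⟩] at h1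
      exact h1.congr' (hev0.mono hJt)
  · refine h.limit_mem (l := 𝓝[<] (1 : ℝ)) (u := fun t ↦ x + r * semi t) (x := x + r * semi 1) ?_
      (hev1.mono fun t ht ↦ hpos t ht.1 ht.2) ((hc.tendsto 1).mono_left nhdsWithin_le_nhds) ?_
    · simp [semi_one]
    · have h1 := (hJe.tendsto 1).mono_left (nhdsWithin_le_nhds (s := Iio 1))
      rw [IccExtend_of_mem _ _ ⟨zero_le_one, le_rfl⟩] at h1
      exact h1.congr' (hev1.mono hJt)

theorem exists_image_subset_ball (h : IsUniformization Ψ X) (x : ℝ) {ε : ℝ} (hε : 0 < ε) :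
    ∃ r > 0, ∃ c, ∀ z : ℂ, 0 < z.im → dist z x < r → Ψ z ∈ ball c ε := by
  set w₁ : ℂ := x + 2 * Complex.I with hw₁
  set w₂ : ℂ := x + 3 * Complex.I with hw₂
  have h1 : 0 < w₁.im := by simp [hw₁]
  have h2 : 0 < w₂.im := by simp [hw₂]
  have hd1 : 1 < dist w₁ x := by simp [hw₁, dist_eq_norm]
  have hd2 : 1 < dist w₂ x := by simp [hw₂, dist_eq_norm]
  have hne : Ψ w₁ ≠ Ψ w₂ := fun he ↦ by
    have := congrArg Complex.im (h.inj h1 h2 he)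
    norm_num [hw₁, hw₂] at this
  have hdist := dist_pos.mpr hne
  set ρ := min ε (dist (Ψ w₁) (Ψ w₂) / 2) with hρ
  have hρ0 : 0 < ρ := lt_min hε (half_pos hdist)
  obtain ⟨η, hη, hulc⟩ := h.ulc (ρ / 2) (half_pos hρ0)
  obtain ⟨r, hr0, hr1, J, hJ, hJΨ, hJd⟩ := exists_short_semicircle h.diff h.inj h.bdd x
    (ε := min (min (ρ / 2) η) 1) (by positivity)
  obtain ⟨hJ0, hJ1⟩ := h.semicircle_zero_mem x hr0 hJ hJΨ
  obtain ⟨T, hT⟩ := hulc _ hJ1 _ hJ0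
    ((hJd 1 0).trans_le ((min_le_left _ _).trans (min_le_right _ _)))
  have hJρ : ∀ s t, dist (J s) (J t) < ρ / 2 := fun s t ↦
    (hJd s t).trans_le ((min_le_left _ _).trans (min_le_left _ _))
  have hJb : ∀ t, J t ∈ ball (J 0) ρ := fun t ↦ by
    have := hJρ t 0
    rw [mem_ball]; linarith
  have hTb : ∀ t, T t ∈ ball (J 0) ρ := fun t ↦ by
    have h3 := (hT t).2
    rw [mem_ball] at h3 ⊢
    linarith [hJρ 1 0, dist_triangle (T t) (J 1) (J 0)]
  have hN : ∀ w, w ∉ ball (J 0) ρ → logVar (fun t ↦ J t - w) + logVar (fun t ↦ T t - w) = 0 := by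
    intro w hw
    rw [logVar_ball hJ hJb hw, logVar_ball T.continuous hTb hw, T.source, T.target]
    ring
  refine ⟨r, hr0, J 0, fun z hz hzr ↦ ?_⟩
  suffices hsuff : Ψ z ∈ ball (J 0) ρ from ball_subset_ball (min_le_left _ _) hsuff
  by_contra hzb
  have hr1' : r < 1 := hr1.trans_le (min_le_right _ _)
  have key : ∀ w : ℂ, 0 < w.im → 1 < dist w x → Ψ w ∈ ball (J 0) ρ := by
    intro w hw hwx
    by_contra hwb
    refine crosscut h.diff h.inj x hr0 hJ hJΨ (h.notMem _ hJ0) (h.notMem _ hJ1) T.continuous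
      (fun t ↦ h.notMem _ (hT t).1) T.source T.target hz hzr hw (hr1'.trans hwx) ?_
    rw [hN _ hzb, hN _ hwb]
  have k1 := key w₁ h1 hd1
  have k2 := key w₂ h2 hd2
  rw [mem_ball] at k1 k2
  have := dist_triangle_right (Ψ w₁) (Ψ w₂) (J 0)
  have := min_le_right ε (dist (Ψ w₁) (Ψ w₂) / 2)
  linarith

theorem exists_tendsto (h : IsUniformization Ψ X) (x : ℝ) :
    ∃ p, Tendsto Ψ (𝓝[{z | 0 < z.im}] (x : ℂ)) (𝓝 p) := by
  have hne : (𝓝[{z : ℂ | 0 < z.im}] (x : ℂ)).NeBot := by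
    rw [← mem_closure_iff_nhdsWithin_neBot, Complex.closure_setOfPred_lt_im]
    simp
  rw [← cauchy_map_iff_exists_tendsto, Metric.cauchy_iff]
  refine ⟨hne.map _, fun ε hε ↦ ?_⟩
  obtain ⟨r, hr, c, hc⟩ := h.exists_image_subset_ball x (half_pos hε)
  refine ⟨ball c (ε / 2), ?_, fun a ha b hb ↦ ?_⟩
  · rw [mem_map]
    filter_upwards [self_mem_nhdsWithin, nhdsWithin_le_nhds (ball_mem_nhds _ hr)] with z hz hzr
    exact hc z hz hzr
  · rw [mem_ball] at ha hb
    linarith [dist_triangle_right a b c]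

theorem exists_extension (h : IsUniformization Ψ X) : ∃ φ : ℂ → ℂ,
    ContinuousOn φ {z | 0 ≤ z.im} ∧ EqOn φ Ψ {z | 0 < z.im} ∧ ∀ x : ℝ, φ x ∈ X := by
  have hcl : {z : ℂ | 0 ≤ z.im} = closure {z : ℂ | 0 < z.im} :=
      (Complex.closure_setOfPred_lt_im 0).symm
  have hlim : ∀ z ∈ {z : ℂ | 0 < z.im}, Tendsto Ψ (𝓝[{z | 0 < z.im}] z) (𝓝 (Ψ z)) := fun z hz ↦
    (h.diff.continuousOn z hz)
  have hc : ContinuousOn (extendFrom {z : ℂ | 0 < z.im} Ψ) {z | 0 ≤ z.im} := by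
    refine continuousOn_extendFrom hcl.le fun z hz ↦ ?_
    rcases (show 0 ≤ z.im from hz).eq_or_lt with h0 | h0
    · have := h.exists_tendsto z.re
      rwa [show ((z.re : ℝ) : ℂ) = z from Complex.ext (by simp) (by simp [← h0])] at this
    · exact ⟨_, hlim z h0⟩
  have heq : EqOn (extendFrom {z : ℂ | 0 < z.im} Ψ) Ψ {z | 0 < z.im} := fun z hz ↦
    extendFrom_eq (subset_closure hz) (hlim z hz)
  refine ⟨_, hc, heq, fun x ↦ ?_⟩
  have hx : (x : ℂ) ∈ {z : ℂ | 0 ≤ z.im} := by simp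
  have hne : (𝓝[{z : ℂ | 0 < z.im}] (x : ℂ)).NeBot := by
    rw [← mem_closure_iff_nhdsWithin_neBot, ← hcl]
    exact hx
  refine h.limit_mem (l := 𝓝[{z : ℂ | 0 < z.im}] (x : ℂ)) (u := id) (x := x) (by simp)
    self_mem_nhdsWithin (tendsto_id.mono_left nhdsWithin_le_nhds) ?_
  refine ((hc x hx).mono_left (nhdsWithin_mono _ fun z hz ↦ (show 0 < z.im from hz).le)).congr' ?_
  filter_upwards [self_mem_nhdsWithin] with z hz using heq hz

end IsUniformization

theorem eq_zero_of_boundary_eq_zero {g : ℂ → ℂ} (hg : ContinuousOn g {z | 0 ≤ z.im})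
    (hd : DifferentiableOn ℂ g {z | 0 < z.im}) {m s : ℝ} (hs : 0 < s)
    (h0 : ∀ x : ℝ, |x - m| ≤ s → g x = 0) : g (m + s * Complex.I) = 0 := by
  set U : Set ℂ := Ioo (-s) s ×ℂ Ioo (-s) s with hU
  have hne : -s < s := by linarith
  have hcl : closure U = Icc (-s) s ×ℂ Icc (-s) s := by
    rw [hU, Complex.closure_reProdIm, closure_Ioo hne.ne]
  have him : ∀ (k : ℕ) (ζ : ℂ), k < 4 → |ζ.re| ≤ s → |ζ.im| ≤ s → |(Complex.I ^ k * ζ).im| ≤ s := by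
    intro k ζ hk h1 h2
    interval_cases k <;> simp [pow_succ, h1, h2]
  have him' : ∀ (k : ℕ) (ζ : ℂ), k < 4 → |ζ.re| < s → |ζ.im| < s → |(Complex.I ^ k * ζ).im| < s :=
      by
    intro k ζ hk h1 h2
    interval_cases k <;> simp [pow_succ, h1, h2]
  set F : ℂ → ℂ := fun ζ ↦ ∏ k ∈ Finset.range 4, g (m + s * Complex.I + Complex.I ^ k * ζ) with hF
  have hFd : DiffContOnCl ℂ F U := by
    constructor
    · refine DifferentiableOn.fun_finsetProd fun k hk ↦ ?_
      refine hd.comp (by fun_prop) fun ζ hζ ↦ ?_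
      have := abs_lt.mp (him' k ζ (Finset.mem_range.mp hk) (abs_lt.mpr hζ.1) (abs_lt.mpr hζ.2))
      simp only [mem_ofPred_eq, Complex.add_im, Complex.ofReal_im, Complex.im_ofReal_mul,
        Complex.I_im]
      linarith [this.1]
    · rw [hcl]
      refine continuousOn_finsetProd _ fun k hk ↦ ?_
      refine hg.comp (by fun_prop) fun ζ hζ ↦ ?_
      have := abs_le.mp (him k ζ (Finset.mem_range.mp hk) (abs_le.mpr hζ.1) (abs_le.mpr hζ.2))
      simp only [mem_ofPred_eq, Complex.add_im, Complex.ofReal_im, Complex.im_ofReal_mul,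
        Complex.I_im]
      linarith [this.1]
  have hFf : ∀ ζ ∈ frontier U, ‖F ζ‖ ≤ 0 := by
    intro ζ hζ
    rw [norm_le_zero_iff, hF]
    have hmem : ζ ∈ closure U := frontier_subset_closure hζ
    rw [hcl] at hmem
    have hnot : ζ ∉ U := by
      rw [frontier, IsOpen.interior_eq (isOpen_Ioo.reProdIm isOpen_Ioo)] at hζ
      exact hζ.2
    have key : ∃ k < 4, (Complex.I ^ k * ζ).im = -s := by
      by_contra! hcon
      refine hnot ⟨⟨?_, ?_⟩, ⟨?_, ?_⟩⟩
      · refine lt_of_le_of_ne hmem.1.1 fun h ↦ hcon 1 (by norm_num) ?_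
        simp [← h]
      · refine lt_of_le_of_ne hmem.1.2 fun h ↦ hcon 3 (by norm_num) ?_
        simp [pow_succ, ← h]
      · refine lt_of_le_of_ne hmem.2.1 fun h ↦ hcon 0 (by norm_num) ?_
        simp [← h]
      · refine lt_of_le_of_ne hmem.2.2 fun h ↦ hcon 2 (by norm_num) ?_
        simp [← h]
    obtain ⟨k, hk, hki⟩ := key
    refine Finset.prod_eq_zero (Finset.mem_range.mpr hk) ?_
    have hre : |(Complex.I ^ k * ζ).re| ≤ s := by
      have h1 := abs_le.mpr hmem.1
      have h2 := abs_le.mpr hmem.2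
      interval_cases k <;> simp [pow_succ, h1, h2]
    have : (m : ℂ) + s * Complex.I + Complex.I ^ k * ζ = ((m + (Complex.I ^ k * ζ).re : ℝ) : ℂ) :=
        by
      apply Complex.ext
      · simp
      · simp only [Complex.add_im, Complex.ofReal_im, Complex.im_ofReal_mul, Complex.I_im, hki]
        ring
    rw [this]
    exact h0 _ (by simpa using hre)
  have hbdd : Bornology.IsBounded U := by
    refine (IsCompact.isBounded ?_).subset subset_closure
    rw [hcl]
    exact isCompact_Icc.reProdIm isCompact_Icc
  have h00 : (0 : ℂ) ∈ closure U := by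
    rw [hcl]; exact ⟨⟨by simp [hs.le], by simp [hs.le]⟩, ⟨by simp [hs.le], by simp [hs.le]⟩⟩
  have := Complex.norm_le_of_forall_mem_frontier_norm_le hbdd hFd hFf h00
  rw [norm_le_zero_iff, hF] at this
  simpa using this

namespace IsUniformization

variable {Ψ : ℂ → ℂ} {X : Set ℂ}

theorem exists_ne_of_interval (h : IsUniformization Ψ X) {φ : ℂ → ℂ}
    (hφ : ContinuousOn φ {z | 0 ≤ z.im}) (heq : EqOn φ Ψ {z | 0 < z.im}) {p : ℂ} (hp : p ∈ X)
    {a b : ℝ} (hab : a < b) : ∃ x ∈ Icc a b, φ (x : ℝ) ≠ p := by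
  by_contra! hcon
  have := eq_zero_of_boundary_eq_zero (g := fun z ↦ φ z - p) (hφ.sub continuousOn_const)
    ((h.diff.congr heq).sub_const p) (m := (a + b) / 2) (s := (b - a) / 2) (by linarith)
    (fun x hx ↦ by
      rw [abs_le] at hx
      rw [hcon x ⟨by linarith, by linarith⟩, sub_self])
  have hz : 0 < ((((a + b) / 2 : ℝ) : ℂ) + ((b - a) / 2 : ℝ) * Complex.I).im := by
    simp; linarith
  rw [heq hz, sub_eq_zero] at this
  exact h.notMem p hp ⟨_, hz, this⟩

theorem extension_ne_of_lt (h : IsUniformization Ψ X) (hX : ∀ p ∈ X, IsPreconnected (X \ {p}))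
    {φ : ℂ → ℂ} (hφ : ContinuousOn φ {z | 0 ≤ z.im}) (heq : EqOn φ Ψ {z | 0 < z.im})
    (hφX : ∀ x : ℝ, φ x ∈ X) {a b : ℝ} (hab : a < b) : φ a ≠ φ b := by
  intro hpq
  set p := φ a with hp
  have hpX : p ∈ X := hφX a
  set x := (a + b) / 2 with hx
  set r := (b - a) / 2 with hr
  have hr0 : 0 < r := by rw [hr]; linarith
  obtain ⟨y, hy, hyp⟩ := h.exists_ne_of_interval hφ heq hpX hab
  obtain ⟨y', hy', hyp'⟩ := h.exists_ne_of_interval hφ heq hpX (show b < b + 1 by linarith)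
  have hya : a < y := lt_of_le_of_ne hy.1 fun h' ↦ hyp (by rw [← h'])
  have hyb : y < b := lt_of_le_of_ne hy.2 fun h' ↦ hyp (by rw [h', ← hpq])
  have hyb' : b < y' := lt_of_le_of_ne hy'.1 fun h' ↦ hyp' (by rw [← h', ← hpq])
  set J : I → ℂ := fun t ↦ φ (x + r * semi t) with hJdef
  have hclosed : ∀ t : I, 0 ≤ ((x : ℂ) + r * semi t).im := fun t ↦ by
    have : 0 ≤ (semi t).im := by
      rw [semi_im]
      exact Real.sin_nonneg_of_nonneg_of_le_pi (mul_nonneg t.2.1 Real.pi_pos.le)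
        (by nlinarith [t.2.2, Real.pi_pos])
    simpa using mul_nonneg hr0.le this
  have hJ : Continuous J := hφ.comp_continuous
    (continuous_const.add (continuous_const.mul (continuous_semi.comp continuous_subtype_val)))
    hclosed
  have hJΨ : ∀ t : I, 0 < (t : ℝ) → (t : ℝ) < 1 → J t = Ψ (x + r * semi t) := fun t h0 h1 ↦ by
    refine heq ?_
    simpa using mul_pos hr0 (semi_im_pos h0 h1)
  have hJ0 : J 0 = p := by
    rw [hpq]
    simp only [hJdef, hx, hr, Set.Icc.coe_zero, semi_zero]
    congr 1
    push_cast
    ring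
  have hJ1 : J 1 = p := by
    simp only [hJdef, hx, hr, Set.Icc.coe_one, semi_one, hp]
    congr 1
    push_cast
    ring
  have hrange : ∀ q ∈ X, q ≠ p → ∀ t, J t ≠ q := by
    intro q hq hqp t ht
    rcases t.2.1.eq_or_lt with h0 | h0
    · rw [show t = 0 from Subtype.ext h0.symm, hJ0] at ht
      exact hqp ht.symm
    rcases t.2.2.eq_or_lt with h1 | h1
    · rw [show t = 1 from Subtype.ext h1, hJ1] at ht
      exact hqp ht.symm
    rw [hJΨ t h0 h1] at ht
    refine h.notMem q hq ⟨_, ?_, ht⟩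
    simpa using mul_pos hr0 (semi_im_pos h0 h1)
  set N : ℂ → ℂ := fun w ↦ logVar (fun t ↦ J t - w) with hNdef
  have hNc : ContinuousOn N (range J)ᶜ :=
    continuousOn_logVar (F := fun w t ↦ J t - w)
      ((hJ.comp continuous_snd).sub continuous_fst).continuousOn
      fun w hw t ht ↦ hw ⟨t, sub_eq_zero.mp ht⟩
  have hNe : ∀ w ∈ (range J)ᶜ, Complex.exp (N w) = 1 := by
    intro w hw
    have hne : ∀ t, J t - w ≠ 0 := fun t ht ↦ hw ⟨t, sub_eq_zero.mp ht⟩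
    rw [hNdef]
    beta_reduce
    rw [exp_logVar (f := fun t ↦ J t - w) (hJ.sub continuous_const) hne, hJ0, hJ1, div_self]
    exact hJ0 ▸ hne 0
  have hNconst : ∀ S ⊆ (range J)ᶜ, IsPreconnected S → ∀ w ∈ S, ∀ w' ∈ S, N w = N w' :=
    fun S hS hSc w hw w' hw' ↦ exp_constOn hSc (hNc.mono hS)
      (fun u hu v hv ↦ by rw [hNe u (hS hu), hNe v (hS hv)]) hw hw'
  have hNX : N (φ y) = N (φ y') :=
    hNconst _ (fun q hq ⟨t, ht⟩ ↦ hrange q hq.1 hq.2 t ht) (hX p hpX) _ ⟨hφX y, hyp⟩ _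
        ⟨hφX y', hyp'⟩
  have hcompl : IsOpen (range J)ᶜ := (isCompact_range hJ).isClosed.isOpen_compl
  have happrox : ∀ u : ℝ, φ u ≠ p → ∀ᶠ z in 𝓝[{z : ℂ | 0 < z.im}] (u : ℂ), N (Ψ z) = N (φ u) := by
    intro u hu
    obtain ⟨δ, hδ, hball⟩ := Metric.isOpen_iff.mp hcompl (φ u)
      (fun ⟨t, ht⟩ ↦ hrange _ (hφX u) hu t ht)
    have h1 := (hφ u (by simp)).mono_left (nhdsWithin_mono _ (show {z : ℂ | 0 < z.im} ⊆
      {z | 0 ≤ z.im} from fun z hz ↦ (show 0 < z.im from hz).le))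
    filter_upwards [h1 (ball_mem_nhds _ hδ), self_mem_nhdsWithin] with z hz hz0
    rw [mem_preimage, heq hz0] at hz
    exact hNconst _ hball (convex_ball _ _).isPreconnected _ hz _ (mem_ball_self hδ)
  have hnb : ∀ u : ℝ, (𝓝[{z : ℂ | 0 < z.im}] (u : ℂ)).NeBot := fun u ↦ by
    rw [← mem_closure_iff_nhdsWithin_neBot, Complex.closure_setOfPred_lt_im]
    simp
  have hin : ∀ᶠ z : ℂ in 𝓝[{z : ℂ | 0 < z.im}] (y : ℂ), dist z x < r := by
    refine nhdsWithin_le_nhds ((continuous_id.dist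
        continuous_const).continuousAt.eventually_lt_const ?_)
    beta_reduce
    rw [id_eq, Complex.dist_of_im_eq (by simp), Real.dist_eq]
    simp only [Complex.ofReal_re]
    rw [abs_lt]
    constructor <;> linarith
  have hout : ∀ᶠ z : ℂ in 𝓝[{z : ℂ | 0 < z.im}] (y' : ℂ), r < dist z x := by
    refine nhdsWithin_le_nhds ((continuous_id.dist
        continuous_const).continuousAt.eventually_const_lt ?_)
    beta_reduce
    rw [id_eq, Complex.dist_of_im_eq (by simp), Real.dist_eq]
    simp only [Complex.ofReal_re]
    exact lt_of_lt_of_le (by linarith) (le_abs_self _)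
  obtain ⟨z, ⟨hz1, hz2⟩, hz3⟩ := (((happrox y hyp).and hin).and
    (show ∀ᶠ z in 𝓝[{z : ℂ | 0 < z.im}] (y : ℂ), 0 < z.im from self_mem_nhdsWithin)).exists
  obtain ⟨w, ⟨hw1, hw2⟩, hw3⟩ := (((happrox y' hyp').and hout).and
    (show ∀ᶠ z in 𝓝[{z : ℂ | 0 < z.im}] (y' : ℂ), 0 < z.im from self_mem_nhdsWithin)).exists
  have hTz : ∀ v, 0 < v.im → logVar (fun _ : I ↦ p - Ψ v) = 0 := fun v hv ↦ by
    have hne : p - Ψ v ≠ 0 := fun h' ↦ h.notMem p hpX ⟨v, hv, (sub_eq_zero.mp h').symm⟩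
    rw [logVar_eq (L := fun _ ↦ Complex.log (p - Ψ v)) continuous_const
      fun _ ↦ Complex.exp_log hne, sub_self]
  refine crosscut h.diff h.inj x hr0 hJ hJΨ (by rw [hJ0]; exact h.notMem p hpX)
    (by rw [hJ1]; exact h.notMem p hpX) (T := fun _ ↦ p) continuous_const
    (fun _ ↦ h.notMem p hpX) hJ1.symm hJ0.symm hz3 hz2 hw3 hw2 ?_
  rw [hTz z hz3, hTz w hw3, add_zero, add_zero]
  exact hz1.trans (hNX.trans hw1.symm)

theorem injective_extension (h : IsUniformization Ψ X) (hX : ∀ p ∈ X, IsPreconnected (X \ {p}))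
    {φ : ℂ → ℂ} (hφ : ContinuousOn φ {z | 0 ≤ z.im}) (heq : EqOn φ Ψ {z | 0 < z.im})
    (hφX : ∀ x : ℝ, φ x ∈ X) : Function.Injective fun x : ℝ ↦ φ x := by
  intro a b hab
  rcases lt_trichotomy a b with hlt | he | hlt
  · exact absurd hab (h.extension_ne_of_lt hX hφ heq hφX hlt)
  · exact he
  · exact absurd hab.symm (h.extension_ne_of_lt hX hφ heq hφX hlt)

theorem im_sub_inv_pos (c : ℝ) {z : ℂ} (hz : 0 < z.im) : 0 < ((c : ℂ) - z⁻¹).im := by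
  have : z ≠ 0 := by rintro rfl; simp at hz
  simp only [Complex.sub_im, Complex.ofReal_im, Complex.inv_im, zero_sub, neg_div, neg_neg]
  exact div_pos hz (Complex.normSq_pos.mpr this)

theorem image_comp_inv (Ψ : ℂ → ℂ) (c : ℝ) :
    (fun z ↦ Ψ (c - z⁻¹)) '' {z : ℂ | 0 < z.im} = Ψ '' {z | 0 < z.im} := by
  apply Subset.antisymm
  · rintro _ ⟨z, hz, rfl⟩
    exact ⟨_, im_sub_inv_pos c hz, rfl⟩
  · rintro _ ⟨w, hw, rfl⟩
    have hw' : 0 < (w - c).im := by simpa using hw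
    have hwc : w - c ≠ 0 := by intro h0; rw [h0] at hw'; simp at hw'
    refine ⟨-(w - c)⁻¹, ?_, ?_⟩
    · have := im_sub_inv_pos c hw'
      simpa using this
    · simp [inv_neg]

theorem comp_inv (h : IsUniformization Ψ X) (c : ℝ) :
    IsUniformization (fun z ↦ Ψ (c - z⁻¹)) X := by
  have himg := image_comp_inv Ψ c
  refine ⟨?_, ?_, himg ▸ h.bdd, himg ▸ h.frontier_subset, himg ▸ h.notMem, h.ulc⟩
  · refine h.diff.comp ?_ fun z ↦ im_sub_inv_pos c
    refine (differentiableOn_const _).sub (differentiableOn_inv.mono ?_)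
    rintro z hz rfl
    simp at hz
  · exact h.inj.comp (fun a _ b _ hab ↦ by simpa using hab) fun z ↦ im_sub_inv_pos c

/-- Continuous injective extension of a conformal map to the closed half plane and to infinity. -/
theorem exists_boundary_map (h : IsUniformization Ψ X) (hX : ∀ p ∈ X, IsPreconnected (X \ {p})) :
    ∃ φ : ℂ → ℂ, ContinuousOn φ {z | 0 ≤ z.im} ∧ EqOn φ Ψ {z | 0 < z.im} ∧
      (∀ x : ℝ, φ x ∈ X) ∧ (Function.Injective fun x : ℝ ↦ φ x) ∧
      ∃ L ∈ X, Tendsto φ (Bornology.cobounded ℂ ⊓ 𝓟 {z | 0 ≤ z.im}) (𝓝 L) ∧ ∀ x : ℝ, φ x ≠ L := by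
  obtain ⟨φ, hφ, heq, hφX⟩ := h.exists_extension
  have hinj := h.injective_extension hX hφ heq hφX
  have hsub : {z : ℂ | 0 < z.im} ⊆ {z | 0 ≤ z.im} := fun z hz ↦ (show 0 < z.im from hz).le
  have hcl : closure {z : ℂ | 0 < z.im} = {z : ℂ | 0 ≤ z.im} := Complex.closure_setOfPred_lt_im 0
  have hmain : ∀ c : ℝ, ∃ L ∈ X, Tendsto φ (Bornology.cobounded ℂ ⊓ 𝓟 {z | 0 ≤ z.im}) (𝓝 L) ∧
      ∀ x : ℝ, x ≠ c → φ x ≠ L := by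
    intro c
    obtain ⟨φ', hφ', heq', hφX'⟩ := (h.comp_inv c).exists_extension
    have hinj' := (h.comp_inv c).injective_extension hX hφ' heq' hφX'
    have hsubinv : ∀ z : ℂ, 0 ≤ z.im → 0 ≤ (((c : ℂ) - z)⁻¹).im := fun z hz ↦ by
      rw [Complex.inv_im]
      exact div_nonneg (by simpa using hz) (Complex.normSq_nonneg _)
    have hrel : ∀ z : ℂ, 0 ≤ z.im → z ≠ c → φ z = φ' (c - z)⁻¹ := by
      intro z hz hzc
      have hne : (c : ℂ) - z ≠ 0 := sub_ne_zero.mpr (Ne.symm hzc)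
      have hmem : z ∈ closure ({z : ℂ | 0 < z.im} ∩ {(c : ℂ)}ᶜ) := by
        have h1 : {(c : ℂ)}ᶜ ∈ 𝓝 z := isOpen_compl_singleton.mem_nhds hzc
        rw [mem_closure_iff_nhdsWithin_neBot, nhdsWithin_inter_of_mem' (nhdsWithin_le_nhds h1),
          ← mem_closure_iff_nhdsWithin_neBot, hcl]
        exact hz
      have hnb := mem_closure_iff_nhdsWithin_neBot.mp hmem
      have t1 : Tendsto φ (𝓝[{z : ℂ | 0 < z.im} ∩ {(c : ℂ)}ᶜ] z) (𝓝 (φ z)) :=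
        (hφ z hz).mono_left (nhdsWithin_mono _ (inter_subset_left.trans hsub))
      have t2 : Tendsto (fun w ↦ φ' (c - w)⁻¹) (𝓝[{z : ℂ | 0 < z.im} ∩ {(c : ℂ)}ᶜ] z)
          (𝓝 (φ' (c - z)⁻¹)) := by
        refine (hφ' _ (hsubinv z hz)).tendsto.comp (tendsto_nhdsWithin_iff.mpr ⟨?_, ?_⟩)
        · exact (((continuous_const.sub continuous_id).tendsto z).inv₀ hne).mono_left
            nhdsWithin_le_nhds
        · filter_upwards [self_mem_nhdsWithin] with w hw using hsubinv w (hsub hw.1)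
      refine tendsto_nhds_unique t1 (t2.congr' ?_)
      filter_upwards [self_mem_nhdsWithin] with w hw
      have hw0 : 0 < w.im := hw.1
      have hwc : (c : ℂ) - w ≠ 0 := sub_ne_zero.mpr fun h ↦ hw.2 h.symm
      have : 0 < (((c : ℂ) - w)⁻¹).im := by
        rw [Complex.inv_im]
        exact div_pos (by simpa using hw0) (Complex.normSq_pos.mpr hwc)
      rw [heq hw0, heq' this]
      simp
    refine ⟨φ' ((0 : ℝ) : ℂ), hφX' 0, ?_, ?_⟩
    · have hev : ∀ᶠ z : ℂ in Bornology.cobounded ℂ ⊓ 𝓟 {z | 0 ≤ z.im}, z ≠ c ∧ 0 ≤ z.im := by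
        refine Filter.Eventually.and (Filter.Eventually.filter_mono inf_le_left ?_)
          (Filter.Eventually.filter_mono inf_le_right (mem_principal_self _))
        exact Bornology.eventually_ne_cobounded _
      have hcob : Tendsto (fun z : ℂ ↦ ((c : ℂ) - z)⁻¹) (Bornology.cobounded ℂ ⊓ 𝓟 {z | 0 ≤ z.im})
          (𝓝[{z | 0 ≤ z.im}] ((0 : ℝ) : ℂ)) := by
        refine tendsto_nhdsWithin_iff.mpr ⟨?_, hev.mono fun z hz ↦ hsubinv z hz.2⟩
        rw [Complex.ofReal_zero]
        refine tendsto_inv₀_cobounded.comp (Tendsto.mono_left ?_ inf_le_left)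
        exact tendsto_const_sub_cobounded _
      refine ((hφ' _ (by simp)).tendsto.comp hcob).congr' ?_
      exact hev.mono fun z hz ↦ (hrel z hz.2 hz.1).symm
    · intro x hx hx0
      rw [hrel x (by simp) (by exact_mod_cast hx)] at hx0
      have : (((c - x)⁻¹ : ℝ) : ℂ) = ((c : ℂ) - x)⁻¹ := by push_cast; rfl
      rw [← this] at hx0
      have := hinj' hx0
      exact hx (sub_eq_zero.mp (inv_eq_zero.mp this)).symm
  refine ⟨φ, hφ, heq, hφX, hinj, ?_⟩
  obtain ⟨L, hL, ht, hne⟩ := hmain 0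
  obtain ⟨L', hL', ht', hne'⟩ := hmain 1
  have hnb : (Bornology.cobounded ℂ ⊓ 𝓟 {z : ℂ | 0 ≤ z.im}).NeBot := by
    have : Tendsto (fun n : ℕ ↦ (n : ℂ)) atTop (Bornology.cobounded ℂ ⊓ 𝓟 {z : ℂ | 0 ≤ z.im}) := by
      rw [tendsto_inf, tendsto_principal]
      refine ⟨?_, Eventually.of_forall fun n ↦ by simp⟩
      rw [← tendsto_norm_atTop_iff_cobounded]
      simpa using tendsto_natCast_atTop_atTop (R := ℝ)
    exact this.neBot
  have hLL : L = L' := tendsto_nhds_unique ht ht'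
  refine ⟨L, hL, ht, fun x ↦ ?_⟩
  by_cases hx : x = 0
  · exact hLL ▸ hne' x (by rw [hx]; norm_num)
  · exact hne x hx

end IsUniformization

theorem eq_zero_of_exp_eq_one {x : ℂ} (h : Complex.exp x = 1) (hx : ‖x‖ < 6) : x = 0 := by
  obtain ⟨n, hn⟩ := Complex.exp_eq_one_iff.mp h
  rcases eq_or_ne n 0 with rfl | h0
  · simpa using hn
  have h1 : (1 : ℝ) ≤ |(n : ℝ)| := by exact_mod_cast Int.one_le_abs h0
  rw [hn] at hx
  simp only [norm_mul, Complex.norm_intCast, Complex.norm_ofNat, Complex.norm_real,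
    Complex.norm_I, mul_one, Real.norm_eq_abs, abs_of_pos Real.pi_pos] at hx
  nlinarith [Real.pi_gt_three]

/-- The sum of the values of a discrete one-form, given by its values on horizontal and vertical
edges, around the lattice square with lower left corner `(m, n)`. -/
def squareSum (a b : ℤ → ℤ → ℂ) (m n : ℤ) : ℂ :=
  a m n + b (m + 1) n - a m (n + 1) - b m n

theorem exists_int_sum (f : ℤ → ℂ) : ∃ S : ℤ → ℂ, ∀ n, S (n + 1) - S n = f n := by
  refine ⟨fun n ↦ ∑ i ∈ Finset.range n.toNat, f i
    - ∑ i ∈ Finset.range (-n).toNat, f (-1 - i), fun n ↦ ?_⟩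
  rcases le_or_gt 0 n with h | h
  · lift n to ℕ using h
    have h1 : ((n : ℤ) + 1).toNat = n + 1 := by omega
    have h2 : (-((n : ℤ) + 1)).toNat = 0 := by omega
    have h3 : (-(n : ℤ)).toNat = 0 := by omega
    simp only [h1, h2, h3, Finset.sum_range_succ]
    simp
  · obtain ⟨k, rfl⟩ : ∃ k : ℕ, n = -1 - k := ⟨(-1 - n).toNat, by omega⟩
    have h1 : ((-1 - (k : ℤ)) + 1).toNat = 0 := by omega
    have h2 : (-((-1 - (k : ℤ)) + 1)).toNat = k := by omega
    have h3 : (-(-1 - (k : ℤ))).toNat = k + 1 := by omega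
    have h4 : (-1 - (k : ℤ)).toNat = 0 := by omega
    simp only [h1, h2, h3, h4, Finset.sum_range_succ]
    simp

theorem int_const {X : Type*} {f : ℤ → X} (h : ∀ n, f (n + 1) = f n) (n : ℤ) : f n = f 0 := by
  induction n with
  | zero => rfl
  | succ i hi => rw [h, hi]
  | pred i hi => rw [← hi, ← h (-i - 1)]; congr 1; ring

theorem exists_lattice_potential {a b : ℤ → ℤ → ℂ} (h : ∀ m n, squareSum a b m n = 0) :
    ∃ F : ℤ → ℤ → ℂ, (∀ m n, F (m + 1) n - F m n = a m n) ∧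
      ∀ m n, F m (n + 1) - F m n = b m n := by
  obtain ⟨S, hS⟩ := exists_int_sum fun m ↦ a m 0
  choose T hT using fun m ↦ exists_int_sum (b m)
  refine ⟨fun m n ↦ S m + T m n - T m 0, fun m n ↦ ?_, fun m n ↦ ?_⟩
  · have := int_const (f := fun n ↦ S (m + 1) + T (m + 1) n - T (m + 1) 0
      - (S m + T m n - T m 0) - a m n) (fun n ↦ by
        have := h m n
        rw [squareSum] at this
        linear_combination hT (m + 1) n - hT m n + this) n
    linear_combination this + hS m
  · linear_combination hT m n

/-- The lattice point `(m, n)`, seen from the center of the unit square. -/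
noncomputable def fromCenter (m n : ℤ) : ℂ := (m - 1 / 2) + (n - 1 / 2) * Complex.I

theorem fromCenter_re (m n : ℤ) : (fromCenter m n).re = m - 1 / 2 := by
  simp [fromCenter]

theorem fromCenter_im (m n : ℤ) : (fromCenter m n).im = n - 1 / 2 := by
  simp [fromCenter]

theorem fromCenter_ne_zero (m n : ℤ) : fromCenter m n ≠ 0 := by
  intro h
  have := congrArg Complex.re h
  rw [fromCenter_re, Complex.zero_re] at this
  have h2 : (2 * m : ℝ) = 1 := by linarith
  norm_cast at h2
  omega

theorem log_div_of_re_pos {u z w : ℂ} (hz : 0 < (u * z).re) (hw : 0 < (u * w).re) :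
    Complex.log (w / z) = Complex.log (u * w) - Complex.log (u * z) := by
  have hu : u ≠ 0 := by rintro rfl; simp at hz
  have hz0 : z ≠ 0 := by rintro rfl; simp at hz
  have hw0 : w ≠ 0 := by rintro rfl; simp at hw
  have h1 := abs_lt.mp (Complex.abs_arg_lt_pi_div_two_iff.mpr (Or.inl hz))
  have h2 := abs_lt.mp (Complex.abs_arg_lt_pi_div_two_iff.mpr (Or.inl hw))
  have : w / z = Complex.exp (Complex.log (u * w) - Complex.log (u * z)) := by
    rw [Complex.exp_sub, Complex.exp_log (mul_ne_zero hu hw0), Complex.exp_log (mul_ne_zero hu hz0)]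
    field_simp
  rw [this, Complex.log_exp]
  · simp only [Complex.sub_im, Complex.log_im]; linarith [Real.pi_pos]
  · simp only [Complex.sub_im, Complex.log_im]; linarith [Real.pi_pos]

theorem squareSum_fromCenter (m n : ℤ) :
    squareSum (fun m n ↦ Complex.log (fromCenter (m + 1) n / fromCenter m n))
      (fun m n ↦ Complex.log (fromCenter m (n + 1) / fromCenter m n)) m n =
    if m = 0 ∧ n = 0 then 2 * Real.pi * Complex.I else 0 := by
  have key : ∀ u : ℂ, (∀ i ∈ ({m, m + 1} : Set ℤ), ∀ j ∈ ({n, n + 1} : Set ℤ),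
      0 < (u * fromCenter i j).re) →
      squareSum (fun m n ↦ Complex.log (fromCenter (m + 1) n / fromCenter m n))
      (fun m n ↦ Complex.log (fromCenter m (n + 1) / fromCenter m n)) m n = 0 := by
    intro u hu
    have h00 := hu m (by simp) n (by simp)
    have h10 := hu (m + 1) (by simp) n (by simp)
    have h01 := hu m (by simp) (n + 1) (by simp)
    have h11 := hu (m + 1) (by simp) (n + 1) (by simp)
    rw [squareSum, log_div_of_re_pos h00 h10, log_div_of_re_pos h10 h11,
      log_div_of_re_pos h01 h11, log_div_of_re_pos h00 h01]
    ring
  have cast1 : ∀ i : ℤ, 1 ≤ i → (1 : ℝ) ≤ i := fun i hi ↦ by exact_mod_cast hi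
  have cast2 : ∀ i : ℤ, i ≤ 0 → (i : ℝ) ≤ 0 := fun i hi ↦ by exact_mod_cast hi
  split_ifs with h
  · obtain ⟨rfl, rfl⟩ := h
    have e1 : fromCenter (0 + 1) 0 / fromCenter 0 0 = Complex.I := by
      rw [div_eq_iff (fromCenter_ne_zero _ _)]
      apply Complex.ext <;> (simp [fromCenter]; try norm_num)
    have e2 : fromCenter (0 + 1) (0 + 1) / fromCenter (0 + 1) 0 = Complex.I := by
      rw [div_eq_iff (fromCenter_ne_zero _ _)]
      apply Complex.ext <;> (simp [fromCenter]; try norm_num)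
    have e3 : fromCenter (0 + 1) (0 + 1) / fromCenter 0 (0 + 1) = -Complex.I := by
      rw [div_eq_iff (fromCenter_ne_zero _ _)]
      apply Complex.ext <;> (simp [fromCenter]; try norm_num)
    have e4 : fromCenter 0 (0 + 1) / fromCenter 0 0 = -Complex.I := by
      rw [div_eq_iff (fromCenter_ne_zero _ _)]
      apply Complex.ext <;> (simp [fromCenter]; try norm_num)
    rw [squareSum, e1, e2, e3, e4, Complex.log_I, Complex.log_neg_I]
    ring
  · have h' : 1 ≤ m ∨ m + 1 ≤ 0 ∨ 1 ≤ n ∨ n + 1 ≤ 0 := by omega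
    rcases h' with h | h | h | h
    · refine key 1 fun i hi j _ ↦ ?_
      have := cast1 i (by rcases hi with rfl | rfl <;> omega)
      simp only [one_mul, fromCenter_re]; linarith
    · refine key (-1) fun i hi j _ ↦ ?_
      have := cast2 i (by rcases hi with rfl | rfl <;> omega)
      simp only [neg_mul, one_mul, Complex.neg_re, fromCenter_re]; linarith
    · refine key (-Complex.I) fun i _ j hj ↦ ?_
      have := cast1 j (by rcases hj with rfl | rfl <;> omega)
      simp only [neg_mul, Complex.neg_re, Complex.I_mul_re, fromCenter_im]; linarith
    · refine key Complex.I fun i _ j hj ↦ ?_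
      have := cast2 j (by rcases hj with rfl | rfl <;> omega)
      simp only [Complex.I_mul_re, fromCenter_im]; linarith

/-- The logarithmic differences of `G` on horizontal and vertical edges, around a square. -/
noncomputable def logSum (G : ℤ → ℤ → ℂ) (m n : ℤ) : ℂ :=
  squareSum (fun m n ↦ Complex.log (G (m + 1) n / G m n))
    (fun m n ↦ Complex.log (G m (n + 1) / G m n)) m n

theorem exists_logSum_eq {G : ℤ → ℤ → ℂ} (h0 : ∀ m n, G m n ≠ 0) (m n : ℤ) :
    ∃ k : ℤ, logSum G m n = k * (2 * Real.pi * Complex.I) := by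
  rw [← Complex.exp_eq_one_iff, logSum, squareSum]
  have h := fun i j i' j' ↦ div_ne_zero (h0 i j) (h0 i' j')
  simp only [Complex.exp_sub, Complex.exp_add, Complex.exp_log (h _ _ _ _)]
  have h1 := h0 m n
  have h2 := h0 (m + 1) n
  have h3 := h0 m (n + 1)
  have h4 := h0 (m + 1) (n + 1)
  field_simp

theorem exists_lattice_log {G : ℤ → ℤ → ℂ} (h0 : ∀ m n, G m n ≠ 0) (T : Finset (ℤ × ℤ))
    (hT : ∀ m n, (m, n) ∉ T → logSum G m n = 0) :
    ∃ (k : ℤ × ℤ → ℤ) (F : ℤ → ℤ → ℂ),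
      (∀ p, k p ≠ 0 → logSum G p.1 p.2 ≠ 0) ∧
      (∀ m n, F (m + 1) n - F m n = Complex.log (G (m + 1) n / G m n) - ∑ p ∈ T, k p *
        Complex.log (fromCenter (m + 1 - p.1) (n - p.2) / fromCenter (m - p.1) (n - p.2))) ∧
      (∀ m n, F m (n + 1) - F m n = Complex.log (G m (n + 1) / G m n) - ∑ p ∈ T, k p *
        Complex.log (fromCenter (m - p.1) (n + 1 - p.2) / fromCenter (m - p.1) (n - p.2))) ∧
      ∀ m n, G m n = Complex.exp (F m n) *
        ∏ p ∈ T, fromCenter (m - p.1) (n - p.2) ^ k p := by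
  choose k hk using fun p : ℤ × ℤ ↦ exists_logSum_eq h0 p.1 p.2
  obtain ⟨F, hF1, hF2⟩ := exists_lattice_potential
    (a := fun m n ↦ Complex.log (G (m + 1) n / G m n) - ∑ p ∈ T, k p *
        Complex.log (fromCenter (m + 1 - p.1) (n - p.2) / fromCenter (m - p.1) (n - p.2)))
    (b := fun m n ↦ Complex.log (G m (n + 1) / G m n) - ∑ p ∈ T, k p *
        Complex.log (fromCenter (m - p.1) (n + 1 - p.2) / fromCenter (m - p.1) (n - p.2)))
    (fun m n ↦ by
      have e : ∀ a b a' b' : ℤ → ℤ → ℂ, squareSum (fun m n ↦ a m n - a' m n)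
          (fun m n ↦ b m n - b' m n) m n = squareSum a b m n - squareSum a' b' m n := by
        intro a b a' b'; simp only [squareSum]; ring
      rw [e, ← logSum]
      have e2 : squareSum (fun m n ↦ ∑ p ∈ T, k p *
          Complex.log (fromCenter (m + 1 - p.1) (n - p.2) / fromCenter (m - p.1) (n - p.2)))
          (fun m n ↦ ∑ p ∈ T, k p *
          Complex.log (fromCenter (m - p.1) (n + 1 - p.2) / fromCenter (m - p.1) (n - p.2))) m n
          = ∑ p ∈ T, k p * if p = (m, n) then 2 * Real.pi * Complex.I else 0 := by
        simp only [squareSum, ← Finset.sum_add_distrib, ← Finset.sum_sub_distrib]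
        refine Finset.sum_congr rfl fun p _ ↦ ?_
        have := squareSum_fromCenter (m - p.1) (n - p.2)
        simp only [squareSum] at this
        have c : (p = (m, n)) = (m - p.1 = 0 ∧ n - p.2 = 0) := by
          rw [Prod.ext_iff]; simp only [eq_iff_iff]; omega
        simp only [c, ← this, add_sub_right_comm]
        ring
      rw [e2]
      simp only [mul_ite, mul_zero, Finset.sum_ite_eq']
      split_ifs with hm
      · rw [hk (m, n), sub_self]
      · rw [hT m n hm, sub_self])
  have hprod : ∀ m n, ∏ p ∈ T, fromCenter (m - p.1) (n - p.2) ^ k p ≠ 0 := fun m n ↦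
    Finset.prod_ne_zero_iff.mpr fun p _ ↦ zpow_ne_zero _ (fromCenter_ne_zero _ _)
  have hstep : ∀ m n m' n', F m' n' - F m n = Complex.log (G m' n' / G m n) - ∑ p ∈ T, k p *
        Complex.log (fromCenter (m' - p.1) (n' - p.2) / fromCenter (m - p.1) (n - p.2)) →
      G m' n' / (Complex.exp (F m' n') * ∏ p ∈ T, fromCenter (m' - p.1) (n' - p.2) ^ k p) =
      G m n / (Complex.exp (F m n) * ∏ p ∈ T, fromCenter (m - p.1) (n - p.2) ^ k p) := by
    intro m n m' n' h
    have := congrArg Complex.exp h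
    rw [Complex.exp_sub, Complex.exp_sub, Complex.exp_log (div_ne_zero (h0 _ _) (h0 _ _)),
      Complex.exp_sum] at this
    have e : ∏ p ∈ T, Complex.exp (k p * Complex.log (fromCenter (m' - p.1) (n' - p.2) /
        fromCenter (m - p.1) (n - p.2))) = (∏ p ∈ T, fromCenter (m' - p.1) (n' - p.2) ^ k p) /
        ∏ p ∈ T, fromCenter (m - p.1) (n - p.2) ^ k p := by
      rw [← Finset.prod_div_distrib]
      refine Finset.prod_congr rfl fun p _ ↦ ?_
      rw [Complex.exp_int_mul, Complex.exp_log
        (div_ne_zero (fromCenter_ne_zero _ _) (fromCenter_ne_zero _ _)), div_zpow]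
    rw [e] at this
    have h1 := hprod m n
    have h2 := hprod m' n'
    have h3 := h0 m n
    have h4 := h0 m' n'
    have h5 := Complex.exp_ne_zero (F m n)
    have h6 := Complex.exp_ne_zero (F m' n')
    rw [div_eq_div_iff (mul_ne_zero h6 h2) (mul_ne_zero h5 h1)]
    rw [div_eq_iff h5] at this
    rw [this]
    field_simp
  have hconst : ∀ m n, G m n / (Complex.exp (F m n) *
      ∏ p ∈ T, fromCenter (m - p.1) (n - p.2) ^ k p) = G 0 0 / (Complex.exp (F 0 0) *
      ∏ p ∈ T, fromCenter (0 - p.1) (0 - p.2) ^ k p) := by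
    intro m n
    rw [int_const (f := fun n ↦ G m n / (Complex.exp (F m n) *
      ∏ p ∈ T, fromCenter (m - p.1) (n - p.2) ^ k p)) (fun n ↦ hstep _ _ _ _ (hF2 m n)) n]
    exact int_const (f := fun m ↦ G m 0 / (Complex.exp (F m 0) *
      ∏ p ∈ T, fromCenter (m - p.1) (0 - p.2) ^ k p)) (fun m ↦ hstep _ _ _ _ (hF1 m 0)) m
  obtain ⟨C, hC⟩ : ∃ C, Complex.exp C = G 0 0 / (Complex.exp (F 0 0) *
      ∏ p ∈ T, fromCenter (0 - p.1) (0 - p.2) ^ k p) :=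
    ⟨_, Complex.exp_log (div_ne_zero (h0 _ _) (mul_ne_zero (Complex.exp_ne_zero _) (hprod 0 0)))⟩
  refine ⟨k, fun m n ↦ F m n + C, fun p hp h ↦ hp ?_, fun m n ↦ ?_, fun m n ↦ ?_, fun m n ↦ ?_⟩
  · have := hk p
    rw [h, eq_comm, mul_eq_zero] at this
    simpa [Complex.I_ne_zero, Real.pi_ne_zero] using this
  · linear_combination hF1 m n
  · linear_combination hF2 m n
  · have := hconst m n
    rw [← hC, div_eq_iff (mul_ne_zero (Complex.exp_ne_zero _) (hprod m n))] at this
    rw [this, Complex.exp_add]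
    ring

/-- The points of norm less than `R` and of distance more than `δ` to `A`. -/
def awayFrom (A : Set ℂ) (R δ : ℝ) : Set ℂ := {z | ‖z‖ < R ∧ δ < infDist z A}

theorem isOpen_awayFrom (A : Set ℂ) (R δ : ℝ) : IsOpen (awayFrom A R δ) :=
  (isOpen_lt continuous_norm continuous_const).inter
    (isOpen_lt continuous_const (continuous_infDist_pt A))

theorem exists_log_sub_shift {K : Set ℂ} {a c : ℂ} (h : ∀ z ∈ K, ‖c - a‖ < ‖z - a‖)
    (ha : ∃ l : ℂ → ℂ, ContinuousOn l K ∧ ∀ z ∈ K, Complex.exp (l z) = z - a) :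
    ∃ l : ℂ → ℂ, ContinuousOn l K ∧ ∀ z ∈ K, Complex.exp (l z) = z - c := by
  obtain ⟨l, hl, he⟩ := ha
  have h0 : ∀ z ∈ K, z - a ≠ 0 := fun z hz ↦ norm_pos_iff.mp ((norm_nonneg _).trans_lt (h z hz))
  have hs : ∀ z ∈ K, 1 + (a - c) / (z - a) ∈ Complex.slitPlane := fun z hz ↦ by
    apply one_add_mem_slitPlane
    rw [norm_div, div_lt_one (norm_pos_iff.mpr (h0 z hz)), norm_sub_rev]
    exact h z hz
  refine ⟨fun z ↦ l z + Complex.log (1 + (a - c) / (z - a)), hl.add (ContinuousOn.clog ?_ hs),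
    fun z hz ↦ ?_⟩
  · exact continuousOn_const.add (continuousOn_const.div
      (continuousOn_id.sub continuousOn_const) h0)
  · rw [Complex.exp_add, he z hz, Complex.exp_log (Complex.slitPlane_ne_zero (hs z hz))]
    have := h0 z hz
    field_simp
    ring

theorem exists_log_sub_of_large {K : Set ℂ} {c : ℂ} (h : ∀ z ∈ K, ‖z‖ < ‖c‖) :
    ∃ l : ℂ → ℂ, ContinuousOn l K ∧ ∀ z ∈ K, Complex.exp (l z) = z - c := by
  have hs : ∀ z ∈ K, 1 + (-z / c) ∈ Complex.slitPlane := fun z hz ↦ by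
    have := (norm_nonneg _).trans_lt (h z hz)
    apply one_add_mem_slitPlane
    rw [norm_div, norm_neg, div_lt_one this]
    exact h z hz
  refine ⟨fun z ↦ Complex.log (-c) + Complex.log (1 + (-z / c)),
    continuousOn_const.add (ContinuousOn.clog ?_ hs), fun z hz ↦ ?_⟩
  · fun_prop
  · have : c ≠ 0 := norm_pos_iff.mp ((norm_nonneg _).trans_lt (h z hz))
    rw [Complex.exp_add, Complex.exp_log (neg_ne_zero.mpr this),
      Complex.exp_log (Complex.slitPlane_ne_zero (hs z hz))]
    field_simp
    ring

theorem exists_log_sub {A : Set ℂ} (hA : IsPreconnected A) (hu : ¬ Bornology.IsBounded A)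
    {R δ : ℝ} (hδ : 0 < δ) {c : ℂ} (hc : R < ‖c‖ ∨ infDist c A < δ) :
    ∃ l : ℂ → ℂ, ContinuousOn l (awayFrom A R δ) ∧
      ∀ z ∈ awayFrom A R δ, Complex.exp (l z) = z - c := by
  rcases hc with hc | hc
  · exact exists_log_sub_of_large fun z hz ↦ hz.1.trans hc
  have hne : A.Nonempty := by
    by_contra h
    exact hu (by simp [not_nonempty_iff_eq_empty.mp h])
  set S := {a | ∃ l : ℂ → ℂ, ContinuousOn l (awayFrom A R δ) ∧
      ∀ z ∈ awayFrom A R δ, Complex.exp (l z) = z - a} with hS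
  have hstep : ∀ a ∈ A, a ∈ S → ∀ b, dist a b < δ → b ∈ S := fun a ha haS b hb ↦
    exists_log_sub_shift (fun z hz ↦ by
      rw [← dist_eq_norm, dist_comm, ← dist_eq_norm]
      exact hb.trans (hz.2.trans_le (infDist_le_dist_of_mem ha))) haS
  obtain ⟨a0, ha0, hR⟩ : ∃ a ∈ A, R < ‖a‖ := by
    by_contra! h
    exact hu (isBounded_iff_forall_norm_le.mpr ⟨R, h⟩)
  have hsub : A ⊆ thickening (δ / 2) (A ∩ S) := by
    refine hA.subset_of_closure_inter_subset isOpen_thickening ⟨a0, ha0, ?_⟩ ?_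
    · exact self_subset_thickening (half_pos hδ) _
        ⟨ha0, exists_log_sub_of_large fun z hz ↦ hz.1.trans hR⟩
    · rintro a ⟨ha, haA⟩
      refine self_subset_thickening (half_pos hδ) _ ⟨haA, ?_⟩
      obtain ⟨b, hb, hab⟩ := Metric.mem_closure_iff.mp ha (δ / 2) (half_pos hδ)
      obtain ⟨d, hd, hbd⟩ := mem_thickening_iff.mp hb
      exact hstep d hd.1 hd.2 a (by
        rw [dist_comm]; exact (dist_triangle a b d).trans_lt (by linarith))
  obtain ⟨a, ha, hca⟩ := (infDist_lt_iff hne).mp hc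
  obtain ⟨d, hd, hda⟩ := mem_thickening_iff.mp (hsub ha)
  exact hstep a ha (hstep d hd.1 hd.2 a (by rw [dist_comm]; linarith)) c (by rwa [dist_comm])

theorem norm_log_le {x : ℂ} (h : ‖x - 1‖ ≤ 1 / 8) : ‖Complex.log x‖ ≤ 1 / 4 := by
  have := Complex.norm_log_one_add_half_le_self (z := x - 1) (by linarith)
  rw [add_sub_cancel] at this
  linarith

theorem log_sub_log_of_ball {l : ℂ → ℂ} {x y c : ℂ} {r : ℝ} (hl : ContinuousOn l (ball x r))
    (he : ∀ z ∈ ball x r, Complex.exp (l z) = z - c) (hc : r ≤ ‖x - c‖) (hy : y ∈ ball x r) :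
    l y - l x = Complex.log ((y - c) / (x - c)) := by
  have hr : 0 < r := pos_of_mem_ball hy
  have hx : x - c ≠ 0 := norm_pos_iff.mp (hr.trans_le hc)
  have hs : ∀ z ∈ ball x r, (z - c) / (x - c) ∈ Complex.slitPlane := fun z hz ↦ by
    have : (z - c) / (x - c) = 1 + (z - x) / (x - c) := by field_simp; ring
    rw [this]
    apply one_add_mem_slitPlane
    rw [norm_div, div_lt_one (hr.trans_le hc)]
    exact (mem_ball_iff_norm.mp hz).trans_le hc
  have := exp_constOn (N := fun z ↦ l z - Complex.log ((z - c) / (x - c)))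
    (convex_ball x r).isPreconnected
    (hl.sub (ContinuousOn.clog (by fun_prop) hs))
    (by
      have : ∀ z ∈ ball x r, Complex.exp (l z - Complex.log ((z - c) / (x - c))) = x - c := by
        intro z hz
        have h0 := Complex.slitPlane_ne_zero (hs z hz)
        rw [Complex.exp_sub, he z hz, Complex.exp_log h0]
        have := (div_ne_zero_iff.mp h0).1
        field_simp
      intro z hz w hw
      rw [this z hz, this w hw]) hy (mem_ball_self hr)
  simp only [div_self hx, Complex.log_one, sub_zero] at this
  linear_combination this

/-- The point `(m, n)` of the square lattice of mesh `ε`. -/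
noncomputable def meshPt (ε : ℝ) (m n : ℤ) : ℂ := ε * (m + n * Complex.I)

theorem norm_sub_meshPt_le {ε : ℝ} {z : ℂ} {m n : ℤ} {a b : ℝ} (ha : |z.re - ε * m| ≤ a)
    (hb : |z.im - ε * n| ≤ b) : ‖z - meshPt ε m n‖ ≤ a + b := by
  refine (Complex.norm_le_abs_re_add_abs_im _).trans (add_le_add ?_ ?_)
  · simpa [meshPt] using ha
  · simpa [meshPt] using hb

theorem exists_log_awayFrom_of_mesh {A : Set ℂ} (hA : IsPreconnected A)
    (hu : ¬ Bornology.IsBounded A) {g : ℂ → ℂ} {R δ ε : ℝ} (hδ : 0 < δ) (hε : 0 < ε)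
    (hε1 : ε ≤ 1 / 16) (hε2 : ε ≤ δ / 32) (h0 : ∀ z ∈ awayFrom A (R + 2) (δ / 4), g z ≠ 0)
    (hg : ∀ x ∈ awayFrom A (R + 2) (δ / 4), ∀ y ∈ awayFrom A (R + 2) (δ / 4),
      ‖x - y‖ ≤ 4 * ε → ‖g x / g y - 1‖ ≤ 1 / 8)
    (hgc : ContinuousOn g (awayFrom A R δ)) :
    ∃ l : ℂ → ℂ, ContinuousOn l (awayFrom A R δ) ∧
      ∀ z ∈ awayFrom A R δ, Complex.exp (l z) = g z := by
  classical
  set K' := awayFrom A (R + 2) (δ / 4) with hK'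
  have hmono : ∀ {x y : ℂ} {R₁ δ₁ R₂ δ₂ : ℝ}, x ∈ awayFrom A R₁ δ₁ →
      ‖x - y‖ ≤ R₂ - R₁ → ‖x - y‖ ≤ δ₁ - δ₂ → y ∈ awayFrom A R₂ δ₂ := by
    intro x y R₁ δ₁ R₂ δ₂ hx h1 h2
    have h3 := norm_sub_norm_le y x
    rw [norm_sub_rev] at h3
    have h4 := infDist_le_infDist_add_dist (s := A) (x := x) (y := y)
    rw [dist_eq_norm] at h4
    exact ⟨by linarith [hx.1], by linarith [hx.2]⟩
  set G : ℤ → ℤ → ℂ := fun m n ↦ if meshPt ε m n ∈ K' then g (meshPt ε m n) else 1 with hG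
  have hG0 : ∀ m n, G m n ≠ 0 := fun m n ↦ by
    simp only [hG]; split_ifs with h
    exacts [h0 _ h, one_ne_zero]
  have hGK : ∀ m n, meshPt ε m n ∈ K' → G m n = g (meshPt ε m n) := fun m n h ↦ if_pos h
  have hG1 : ∀ m n, meshPt ε m n ∉ K' → G m n = 1 := fun m n h ↦ if_neg h
  obtain ⟨N, hN⟩ := exists_nat_gt ((R + 2) / ε)
  rw [div_lt_iff₀ hε] at hN
  have hfar : ∀ m n : ℤ, ((N : ℤ) ≤ m ∨ m ≤ -N ∨ (N : ℤ) ≤ n ∨ n ≤ -N) → G m n = 1 := by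
    intro m n h
    refine hG1 m n fun hK ↦ ?_
    have h1 := (Complex.abs_re_le_norm (meshPt ε m n)).trans_lt hK.1
    have h2 := (Complex.abs_im_le_norm (meshPt ε m n)).trans_lt hK.1
    simp only [meshPt, Complex.re_ofReal_mul, Complex.im_ofReal_mul, Complex.add_re,
      Complex.add_im, Complex.intCast_re, Complex.intCast_im, Complex.mul_I_re, Complex.mul_I_im,
      neg_zero, add_zero, zero_add, abs_lt] at h1 h2
    rcases h with h | h | h | h
    · have : (N : ℝ) ≤ m := by exact_mod_cast h
      nlinarith [h1.2]
    · have : (m : ℝ) ≤ -N := by exact_mod_cast h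
      nlinarith [h1.1]
    · have : (N : ℝ) ≤ n := by exact_mod_cast h
      nlinarith [h2.2]
    · have : (n : ℝ) ≤ -N := by exact_mod_cast h
      nlinarith [h2.1]
  have hfloor : ∀ x y : ℝ, ∀ m : ℤ, |x - ε * m| ≤ y → |x - ε * (m + 1 : ℤ)| ≤ y + ε := by
    intro x y m h
    rw [abs_le] at h ⊢
    push_cast
    constructor <;> nlinarith
  have hadj1 : ∀ m n, ‖meshPt ε (m + 1) n - meshPt ε m n‖ = ε := fun m n ↦ by
    have : meshPt ε (m + 1) n - meshPt ε m n = ε := by simp only [meshPt]; push_cast; ring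
    rw [this, Complex.norm_real, Real.norm_of_nonneg hε.le]
  have hadj2 : ∀ m n, ‖meshPt ε m (n + 1) - meshPt ε m n‖ = ε := fun m n ↦ by
    have : meshPt ε m (n + 1) - meshPt ε m n = ε * Complex.I := by
      simp only [meshPt]; push_cast; ring
    rw [this, norm_mul, Complex.norm_I, mul_one, Complex.norm_real, Real.norm_of_nonneg hε.le]
  have hlog : ∀ m n m' n', meshPt ε m n ∈ K' → meshPt ε m' n' ∈ K' →
      ‖meshPt ε m' n' - meshPt ε m n‖ ≤ 4 * ε → ‖Complex.log (G m' n' / G m n)‖ ≤ 1 / 4 := by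
    intro m n m' n' h h' hd
    rw [hGK _ _ h, hGK _ _ h']
    exact norm_log_le (hg _ h' _ h hd)
  set T : Finset (ℤ × ℤ) := Finset.Icc (-(N : ℤ)) N ×ˢ Finset.Icc (-(N : ℤ)) N with hTdef
  obtain ⟨k, F, hk, hF1, hF2, hFG⟩ := exists_lattice_log hG0 T fun m n h ↦ by
    simp only [hTdef, Finset.mem_product, Finset.mem_Icc] at h
    have h1 : G m n = 1 := hfar _ _ (by omega)
    have h2 : G (m + 1) n = 1 := hfar _ _ (by omega)
    have h3 : G m (n + 1) = 1 := hfar _ _ (by omega)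
    have h4 : G (m + 1) (n + 1) = 1 := hfar _ _ (by omega)
    simp [logSum, squareSum, h1, h2, h3, h4]
  set c : ℤ × ℤ → ℂ := fun p ↦ ε * ((p.1 + 1 / 2) + (p.2 + 1 / 2) * Complex.I) with hc
  have hcm : ∀ m n p, meshPt ε m n - c p = ε * fromCenter (m - p.1) (n - p.2) := by
    intro m n p
    simp only [meshPt, hc, fromCenter]; push_cast; ring
  have hcbad : ∀ p, k p ≠ 0 → R + 1 < ‖c p‖ ∨ infDist (c p) A < δ / 2 := by
    intro p hp
    by_contra! hcon
    have hcK : ∀ m n : ℤ, (m = p.1 ∨ m = p.1 + 1) → (n = p.2 ∨ n = p.2 + 1) →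
        meshPt ε m n ∈ K' := by
      intro m n hm hn
      have h1 : ‖c p - meshPt ε m n‖ ≤ ε / 2 + ε / 2 := by
        apply norm_sub_meshPt_le
        · rcases hm with rfl | rfl <;> simp [hc, abs_le] <;> constructor <;> linarith
        · rcases hn with rfl | rfl <;> simp [hc, abs_le] <;> constructor <;> linarith
      refine hmono (R₁ := R + 1 + ε) (δ₁ := δ / 2 - ε) ⟨?_, ?_⟩ (h1.trans ?_) (h1.trans ?_)
      all_goals linarith
    refine hk p hp (eq_zero_of_exp_eq_one
      (Complex.exp_eq_one_iff.mpr (exists_logSum_eq hG0 p.1 p.2)) ?_)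
    have a1 := hlog _ _ _ _ (hcK p.1 p.2 (by simp) (by simp))
        (hcK (p.1 + 1) p.2 (by simp) (by simp))
      ((hadj1 _ _).trans_le (by linarith))
    have a2 := hlog _ _ _ _ (hcK (p.1 + 1) p.2 (by simp) (by simp))
      (hcK (p.1 + 1) (p.2 + 1) (by simp) (by simp)) ((hadj2 _ _).trans_le (by linarith))
    have a3 := hlog _ _ _ _ (hcK p.1 (p.2 + 1) (by simp) (by simp))
      (hcK (p.1 + 1) (p.2 + 1) (by simp) (by simp)) ((hadj1 _ _).trans_le (by linarith))
    have a4 := hlog _ _ _ _ (hcK p.1 p.2 (by simp) (by simp))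
        (hcK p.1 (p.2 + 1) (by simp) (by simp))
      ((hadj2 _ _).trans_le (by linarith))
    rw [logSum, squareSum]
    refine (norm_sub_le _ _).trans_lt ?_
    have b1 := norm_sub_le (Complex.log (G (p.1 + 1) p.2 / G p.1 p.2) +
      Complex.log (G (p.1 + 1) (p.2 + 1) / G (p.1 + 1) p.2))
      (Complex.log (G (p.1 + 1) (p.2 + 1) / G p.1 (p.2 + 1)))
    have b2 := norm_add_le (Complex.log (G (p.1 + 1) p.2 / G p.1 p.2))
      (Complex.log (G (p.1 + 1) (p.2 + 1) / G (p.1 + 1) p.2))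
    linarith
  have hl : ∀ p, ∃ l : ℂ → ℂ, k p ≠ 0 → ContinuousOn l (awayFrom A (R + 1) (δ / 2)) ∧
      ∀ z ∈ awayFrom A (R + 1) (δ / 2), Complex.exp (l z) = z - c p := by
    intro p
    by_cases h : k p = 0
    · exact ⟨0, fun h' ↦ absurd h h'⟩
    · obtain ⟨l, hl⟩ := exists_log_sub hA hu (half_pos hδ) (hcbad p h)
      exact ⟨l, fun _ ↦ hl⟩
  choose l hl using hl
  set P : ℤ → ℤ → ℂ := fun m n ↦ F m n + ∑ p ∈ T, k p * l p (meshPt ε m n) with hP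
  have hstep : ∀ m n m' n', meshPt ε m n ∈ awayFrom A (R + 1 / 2) (3 * δ / 4) →
      ‖meshPt ε m' n' - meshPt ε m n‖ ≤ ε →
      F m' n' - F m n = Complex.log (G m' n' / G m n) - ∑ p ∈ T, k p * Complex.log
        (fromCenter (m' - p.1) (n' - p.2) / fromCenter (m - p.1) (n - p.2)) →
      ‖P m' n' - P m n‖ ≤ 1 / 4 := by
    intro m n m' n' hx hd hFe
    have hball : ball (meshPt ε m n) (2 * ε) ⊆ awayFrom A (R + 1) (δ / 2) := fun y hy ↦ by
      rw [mem_ball', dist_eq_norm] at hy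
      exact hmono hx (by linarith) (by linarith)
    have hx' : meshPt ε m' n' ∈ ball (meshPt ε m n) (2 * ε) := by
      rw [mem_ball, dist_eq_norm]; linarith
    have hP' : P m' n' - P m n = Complex.log (G m' n' / G m n) := by
      have : ∑ p ∈ T, (k p : ℂ) * l p (meshPt ε m' n') - ∑ p ∈ T, (k p : ℂ) * l p (meshPt ε m n) =
          ∑ p ∈ T, k p * Complex.log
        (fromCenter (m' - p.1) (n' - p.2) / fromCenter (m - p.1) (n - p.2)) := by
        rw [← Finset.sum_sub_distrib]
        refine Finset.sum_congr rfl fun p _ ↦ ?_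
        by_cases h : k p = 0
        · simp [h]
        have h' := hl p h
        have hε' : (ε : ℂ) ≠ 0 := by exact_mod_cast hε.ne'
        rw [← mul_sub, log_sub_log_of_ball (c := c p) (h'.1.mono hball)
          (fun z hz ↦ h'.2 z (hball hz)) ?_ hx', hcm, hcm, mul_div_mul_left _ _ hε']
        by_contra! hcon
        have := hmono (y := c p) (R₂ := R + 1) (δ₂ := δ / 2) hx (by linarith) (by linarith)
        rcases hcbad p h with h1 | h1
        · exact absurd this.1 h1.le.not_gt
        · exact absurd this.2 h1.le.not_gt
      simp only [hP]
      linear_combination hFe + this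
    rw [hP']
    refine hlog _ _ _ _ (hmono hx ?_ ?_) (hmono hx ?_ ?_) (by linarith)
    · rw [sub_self, norm_zero]; linarith
    · rw [sub_self, norm_zero]; linarith
    · rw [norm_sub_rev]; linarith
    · rw [norm_sub_rev]; linarith
  obtain ⟨D, hD⟩ : ∃ D, ∀ m n, meshPt ε m n ∈ awayFrom A (R + 1) (δ / 2) →
      Complex.exp (P m n - D) = g (meshPt ε m n) := by
    have hε' : (ε : ℂ) ≠ 0 := by exact_mod_cast hε.ne'
    refine ⟨∑ p ∈ T, k p * Complex.log ε, fun m n h ↦ ?_⟩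
    have hK : meshPt ε m n ∈ K' := hmono h (by rw [sub_self, norm_zero]; linarith)
      (by rw [sub_self, norm_zero]; linarith)
    rw [← hGK _ _ hK, hFG, hP]
    simp only
    rw [add_sub_assoc, Complex.exp_add, ← Finset.sum_sub_distrib, Complex.exp_sum]
    congr 1
    refine Finset.prod_congr rfl fun p _ ↦ ?_
    by_cases hp : k p = 0
    · simp [hp]
    rw [← mul_sub, Complex.exp_int_mul, Complex.exp_sub, (hl p hp).2 _ h, Complex.exp_log hε', hcm,
      mul_div_cancel_left₀ _ hε']
  set v : ℝ → ℤ := fun x ↦ ⌊x / ε⌋ with hv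
  have hv1 : ∀ x, ε * v x ≤ x := fun x ↦ by
    have := (le_div_iff₀ hε).mp (Int.floor_le (x / ε)); simpa [mul_comm] using this
  have hv2 : ∀ x, x < ε * v x + ε := fun x ↦ by
    have := (div_lt_iff₀ hε).mp (Int.lt_floor_add_one (x / ε)); simp only [hv]; linarith
  have hvd : ∀ z : ℂ, ‖z - meshPt ε (v z.re) (v z.im)‖ ≤ ε + ε := fun z ↦ by
    apply norm_sub_meshPt_le
    · rw [abs_le]; constructor <;> linarith [hv1 z.re, hv2 z.re]
    · rw [abs_le]; constructor <;> linarith [hv1 z.im, hv2 z.im]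
  have hvs : ∀ x y, |x - y| < ε → v y = v x ∨ v y = v x + 1 ∨ v x = v y + 1 := fun x y h ↦ by
    rw [abs_lt] at h
    have h1 : v x < v y + 2 := by
      have : ε * v x < ε * (v y + 2) := by linarith [hv1 x, hv2 y]
      exact_mod_cast lt_of_mul_lt_mul_left this hε.le
    have h2 : v y < v x + 2 := by
      have : ε * v y < ε * (v x + 2) := by linarith [hv1 y, hv2 x]
      exact_mod_cast lt_of_mul_lt_mul_left this hε.le
    omega
  have hmid : ∀ z ∈ awayFrom A R δ, ∀ w, ‖z - w‖ ≤ 4 * ε →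
      w ∈ awayFrom A (R + 1 / 2) (3 * δ / 4) := fun z hz w h ↦
    hmono hz (by linarith) (by linarith)
  have hnear : ∀ z ∈ awayFrom A R δ, ∀ w ∈ ball z ε,
      ‖P (v w.re) (v w.im) - P (v z.re) (v z.im)‖ ≤ 1 / 2 := by
    intro z hz w hw
    rw [mem_ball', dist_eq_norm] at hw
    have hre := (Complex.abs_re_le_norm (z - w)).trans_lt hw
    have him := (Complex.abs_im_le_norm (z - w)).trans_lt hw
    have hr := hvs _ _ hre
    have hi := hvs _ _ him
    simp only [Complex.sub_re, Complex.sub_im, abs_lt] at hre him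
    have z1 := hv1 z.re
    have z2 := hv2 z.re
    have z3 := hv1 z.im
    have z4 := hv2 z.im
    have w1 := hv1 w.re
    have w2 := hv2 w.re
    have w3 := hv1 w.im
    have w4 := hv2 w.im
    have m1 : meshPt ε (v w.re) (v z.im) ∈ awayFrom A (R + 1 / 2) (3 * δ / 4) := by
      refine hmid z hz _ ((norm_sub_meshPt_le (a := 2 * ε) (b := ε) ?_ ?_).trans (by linarith)) <;>
        rw [abs_le] <;> constructor <;> linarith
    have m2 : meshPt ε (v w.re) (v w.im) ∈ awayFrom A (R + 1 / 2) (3 * δ / 4) := by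
      refine hmid z hz _ ((norm_sub_meshPt_le (a := 2 * ε) (b := 2 * ε) ?_ ?_).trans
          (by linarith)) <;>
        rw [abs_le] <;> constructor <;> linarith
    have m3 : meshPt ε (v z.re) (v z.im) ∈ awayFrom A (R + 1 / 2) (3 * δ / 4) :=
      hmid z hz _ ((hvd z).trans (by linarith))
    have c1 : ‖P (v w.re) (v z.im) - P (v z.re) (v z.im)‖ ≤ 1 / 4 := by
      rcases hr with h | h | h
      · rw [h, sub_self, norm_zero]; norm_num
      · rw [h]; exact hstep _ _ _ _ m3 (hadj1 _ _).le (hF1 _ _)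
      · rw [h, norm_sub_rev]; exact hstep _ _ _ _ m1 (hadj1 _ _).le (hF1 _ _)
    have c2 : ‖P (v w.re) (v w.im) - P (v w.re) (v z.im)‖ ≤ 1 / 4 := by
      rcases hi with h | h | h
      · rw [h, sub_self, norm_zero]; norm_num
      · rw [h]; exact hstep _ _ _ _ m1 (hadj2 _ _).le (hF2 _ _)
      · rw [h, norm_sub_rev]; exact hstep _ _ _ _ m2 (hadj2 _ _).le (hF2 _ _)
    have := norm_sub_le_norm_sub_add_norm_sub (P (v w.re) (v w.im)) (P (v w.re) (v z.im))
      (P (v z.re) (v z.im))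
    linarith
  have hself : ∀ z ∈ awayFrom A R δ, z ∈ K' := fun z hz ↦
    hmono hz (by rw [sub_self, norm_zero]; linarith) (by rw [sub_self, norm_zero]; linarith)
  have hmK : ∀ z ∈ awayFrom A R δ, meshPt ε (v z.re) (v z.im) ∈ K' := fun z hz ↦
    hmono hz ((hvd z).trans (by linarith)) ((hvd z).trans (by linarith))
  set L : ℂ → ℂ := fun z ↦ P (v z.re) (v z.im) - D +
    Complex.log (g z / g (meshPt ε (v z.re) (v z.im))) with hL
  have hLe : ∀ z ∈ awayFrom A R δ, Complex.exp (L z) = g z := by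
    intro z hz
    have h1 : meshPt ε (v z.re) (v z.im) ∈ awayFrom A (R + 1) (δ / 2) :=
      hmono hz ((hvd z).trans (by linarith)) ((hvd z).trans (by linarith))
    have h2 := h0 _ (hmK z hz)
    rw [hL, Complex.exp_add, hD _ _ h1, Complex.exp_log (div_ne_zero (h0 _ (hself z hz)) h2),
      mul_div_cancel₀ _ h2]
  refine ⟨L, fun z hz ↦ ContinuousAt.continuousWithinAt ?_, hLe⟩
  have hev : ∀ᶠ w in 𝓝 z, L w = P (v z.re) (v z.im) - D +
      Complex.log (g w / g (meshPt ε (v z.re) (v z.im))) := by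
    filter_upwards [ball_mem_nhds z hε, (isOpen_awayFrom A R δ).mem_nhds hz] with w hw hwK
    have h1 : meshPt ε (v z.re) (v z.im) ∈ awayFrom A (R + 1) (δ / 2) :=
      hmono hz ((hvd z).trans (by linarith)) ((hvd z).trans (by linarith))
    have h2 := h0 _ (hmK z hz)
    have h3 := h0 _ (hself w hwK)
    have hwz : ‖w - meshPt ε (v z.re) (v z.im)‖ ≤ 4 * ε := by
      have := norm_sub_le_norm_sub_add_norm_sub w z (meshPt ε (v z.re) (v z.im))
      rw [mem_ball, dist_eq_norm] at hw
      linarith [hvd z]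
    have l1 := norm_log_le (hg _ (hself w hwK) _ (hmK z hz) hwz)
    have l2 := norm_log_le (hg _ (hself w hwK) _ (hmK w hwK) ((hvd w).trans (by linarith)))
    refine sub_eq_zero.mp (eq_zero_of_exp_eq_one ?_ ?_)
    · rw [Complex.exp_sub, hLe w hwK, Complex.exp_add, hD _ _ h1, Complex.exp_log
        (div_ne_zero h3 h2), mul_div_cancel₀ _ h2, div_self h3]
    · have e : L w - (P (v z.re) (v z.im) - D +
          Complex.log (g w / g (meshPt ε (v z.re) (v z.im)))) =
          (P (v w.re) (v w.im) - P (v z.re) (v z.im)) +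
          (Complex.log (g w / g (meshPt ε (v w.re) (v w.im))) -
          Complex.log (g w / g (meshPt ε (v z.re) (v z.im)))) := by simp only [hL]; ring
      rw [e]
      have n1 := norm_add_le (P (v w.re) (v w.im) - P (v z.re) (v z.im))
        (Complex.log (g w / g (meshPt ε (v w.re) (v w.im))) -
          Complex.log (g w / g (meshPt ε (v z.re) (v z.im))))
      have n2 := norm_sub_le (Complex.log (g w / g (meshPt ε (v w.re) (v w.im))))
          (Complex.log (g w / g (meshPt ε (v z.re) (v z.im))))
      have n3 := hnear z hz w hw
      linarith
  refine ContinuousAt.congr ?_ (EventuallyEq.symm hev)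
  have h2 := h0 _ (hmK z hz)
  have hgz : ContinuousAt g z := hgc.continuousAt ((isOpen_awayFrom A R δ).mem_nhds hz)
  refine continuousAt_const.add (ContinuousAt.clog (hgz.div_const _) ?_)
  have := hg _ (hself z hz) _ (hmK z hz) ((hvd z).trans (by linarith))
  have h4 := one_add_mem_slitPlane (this.trans_lt (by norm_num))
  rwa [add_sub_cancel] at h4

theorem exists_log_awayFrom {A : Set ℂ} (hA : IsPreconnected A)
    (hu : ¬ Bornology.IsBounded A) {g : ℂ → ℂ} (hg : ContinuousOn g Aᶜ) (h0 : ∀ z ∈ Aᶜ, g z ≠ 0)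
    (R : ℝ) {δ : ℝ} (hδ : 0 < δ) :
    ∃ l : ℂ → ℂ, ContinuousOn l (awayFrom A R δ) ∧
      ∀ z ∈ awayFrom A R δ, Complex.exp (l z) = g z := by
  set K : Set ℂ := closedBall 0 (R + 2) ∩ {z | δ / 4 ≤ infDist z A} with hK
  have hKc : IsCompact K := (isCompact_closedBall _ _).inter_right
    (isClosed_le continuous_const (continuous_infDist_pt A))
  have hpos : ∀ z, 0 < infDist z A → z ∈ Aᶜ := fun z hz hzA ↦ by
    rw [infDist_zero_of_mem hzA] at hz; exact hz.false
  have hKA : K ⊆ Aᶜ := fun z hz ↦ hpos z (by have : δ / 4 ≤ infDist z A := hz.2; linarith)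
  have hsub : awayFrom A (R + 2) (δ / 4) ⊆ K := fun z hz ↦ ⟨by simpa using hz.1.le, hz.2.le⟩
  obtain ⟨μ, hμ, hmin⟩ := hKc.exists_forall_le' (f := fun z ↦ ‖g z‖) (hg.mono hKA).norm
    (a := 0) (fun z hz ↦ norm_pos_iff.mpr (h0 z (hKA hz)))
  obtain ⟨η, hη, hunif⟩ := Metric.uniformContinuousOn_iff.mp
    (hKc.uniformContinuousOn_of_continuous (hg.mono hKA)) (μ / 8) (by positivity)
  set ε := min (min (1 / 16) (δ / 32)) (η / 8) with hε
  have e1 : ε ≤ 1 / 16 := (min_le_left _ _).trans (min_le_left _ _)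
  have e2 : ε ≤ δ / 32 := (min_le_left _ _).trans (min_le_right _ _)
  have e3 : ε ≤ η / 8 := min_le_right _ _
  refine exists_log_awayFrom_of_mesh hA hu hδ (by positivity : 0 < ε) e1 e2
    (fun z hz ↦ h0 z (hKA (hsub hz))) (fun x hx y hy hxy ↦ ?_)
    (hg.mono fun z hz ↦ hpos z (hδ.trans hz.2))
  have h1 := hunif x (hsub hx) y (hsub hy) (by rw [dist_eq_norm]; linarith)
  have h2 := hmin y (hsub hy)
  rw [dist_eq_norm] at h1
  rw [div_sub_one (h0 y (hKA (hsub hy))), norm_div, div_le_iff₀ (hμ.trans_le h2)]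
  linarith

/-- A nonvanishing continuous function on the connected complement of an unbounded closed connected
set has a continuous logarithm. -/
theorem exists_log_compl {A : Set ℂ} (hA : IsPreconnected A) (hAc : IsClosed A)
    (hu : ¬ Bornology.IsBounded A) (hU : IsPreconnected Aᶜ) {g : ℂ → ℂ} (hg : ContinuousOn g Aᶜ)
    (h0 : ∀ z ∈ Aᶜ, g z ≠ 0) :
    ∃ l : ℂ → ℂ, ContinuousOn l Aᶜ ∧ ∀ z ∈ Aᶜ, Complex.exp (l z) = g z := by
  rcases Aᶜ.eq_empty_or_nonempty with hemp | ⟨z0, hz0⟩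
  · exact ⟨0, by simp [hemp]⟩
  have hne : A.Nonempty := by
    by_contra h
    exact hu (by simp [not_nonempty_iff_eq_empty.mp h])
  set K : ℕ → Set ℂ := fun n ↦ awayFrom A n (1 / (n + 1)) with hK
  have hKo : ∀ n, IsOpen (K n) := fun n ↦ isOpen_awayFrom _ _ _
  have hKmono : Monotone K := fun n m h z hz ↦ by
    have h' : (n : ℝ) ≤ m := by exact_mod_cast h
    exact ⟨hz.1.trans_le h', (one_div_le_one_div_of_le (by positivity) (by linarith)).trans_lt hz.2⟩
  have hKA : ∀ n, K n ⊆ Aᶜ := fun n z hz hzA ↦ by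
    have := hz.2
    rw [infDist_zero_of_mem hzA] at this
    exact (this.trans (by positivity)).false
  choose l hl hle using fun n : ℕ ↦ exists_log_awayFrom hA hu hg h0 n
    (δ := 1 / (n + 1)) (by positivity)
  set C : ℕ → Set ℂ := fun n ↦ connectedComponentIn (K n) z0 with hC
  have hCK : ∀ n, C n ⊆ K n := fun n ↦ connectedComponentIn_subset _ _
  have hCmono : Monotone C := fun n m h ↦ connectedComponentIn_mono _ (hKmono h)
  have hCo : ∀ n, IsOpen (C n) := fun n ↦ (hKo n).connectedComponentIn
  have hz0C : ∀ n, ∀ z ∈ C n, z0 ∈ C n := fun n z hz ↦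
    mem_connectedComponentIn (connectedComponentIn_nonempty_iff.mp ⟨z, hz⟩)
  have hcover : ∀ z ∈ Aᶜ, ∃ n, z ∈ C n := by
    intro z hz
    have hpc : IsPathConnected Aᶜ := (hAc.isOpen_compl.isConnected_iff_isPathConnected).mp
      ⟨⟨z0, hz0⟩, hU⟩
    obtain ⟨γ, hγ⟩ := hpc.joinedIn z0 hz0 z hz
    have hcomp : IsCompact (range γ) := isCompact_range γ.continuous
    have hcov : range γ ⊆ ⋃ n, K n := by
      rintro _ ⟨t, rfl⟩
      have hpos : 0 < infDist (γ t) A := (hAc.notMem_iff_infDist_pos hne).mp (hγ t)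
      obtain ⟨n, hn⟩ := exists_nat_one_div_lt hpos
      obtain ⟨m, hm⟩ := exists_nat_gt ‖γ t‖
      refine mem_iUnion.mpr ⟨max n m, ?_, ?_⟩
      · exact hm.trans_le (by exact_mod_cast le_max_right n m)
      · refine lt_of_le_of_lt (one_div_le_one_div_of_le (by positivity) ?_) hn
        have : (n : ℝ) ≤ (max n m : ℕ) := by exact_mod_cast le_max_left n m
        linarith
    obtain ⟨n, hn⟩ := hcomp.elim_directed_cover K hKo hcov hKmono.directed_le
    refine ⟨n, (isPreconnected_range γ.continuous).subset_connectedComponentIn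
      ⟨0, γ.source⟩ hn ⟨1, γ.target⟩⟩
  classical
  choose! N hN using hcover
  set l' : ℕ → ℂ → ℂ := fun n z ↦ l n z - l n z0 with hl'
  have hagree : ∀ n m, n ≤ m → ∀ z ∈ C n, l' n z = l' m z := by
    intro n m h z hz
    have hc : ∀ w ∈ C n, Complex.exp (l n w - l m w) = 1 := fun w hw ↦ by
      rw [Complex.exp_sub, hle n w (hCK n hw), hle m w (hKmono h (hCK n hw)),
        div_self (h0 w (hKA n (hCK n hw)))]
    have := exp_constOn (N := fun w ↦ l n w - l m w) (isPreconnected_connectedComponentIn (F := K n)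
      (x := z0)) (((hl n).mono (hCK n)).sub ((hl m).mono ((hCK n).trans (hKmono h))))
      (fun x hx y hy ↦ by rw [hc x hx, hc y hy]) hz (hz0C n z hz)
    simp only [hl']
    linear_combination this
  have hagree' : ∀ n m, ∀ z ∈ C n, z ∈ C m → l' n z = l' m z := by
    intro n m z hn hm
    rcases le_total n m with h | h
    exacts [hagree n m h z hn, (hagree m n h z hm).symm]
  refine ⟨fun z ↦ l' (N z) z + Complex.log (g z0), fun z hz ↦ ContinuousAt.continuousWithinAt ?_,
    fun z hz ↦ ?_⟩
  · have hev : ∀ᶠ w in 𝓝 z, l' (N z) w + Complex.log (g z0) = l' (N w) w + Complex.log (g z0) := by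
      filter_upwards [(hCo (N z)).mem_nhds (hN z hz)] with w hw
      rw [hagree' (N z) (N w) w hw (hN w (hKA _ (hCK _ hw)))]
    refine ContinuousAt.congr ?_ hev
    refine ContinuousAt.add (ContinuousAt.sub ?_ continuousAt_const) continuousAt_const
    exact (hl (N z)).continuousAt ((hKo _).mem_nhds (hCK _ (hN z hz)))
  · simp only [hl']
    rw [Complex.exp_add, Complex.exp_sub, hle _ _ (hCK _ (hN z hz)),
      hle _ _ (hCK _ (hz0C _ z (hN z hz))), Complex.exp_log (h0 z0 hz0), div_mul_cancel₀ _
          (h0 z0 hz0)]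

theorem differentiableOn_of_exp {U : Set ℂ} (hU : IsOpen U) {l g : ℂ → ℂ} (hl : ContinuousOn l U)
    (hg : DifferentiableOn ℂ g U) (h : ∀ z ∈ U, Complex.exp (l z) = g z) :
    DifferentiableOn ℂ l U := by
  intro z hz
  have hlz := hl.continuousAt (hU.mem_nhds hz)
  have hgz := hg.differentiableAt (hU.mem_nhds hz)
  have h0 : ∀ w ∈ U, g w ≠ 0 := fun w hw ↦ h w hw ▸ Complex.exp_ne_zero _
  have hs : g z / g z ∈ Complex.slitPlane := by
    rw [div_self (h0 z hz)]; exact Complex.one_mem_slitPlane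
  have hd : DifferentiableAt ℂ (fun w ↦ l z + Complex.log (g w / g z)) z :=
    (DifferentiableAt.clog (hgz.div_const _) hs).const_add _
  have hc : ContinuousAt (fun w ↦ l w - (l z + Complex.log (g w / g z))) z :=
    hlz.sub hd.continuousAt
  have hev : ∀ᶠ w in 𝓝 z, ‖l w - (l z + Complex.log (g w / g z))‖ < 6 := by
    refine hc.norm.eventually_lt continuousAt_const ?_
    simp [div_self (h0 z hz)]
  refine (hd.congr_of_eventuallyEq ?_).differentiableWithinAt
  filter_upwards [hev, hU.mem_nhds hz] with w hw hwU
  refine sub_eq_zero.mp (eq_zero_of_exp_eq_one ?_ hw)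
  rw [Complex.exp_sub, Complex.exp_add, h w hwU, h z hz, Complex.exp_log
    (div_ne_zero (h0 w hwU) (h0 z hz)), mul_div_cancel₀ _ (h0 z hz), div_self (h0 w hwU)]

/-- A nonvanishing holomorphic function on the connected complement of an unbounded closed connected
set has a holomorphic square root. -/
theorem exists_sqrt_compl {A : Set ℂ} (hA : IsPreconnected A) (hAc : IsClosed A)
    (hu : ¬ Bornology.IsBounded A) (hU : IsPreconnected Aᶜ) {g : ℂ → ℂ}
    (hg : DifferentiableOn ℂ g Aᶜ) (h0 : ∀ z ∈ Aᶜ, g z ≠ 0) :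
    ∃ s : ℂ → ℂ, DifferentiableOn ℂ s Aᶜ ∧ ∀ z ∈ Aᶜ, s z ^ 2 = g z := by
  obtain ⟨l, hl, hle⟩ := exists_log_compl hA hAc hu hU hg.continuousOn h0
  refine ⟨fun z ↦ Complex.exp (l z / 2),
    ((differentiableOn_of_exp hAc.isOpen_compl hl hg hle).div_const _).cexp, fun z hz ↦ ?_⟩
  rw [← Complex.exp_nat_mul, ← hle z hz]
  congr 1
  push_cast
  ring

/-- The automorphism of the unit disc which vanishes at `a`. -/
noncomputable def discAut (a z : ℂ) : ℂ := (z - a) / (1 - (starRingEnd ℂ) a * z)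

theorem discAut_denom_ne_zero {a z : ℂ} (ha : ‖a‖ < 1) (hz : ‖z‖ < 1) :
    1 - (starRingEnd ℂ) a * z ≠ 0 := by
  intro h
  have h1 : ‖(starRingEnd ℂ) a * z‖ = 1 := by rw [← sub_eq_zero.mp h, norm_one]
  rw [norm_mul, Complex.norm_conj] at h1
  nlinarith [norm_nonneg a, norm_nonneg z]

theorem norm_discAut_lt_one {a z : ℂ} (ha : ‖a‖ < 1) (hz : ‖z‖ < 1) : ‖discAut a z‖ < 1 := by
  have h0 := discAut_denom_ne_zero ha hz
  rw [discAut, norm_div, div_lt_one (norm_pos_iff.mpr h0)]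
  refine lt_of_pow_lt_pow_left₀ 2 (norm_nonneg _) ?_
  have ha' : ‖a‖ ^ 2 < 1 := by nlinarith [norm_nonneg a]
  have hz' : ‖z‖ ^ 2 < 1 := by nlinarith [norm_nonneg z]
  rw [← Complex.normSq_eq_norm_sq, Complex.normSq_apply] at ha' hz' ⊢
  rw [← Complex.normSq_eq_norm_sq, Complex.normSq_apply]
  simp only [Complex.sub_re, Complex.sub_im, Complex.one_re, Complex.one_im, Complex.mul_re,
    Complex.mul_im, Complex.conj_re, Complex.conj_im]
  nlinarith [mul_pos (sub_pos.mpr ha') (sub_pos.mpr hz')]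

theorem discAut_injOn {a : ℂ} (ha : ‖a‖ < 1) : InjOn (discAut a) (ball 0 1) := by
  intro z hz w hw h
  rw [mem_ball_zero_iff] at hz hw
  rw [discAut, discAut, div_eq_div_iff (discAut_denom_ne_zero ha hz)
    (discAut_denom_ne_zero ha hw)] at h
  have h1 := discAut_denom_ne_zero ha ha
  refine sub_eq_zero.mp ((mul_eq_zero.mp ?_).resolve_right h1)
  linear_combination h

theorem hasDerivAt_discAut {a z : ℂ} (ha : ‖a‖ < 1) (hz : ‖z‖ < 1) :
    HasDerivAt (discAut a)
      ((1 - (starRingEnd ℂ) a * a) / (1 - (starRingEnd ℂ) a * z) ^ 2) z := by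
  have h0 := discAut_denom_ne_zero ha hz
  have h1 : HasDerivAt (fun z ↦ z - a) 1 z := (hasDerivAt_id z).sub_const a
  have h2 : HasDerivAt (fun z ↦ 1 - (starRingEnd ℂ) a * z) (-((starRingEnd ℂ) a * 1)) z :=
    ((hasDerivAt_id z).const_mul _).const_sub 1
  refine (h1.fun_div h2 h0).congr_deriv ?_
  ring

/-- A family of holomorphic functions bounded by one converges locally uniformly along any
ultrafilter. -/
theorem exists_tendstoLocallyUniformlyOn {U : Set ℂ} (hU : IsOpen U) {ι : Type*} (l : Ultrafilter ι)
    {F : ι → ℂ → ℂ} (hF : ∀ i, DifferentiableOn ℂ (F i) U) (hb : ∀ i, ∀ z ∈ U, ‖F i z‖ < 1) :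
    ∃ f : ℂ → ℂ, TendstoLocallyUniformlyOn F f l U ∧ ∀ z ∈ U, Tendsto (fun i ↦ F i z) l
        (𝓝 (f z)) := by
  have hlim : ∀ z ∈ U, ∃ w : ℂ, Tendsto (fun i ↦ F i z) l (𝓝 w) := fun z hz ↦ by
    obtain ⟨w, _, hw⟩ := (isCompact_closedBall (0 : ℂ) 1).ultrafilter_le_nhds
      (l.map fun i ↦ F i z) (by
        rw [le_principal_iff]
        exact mem_map.mpr (Eventually.of_forall fun i ↦ mem_closedBall_zero_iff.mpr (hb i z hz).le))
    exact ⟨w, hw⟩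
  choose! f hf using hlim
  refine ⟨f, ?_, hf⟩
  rw [Metric.tendstoLocallyUniformlyOn_iff]
  intro ε hε z hz
  obtain ⟨r, hr, hrU⟩ := Metric.isOpen_iff.mp hU z hz
  have hlip : ∀ i, ∀ w ∈ ball z r, dist (F i w) (F i z) ≤ 2 / r * dist w z := fun i w hw ↦
    Complex.dist_le_div_mul_dist_of_mapsTo_ball ((hF i).mono hrU) (fun y hy ↦ by
      rw [mem_closedBall, dist_eq_norm]
      refine (norm_sub_le _ _).trans ?_
      linarith [hb i y (hrU hy), hb i z hz]) hw
  have hlip' : ∀ w ∈ ball z r, dist (f w) (f z) ≤ 2 / r * dist w z := fun w hw ↦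
    le_of_tendsto ((hf w (hrU hw)).dist (hf z hz)) (Eventually.of_forall fun i ↦ hlip i w hw)
  set ρ := min r (ε * r / 8) with hρ
  have hρ0 : 0 < ρ := by positivity
  refine ⟨ball z ρ, mem_nhdsWithin_of_mem_nhds (ball_mem_nhds z hρ0), ?_⟩
  filter_upwards [(Metric.tendsto_nhds.mp (hf z hz)) (ε / 4) (by positivity)] with i hi w hw
  have hwr : w ∈ ball z r := ball_subset_ball (min_le_left _ _) hw
  have hw2 : 2 / r * dist w z < ε / 4 := by
    have : dist w z < ε * r / 8 := (mem_ball.mp hw).trans_le (min_le_right _ _)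
    calc 2 / r * dist w z < 2 / r * (ε * r / 8) := by gcongr
      _ = ε / 4 := by field_simp; norm_num
  have h1 := hlip i w hwr
  have h2 := hlip' w hwr
  calc dist (f w) (F i w) ≤ dist (f w) (f z) + dist (f z) (F i z) + dist (F i z) (F i w) :=
        dist_triangle4 _ _ _ _
    _ < ε := by linarith [dist_comm (f z) (F i z), dist_comm (F i z) (F i w)]

/-- If a nonconstant locally uniform limit of holomorphic functions takes the value `w` at `a`, then
the functions eventually take the value `w` near `a`. -/
theorem eventually_exists_eq {U : Set ℂ} (hU : IsOpen U) {ι : Type*} {l : Filter ι}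
    {F : ι → ℂ → ℂ} {f : ℂ → ℂ} (hF : ∀ i, DifferentiableOn ℂ (F i) U)
    (hf : TendstoLocallyUniformlyOn F f l U) (hfd : DifferentiableOn ℂ f U) {a : ℂ} (ha : a ∈ U)
    (hne : ∀ᶠ z in 𝓝[≠] a, f z ≠ f a) {r : ℝ} (hr : 0 < r) :
    ∀ᶠ i in l, ∃ z ∈ ball a r, z ∈ U ∧ F i z = f a := by
  obtain ⟨ρ₁, hρ₁, h1⟩ := Metric.isOpen_iff.mp hU a ha
  obtain ⟨ρ₂, hρ₂, h2⟩ := Metric.mem_nhdsWithin_iff.mp hne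
  obtain ⟨ρ, hρ, hρm⟩ := exists_between (lt_min (lt_min hρ₁ hρ₂) hr)
  have hρ1 : ρ < ρ₁ := hρm.trans_le ((min_le_left _ _).trans (min_le_left _ _))
  have hρ2 : ρ < ρ₂ := hρm.trans_le ((min_le_left _ _).trans (min_le_right _ _))
  have hρ3 : ρ < r := hρm.trans_le (min_le_right _ _)
  have hKU : closedBall a ρ ⊆ U := (closedBall_subset_ball hρ1).trans h1
  obtain ⟨η, hη, hmin⟩ := (isCompact_sphere a ρ).exists_forall_le' (f := fun z ↦ ‖f z - f a‖)
    (a := 0) ((hfd.continuousOn.mono (sphere_subset_closedBall.trans hKU)).sub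
      continuousOn_const).norm (fun z hz ↦ norm_pos_iff.mpr (sub_ne_zero.mpr (h2 ⟨by
        rw [mem_ball, mem_sphere.mp hz]; exact hρ2, ne_of_mem_sphere hz hρ.ne'⟩)))
  have hunif := (tendstoLocallyUniformlyOn_iff_forall_isCompact hU).mp hf _ hKU
    (isCompact_closedBall a ρ)
  filter_upwards [Metric.tendstoUniformlyOn_iff.mp hunif (η / 5) (by positivity)] with i hi
  have hia := hi a (mem_closedBall_self hρ.le)
  have hs : ∀ z ∈ sphere a ρ, 3 * η / 5 ≤ ‖F i z - F i a‖ := fun z hz ↦ by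
    have h3 := hi z (sphere_subset_closedBall hz)
    have h4 := hmin z hz
    rw [← dist_eq_norm] at h4 ⊢
    have := dist_triangle4 (f z) (F i z) (F i a) (f a)
    rw [dist_comm (F i a)] at this
    linarith
  have hfr : ∃ᶠ z in 𝓝 a, F i z ≠ F i a := by
    intro h
    have h' : ∀ᶠ z in 𝓝 a, F i z = F i a := by simpa using h
    have han : AnalyticOnNhd ℂ (F i) (ball a ρ₁) :=
      ((hF i).mono h1).analyticOnNhd isOpen_ball
    have heq := han.eqOn_of_preconnected_of_eventuallyEq (analyticOnNhd_const (v := F i a))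
      (convex_ball a ρ₁).isPreconnected (mem_ball_self hρ₁) h'
    have hp : a + ρ ∈ sphere a ρ := by simp [abs_of_pos hρ]
    have := hs _ hp
    rw [heq (mem_ball.mpr ((mem_sphere.mp hp).trans_lt hρ1)), sub_self, norm_zero] at this
    linarith
  have hdc : DiffContOnCl ℂ (F i) (ball a ρ) := by
    refine DifferentiableOn.diffContOnCl ?_
    rw [closure_ball _ hρ.ne']
    exact (hF i).mono hKU
  obtain ⟨z, hz, hzf⟩ := hdc.ball_subset_image_closedBall hρ hs hfr
    (show f a ∈ ball (F i a) _ by rw [mem_ball]; linarith)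
  exact ⟨z, closedBall_subset_ball hρ3 hz, hKU hz, hzf⟩

theorem exists_extremal {U : Set ℂ} (hU : IsOpen U) (hUc : IsPreconnected U) {z₀ : ℂ} (hz₀ : z₀ ∈ U)
    (hex : ∃ f : ℂ → ℂ, DifferentiableOn ℂ f U ∧ InjOn f U ∧ MapsTo f U (ball 0 1) ∧ f z₀ = 0) :
    ∃ f : ℂ → ℂ, (DifferentiableOn ℂ f U ∧ InjOn f U ∧ MapsTo f U (ball 0 1) ∧ f z₀ = 0) ∧
      ∀ g : ℂ → ℂ, (DifferentiableOn ℂ g U ∧ InjOn g U ∧ MapsTo g U (ball 0 1) ∧ g z₀ = 0) →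
        ‖deriv g z₀‖ ≤ ‖deriv f z₀‖ := by
  set S : Set ℝ := {x | ∃ f : ℂ → ℂ, (DifferentiableOn ℂ f U ∧ InjOn f U ∧
    MapsTo f U (ball 0 1) ∧ f z₀ = 0) ∧ ‖deriv f z₀‖ = x} with hS
  obtain ⟨f₀, hf₀⟩ := hex
  obtain ⟨r, hr, hrU⟩ := Metric.isOpen_iff.mp hU z₀ hz₀
  have hbdd : BddAbove S := by
    refine ⟨1 / r, ?_⟩
    rintro _ ⟨f, ⟨h1, _, h3, h4⟩, rfl⟩
    refine Complex.norm_deriv_le_div_of_mapsTo_ball (h1.mono hrU) (fun z hz ↦ ?_) hr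
    rw [h4]
    exact ball_subset_closedBall (h3 (hrU hz))
  obtain ⟨u, _, hu, huS⟩ := exists_seq_tendsto_sSup (S := S) ⟨_, f₀, hf₀, rfl⟩ hbdd
  choose F hF hFu using huS
  set l : Ultrafilter ℕ := hyperfilter ℕ with hl
  have hl' : (l : Filter ℕ) ≤ atTop := Nat.hyperfilter_le_atTop
  obtain ⟨f, hf, hfp⟩ := exists_tendstoLocallyUniformlyOn hU l (fun i ↦ (hF i).1)
    (fun i z hz ↦ mem_ball_zero_iff.mp ((hF i).2.2.1 hz))
  have hfd : DifferentiableOn ℂ f U :=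
    hf.differentiableOn (Eventually.of_forall fun i ↦ (hF i).1) hU
  have hderiv : ‖deriv f z₀‖ = sSup S := by
    have h1 := ((hf.deriv (Eventually.of_forall fun i ↦ (hF i).1) hU).tendsto_at hz₀).norm
    refine tendsto_nhds_unique h1 ((hu.mono_left hl').congr fun i ↦ ?_)
    exact (hFu i).symm
  have hle : ∀ g : ℂ → ℂ, (DifferentiableOn ℂ g U ∧ InjOn g U ∧ MapsTo g U (ball 0 1) ∧ g z₀ = 0) →
        ‖deriv g z₀‖ ≤ ‖deriv f z₀‖ := fun g hg ↦ hderiv ▸ le_csSup hbdd ⟨g, hg, rfl⟩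
  have hne0 : deriv f z₀ ≠ 0 := norm_pos_iff.mp <|
    (norm_pos_iff.mpr (deriv_ne_zero_of_injOn hU hf₀.1 hf₀.2.1 hz₀)).trans_le (hle f₀ hf₀)
  have hne : ∀ a ∈ U, ∀ᶠ z in 𝓝[≠] a, f z ≠ f a := by
    intro a ha
    have han := hfd.analyticOnNhd hU
    refine ((han a ha).eventually_eq_or_eventually_ne analyticAt_const).resolve_left fun h ↦ hne0 ?_
    have heq := han.eqOn_of_preconnected_of_eventuallyEq (analyticOnNhd_const (v := f a)) hUc ha h
    rw [(heq.eventuallyEq_of_mem (hU.mem_nhds hz₀)).deriv_eq]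
    simp
  have hinj : InjOn f U := by
    intro a ha b hb hab
    by_contra hne'
    have hd : 0 < dist a b / 2 := half_pos (dist_pos.mpr hne')
    have ea := eventually_exists_eq hU (fun i ↦ (hF i).1) hf hfd ha (hne a ha) hd
    have eb := eventually_exists_eq hU (fun i ↦ (hF i).1) hf hfd hb (hne b hb) hd
    obtain ⟨i, ⟨x, hx, hxU, hxf⟩, y, hy, hyU, hyf⟩ := (ea.and eb).exists
    have hxy : x = y := (hF i).2.1 hxU hyU (by rw [hxf, hyf, hab])
    subst hxy
    have := dist_triangle_left a b x
    rw [mem_ball] at hx hy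
    linarith
  refine ⟨f, ⟨hfd, hinj, fun z hz ↦ ?_, ?_⟩, hle⟩
  · rw [← interior_closedBall _ one_ne_zero, mem_interior_iff_mem_nhds]
    refine Filter.mem_of_superset (image_mem_nhds_of_injOn hU hfd hinj hz (hU.mem_nhds hz)) ?_
    rintro _ ⟨w, hw, rfl⟩
    exact isClosed_closedBall.mem_of_tendsto (hfp w hw)
      (Eventually.of_forall fun i ↦ ball_subset_closedBall ((hF i).2.2.1 hw))
  · exact tendsto_nhds_unique (hfp z₀ hz₀) ((tendsto_const_nhds).congr fun i ↦ ((hF i).2.2.2).symm)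

theorem exists_image_eq_ball {U : Set ℂ} (hU : IsOpen U) (hUc : IsPreconnected U) {z₀ : ℂ}
    (hz₀ : z₀ ∈ U)
    (hsqrt : ∀ g : ℂ → ℂ, DifferentiableOn ℂ g U → (∀ z ∈ U, g z ≠ 0) →
      ∃ s : ℂ → ℂ, DifferentiableOn ℂ s U ∧ ∀ z ∈ U, s z ^ 2 = g z)
    (hex : ∃ f : ℂ → ℂ, DifferentiableOn ℂ f U ∧ InjOn f U ∧ MapsTo f U (ball 0 1)) :
    ∃ f : ℂ → ℂ, DifferentiableOn ℂ f U ∧ InjOn f U ∧ f '' U = ball 0 1 := by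
  have hcomp : ∀ a : ℂ, ‖a‖ < 1 → ∀ f : ℂ → ℂ, DifferentiableOn ℂ f U → MapsTo f U (ball 0 1) →
      DifferentiableOn ℂ (fun z ↦ discAut a (f z)) U ∧
      MapsTo (fun z ↦ discAut a (f z)) U (ball 0 1) := by
    intro a ha f hf hm
    have hm' : ∀ z ∈ U, ‖f z‖ < 1 := fun z hz ↦ mem_ball_zero_iff.mp (hm hz)
    refine ⟨fun z hz ↦ ?_, fun z hz ↦ mem_ball_zero_iff.mpr (norm_discAut_lt_one ha (hm' z hz))⟩
    exact (hasDerivAt_discAut ha (hm' z hz)).differentiableAt.comp_differentiableWithinAt z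
        (hf z hz)
  obtain ⟨f, ⟨hf1, hf2, hf3, hf4⟩, hmax⟩ := exists_extremal hU hUc hz₀ (by
    obtain ⟨f, h1, h2, h3⟩ := hex
    have ha : ‖f z₀‖ < 1 := mem_ball_zero_iff.mp (h3 hz₀)
    obtain ⟨c1, c2⟩ := hcomp (f z₀) ha f h1 h3
    exact ⟨fun z ↦ discAut (f z₀) (f z), c1,
      fun z hz w hw h ↦ h2 hz hw (discAut_injOn ha (h3 hz) (h3 hw) h), c2, by simp [discAut]⟩)
  refine ⟨f, hf1, hf2, hf3.image_subset.antisymm fun w hw ↦ ?_⟩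
  by_contra hwf
  have hw1 : ‖w‖ < 1 := mem_ball_zero_iff.mp hw
  have hfn : ∀ z ∈ U, ‖f z‖ < 1 := fun z hz ↦ mem_ball_zero_iff.mp (hf3 hz)
  obtain ⟨c1, c2⟩ := hcomp w hw1 f hf1 hf3
  obtain ⟨s, hs1, hs2⟩ := hsqrt _ c1 fun z hz h ↦ by
    rw [discAut, div_eq_zero_iff, or_iff_left (discAut_denom_ne_zero hw1 (hfn z hz)),
      sub_eq_zero] at h
    exact hwf ⟨z, hz, h⟩
  have hs3 : MapsTo s U (ball 0 1) := fun z hz ↦ by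
    have : ‖discAut w (f z)‖ < 1 := mem_ball_zero_iff.mp (c2 hz)
    rw [← hs2 z hz, norm_pow] at this
    rw [mem_ball_zero_iff]
    nlinarith [norm_nonneg (s z)]
  set b := s z₀ with hb
  have hb1 : ‖b‖ < 1 := mem_ball_zero_iff.mp (hs3 hz₀)
  obtain ⟨d1, d2⟩ := hcomp b hb1 s hs1 hs3
  have hbw : b ^ 2 = -w := by
    rw [hb, hs2 z₀ hz₀, hf4]; simp [discAut]
  have hw0 : w ≠ 0 := fun h ↦ hwf ⟨z₀, hz₀, by rw [hf4, h]⟩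
  have hb0 : b ≠ 0 := by rintro h; rw [h] at hbw; simp at hbw; exact hw0 hbw
  have hle := hmax (fun z ↦ discAut b (s z)) ⟨d1, fun z hz y hy h ↦ hf2 hz hy ?_, d2, by
    simp [discAut, hb]⟩
  · have hsd : HasDerivAt s (deriv s z₀) z₀ := (hs1.differentiableAt (hU.mem_nhds hz₀)).hasDerivAt
    have hfd : HasDerivAt f (deriv f z₀) z₀ := (hf1.differentiableAt (hU.mem_nhds hz₀)).hasDerivAt
    have e1 : deriv (fun z ↦ discAut b (s z)) z₀ = deriv s z₀ / (1 - (starRingEnd ℂ) b * b) := by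
      have h0 := discAut_denom_ne_zero hb1 hb1
      have hcd : HasDerivAt (fun z ↦ discAut b (s z)) _ z₀ :=
        (hasDerivAt_discAut hb1 hb1).comp z₀ hsd
      rw [hcd.deriv]
      field_simp
    have e2 : 2 * b * deriv s z₀ = (1 - (starRingEnd ℂ) w * w) * deriv f z₀ := by
      have h1 : HasDerivAt (fun z ↦ s z ^ 2) (2 * b * deriv s z₀) z₀ := by
        refine (hsd.fun_pow 2).congr_deriv ?_
        push_cast; ring
      have h2 : HasDerivAt (fun z ↦ discAut w (f z))
          ((1 - (starRingEnd ℂ) w * w) * deriv f z₀) z₀ := by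
        have : HasDerivAt (fun z ↦ discAut w (f z)) _ z₀ :=
          (hasDerivAt_discAut hw1 (hfn z₀ hz₀)).comp z₀ hfd
        exact this.congr_deriv (by rw [hf4]; simp)
      refine h1.unique (h2.congr_of_eventuallyEq ?_)
      filter_upwards [hU.mem_nhds hz₀] with z hz using hs2 z hz
    have hconj : ∀ x : ℂ, ‖x‖ < 1 → ‖1 - (starRingEnd ℂ) x * x‖ = 1 - ‖x‖ ^ 2 := by
      intro x hx
      rw [mul_comm, Complex.mul_conj, Complex.normSq_eq_norm_sq]
      have : (1 : ℂ) - ((‖x‖ ^ 2 : ℝ) : ℂ) = ((1 - ‖x‖ ^ 2 : ℝ) : ℂ) := by push_cast; ring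
      rw [this, Complex.norm_real, Real.norm_of_nonneg]
      nlinarith [norm_nonneg x]
    have hwb : ‖w‖ = ‖b‖ ^ 2 := by rw [← norm_pow, hbw, norm_neg]
    have e3 := congrArg norm e2
    rw [norm_mul, norm_mul, norm_mul, hconj w hw1, hwb, Complex.norm_ofNat] at e3
    rw [e1, norm_div, hconj b hb1] at hle
    have hβ : 0 < ‖b‖ := norm_pos_iff.mpr hb0
    have hq : 0 < 1 - ‖b‖ ^ 2 := by nlinarith
    have hfpos : 0 < ‖deriv f z₀‖ := norm_pos_iff.mpr (deriv_ne_zero_of_injOn hU hf1 hf2 hz₀)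
    rw [div_le_iff₀ hq] at hle
    have h5 : (1 - (‖b‖ ^ 2) ^ 2) * ‖deriv f z₀‖ ≤ 2 * ‖b‖ * (‖deriv f z₀‖ * (1 - ‖b‖ ^ 2)) := by
      rw [← e3]; exact mul_le_mul_of_nonneg_left hle (by positivity)
    have h6 : 0 < ‖deriv f z₀‖ * (1 - ‖b‖ ^ 2) * (1 - ‖b‖) ^ 2 := by
      have : 0 < 1 - ‖b‖ := by linarith
      positivity
    nlinarith
  · have h1 := discAut_injOn hb1 (hs3 hz) (hs3 hy) h
    refine discAut_injOn hw1 (hf3 hz) (hf3 hy) ?_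
    rw [← hs2 z hz, ← hs2 y hy, h1]

theorem exists_holomorphic_inverse {U : Set ℂ} (hU : IsOpen U) {f : ℂ → ℂ}
    (hf : DifferentiableOn ℂ f U) (hi : InjOn f U) :
    ∃ g : ℂ → ℂ, DifferentiableOn ℂ g (f '' U) ∧ ∀ z ∈ U, g (f z) = z := by
  have hl : LeftInvOn (Function.invFunOn f U) f U := hi.leftInvOn_invFunOn
  refine ⟨Function.invFunOn f U, ?_, fun z hz ↦ hl hz⟩
  rintro _ ⟨z, hz, rfl⟩
  have hc : ContinuousAt (Function.invFunOn f U) (f z) := by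
    rw [ContinuousAt, hl hz]
    intro V hV
    refine mem_map.mpr (Filter.mem_of_superset (image_mem_nhds_of_injOn hU hf hi hz
      (inter_mem hV (hU.mem_nhds hz))) ?_)
    rintro _ ⟨w, ⟨hw1, hw2⟩, rfl⟩
    rwa [mem_preimage, hl hw2]
  refine DifferentiableAt.differentiableWithinAt (HasDerivAt.differentiableAt
    (HasDerivAt.of_local_left_inverse (f := f) (f' := deriv f z) hc ?_
    (deriv_ne_zero_of_injOn hU hf hi hz) ?_))
  · rw [hl hz]; exact (hf.differentiableAt (hU.mem_nhds hz)).hasDerivAt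
  · filter_upwards [image_mem_nhds_of_injOn hU hf hi hz (hU.mem_nhds hz)] with y hy
    exact Function.invFunOn_eq hy

/-- Riemann mapping theorem, for a connected open set which carries holomorphic square roots. -/
theorem exists_riemann_map {U : Set ℂ} (hU : IsOpen U) (hUc : IsPreconnected U) (hne : U.Nonempty)
    (hsqrt : ∀ g : ℂ → ℂ, DifferentiableOn ℂ g U → (∀ z ∈ U, g z ≠ 0) →
      ∃ s : ℂ → ℂ, DifferentiableOn ℂ s U ∧ ∀ z ∈ U, s z ^ 2 = g z)
    (hex : ∃ f : ℂ → ℂ, DifferentiableOn ℂ f U ∧ InjOn f U ∧ MapsTo f U (ball 0 1)) :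
    ∃ ψ : ℂ → ℂ, DifferentiableOn ℂ ψ {z | 0 < z.im} ∧ InjOn ψ {z | 0 < z.im} ∧
      ψ '' {z | 0 < z.im} = U := by
  obtain ⟨z₀, hz₀⟩ := hne
  obtain ⟨f, hf1, hf2, hf3⟩ := exists_image_eq_ball hU hUc hz₀ hsqrt hex
  obtain ⟨g, hg1, hg2⟩ := exists_holomorphic_inverse hU hf1 hf2
  rw [hf3] at hg1
  have hden : ∀ z : ℂ, 0 < z.im → z + Complex.I ≠ 0 := fun z hz h ↦ by
    have := congrArg Complex.im h
    simp at this; linarith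
  set C : ℂ → ℂ := fun z ↦ (z - Complex.I) / (z + Complex.I) with hC
  have hCd : DifferentiableOn ℂ C {z | 0 < z.im} := by
    intro z hz
    exact (DifferentiableAt.fun_div (d := fun z ↦ z + Complex.I) (by fun_prop)
      (by fun_prop) (hden z hz)).differentiableWithinAt
  have hCm : ∀ z : ℂ, 0 < z.im → C z ∈ ball 0 1 := by
    intro z hz
    rw [mem_ball_zero_iff, hC, norm_div, div_lt_one (norm_pos_iff.mpr (hden z hz))]
    refine lt_of_pow_lt_pow_left₀ 2 (norm_nonneg _) ?_
    rw [← Complex.normSq_eq_norm_sq, ← Complex.normSq_eq_norm_sq, Complex.normSq_apply,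
      Complex.normSq_apply]
    simp only [Complex.sub_re, Complex.sub_im, Complex.add_re, Complex.add_im, Complex.I_re,
      Complex.I_im]
    nlinarith
  have hCi : InjOn C {z | 0 < z.im} := by
    intro z hz w hw h
    simp only [hC] at h
    rw [div_eq_div_iff (hden z hz) (hden w hw)] at h
    have : 2 * Complex.I * (z - w) = 0 := by linear_combination h
    simpa [sub_eq_zero, Complex.I_ne_zero] using this
  have hCs : ∀ w ∈ ball (0 : ℂ) 1, ∃ z : ℂ, 0 < z.im ∧ C z = w := by
    intro w hw
    rw [mem_ball_zero_iff] at hw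
    have h1 : 1 - w ≠ 0 := fun h ↦ by rw [← sub_eq_zero.mp h, norm_one] at hw; exact hw.false
    refine ⟨Complex.I * (1 + w) / (1 - w), ?_, ?_⟩
    · have hns : 0 < Complex.normSq (1 - w) := Complex.normSq_pos.mpr h1
      have hw2 : Complex.normSq w < 1 := by
        rw [Complex.normSq_eq_norm_sq]; nlinarith [norm_nonneg w]
      rw [Complex.normSq_apply] at hw2
      rw [Complex.div_im, ← sub_div]
      refine div_pos ?_ hns
      simp
      nlinarith
    · have h2 : Complex.I * (1 + w) / (1 - w) + Complex.I ≠ 0 := by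
        have : Complex.I * (1 + w) / (1 - w) + Complex.I = 2 * Complex.I / (1 - w) := by
          field_simp; ring
        rw [this]
        exact div_ne_zero (mul_ne_zero two_ne_zero Complex.I_ne_zero) h1
      simp only [hC]
      rw [div_eq_iff h2]
      field_simp
      ring
  have hgm : ∀ w ∈ ball (0 : ℂ) 1, g w ∈ U ∧ f (g w) = w := fun w hw ↦ by
    rw [← hf3] at hw
    obtain ⟨z, hz, rfl⟩ := hw
    rw [hg2 z hz]
    exact ⟨hz, rfl⟩
  refine ⟨fun z ↦ g (C z), hg1.comp hCd fun z hz ↦ hCm z hz, fun z hz w hw h ↦ hCi hz hw ?_, ?_⟩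
  · rw [← (hgm _ (hCm z hz)).2, ← (hgm _ (hCm w hw)).2]
    exact congrArg f h
  · ext z
    constructor
    · rintro ⟨y, hy, rfl⟩
      exact (hgm _ (hCm y hy)).1
    · intro hz
      obtain ⟨y, hy, hyz⟩ := hCs (f z) (hf3 ▸ mem_image_of_mem f hz)
      exact ⟨y, hy, by simp only [hyz, hg2 z hz]⟩

theorem exists_log_univ {f : ℂ → ℂ} (hf : Continuous f) (h0 : ∀ z, f z ≠ 0) :
    ∃ L : ℂ → ℂ, Continuous L ∧ ∀ z, Complex.exp (L z) = f z := by
  obtain ⟨L, hL, h⟩ := exists_log_family (X := ℂ) (F := fun z t ↦ f ((t : ℝ) * z))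
    (by simp only [Function.uncurry_def]; fun_prop) (fun _ _ ↦ h0 _)
  refine ⟨fun z ↦ L z 1 + Complex.log (f 0), ?_, fun z ↦ ?_⟩
  · exact (hL.comp (Continuous.prodMk_left (1 : I))).add continuous_const
  · rw [Complex.exp_add, h, Complex.exp_log (h0 0)]
    simp [div_mul_cancel₀ _ (h0 0)]

theorem isPreconnected_lt_norm {R : ℝ} (hR : 0 < R) : IsPreconnected {z : ℂ | R < ‖z‖} := by
  have : {z : ℂ | R < ‖z‖} = Complex.exp '' {z | Real.log R < z.re} := by
    ext z
    constructor
    · intro (hz : R < ‖z‖)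
      have h0 : z ≠ 0 := norm_pos_iff.mp (hR.trans hz)
      exact ⟨Complex.log z, by
        simpa only [mem_ofPred_eq, Complex.log_re] using Real.log_lt_log hR hz, Complex.exp_log h0⟩
    · rintro ⟨w, hw, rfl⟩
      rw [mem_ofPred_eq, Complex.norm_exp, ← Real.log_lt_iff_lt_exp hR]
      exact hw
  rw [this]
  exact (convex_halfSpace_re_gt _).isPreconnected.image _ Complex.continuous_exp.continuousOn

/-- A continuous nonvanishing function on the plane cannot agree with `z - p` on a large circle. -/
theorem exists_ne_sub_of_continuous {f : ℂ → ℂ} (hf : Continuous f) (h0 : ∀ z, f z ≠ 0) (p : ℂ)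
    {R : ℝ} (hR : 0 < R) : ∃ z ∈ sphere p R, f z ≠ z - p := by
  by_contra! h
  obtain ⟨L, hL, hLe⟩ := exists_log_univ hf h0
  set c : I → ℂ := fun t ↦ p + R * Complex.exp (2 * Real.pi * Complex.I * (t : ℝ)) with hc
  have hcs : ∀ t, c t ∈ sphere p R := fun t ↦ by
    have : (2 * Real.pi * Complex.I * (t : ℝ) : ℂ) = ((2 * Real.pi * t : ℝ) : ℂ) * Complex.I := by
      push_cast; ring
    rw [mem_sphere, dist_eq_norm, hc]
    simp only [add_sub_cancel_left]
    rw [this, norm_mul, Complex.norm_exp_ofReal_mul_I, mul_one, Complex.norm_real,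
      Real.norm_of_nonneg hR.le]
  have hcc : Continuous c := by fun_prop
  have hN : ∀ t : I, Complex.exp (L (c t) - 2 * Real.pi * Complex.I * (t : ℝ)) = R := fun t ↦ by
    rw [Complex.exp_sub, hLe, h _ (hcs t), hc]
    simp only [add_sub_cancel_left]
    rw [mul_div_cancel_right₀ _ (Complex.exp_ne_zero _)]
  have key := exp_constOn (S := univ) isPreconnected_univ
    (N := fun t : I ↦ L (c t) - 2 * Real.pi * Complex.I * (t : ℝ)) (by fun_prop)
    (fun x _ y _ ↦ by rw [hN, hN]) (mem_univ 0) (mem_univ 1)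
  have h1 : c 1 = c 0 := by simp [hc, Complex.exp_two_pi_mul_I]
  simp only [h1, Icc.coe_zero, Icc.coe_one, Complex.ofReal_zero, Complex.ofReal_one] at key
  exact Complex.two_pi_I_ne_zero (by linear_combination key)

/-- The components of the complement of an arc are unbounded. -/
theorem not_isBounded_connectedComponentIn_compl_arc {γ : I → ℂ} (hγ : Continuous γ)
    (hi : Function.Injective γ) {p : ℂ} (hp : p ∈ (range γ)ᶜ) :
    ¬ Bornology.IsBounded (connectedComponentIn (range γ)ᶜ p) := by
  intro hb
  set V := connectedComponentIn (range γ)ᶜ p with hV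
  have hAo : IsOpen (range γ)ᶜ := (isCompact_range hγ).isClosed.isOpen_compl
  have hVo : IsOpen V := hAo.connectedComponentIn
  have hpV : p ∈ V := mem_connectedComponentIn hp
  have hfr : frontier V ⊆ range γ := by
    intro z hz
    by_contra hzA
    obtain ⟨y, hy, hyV⟩ := mem_closure_iff.mp hz.1 _ (hAo.connectedComponentIn (x := z))
      (mem_connectedComponentIn hzA)
    have hzV : z ∈ V := by
      rw [hV, connectedComponentIn_eq hyV, ← connectedComponentIn_eq hy]
      exact mem_connectedComponentIn hzA
    exact hz.2 (by rwa [hVo.interior_eq])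
  obtain ⟨N, hN, hNe⟩ := exists_log (f := fun t ↦ γ t - p) (by fun_prop)
    (fun t h ↦ hp ⟨t, sub_eq_zero.mp h⟩)
  obtain ⟨G, hG⟩ := ContinuousMap.exists_extension' (hγ.isClosedEmbedding hi) ⟨N, hN⟩
  have hG' : ∀ t, G (γ t) = N t := fun t ↦ congrFun hG t
  classical
  set f : ℂ → ℂ := fun z ↦ if z ∈ closure V then Complex.exp (G z) else z - p with hf
  have hfc : Continuous f := by
    refine Continuous.if (fun z hz ↦ ?_) (Complex.continuous_exp.comp G.continuous) (by fun_prop)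
    obtain ⟨t, rfl⟩ := hfr (frontier_closure_subset hz)
    rw [hG', hNe]
  have hf0 : ∀ z, f z ≠ 0 := fun z ↦ by
    simp only [hf]
    split_ifs with h
    · exact Complex.exp_ne_zero _
    · exact fun h' ↦ h (subset_closure (by rwa [sub_eq_zero.mp h']))
  obtain ⟨R, hR⟩ := hb.closure.subset_ball p
  have hR0 : 0 < R := pos_of_mem_ball (hR (subset_closure hpV))
  obtain ⟨z, hz, hne⟩ := exists_ne_sub_of_continuous hfc hf0 p hR0
  refine hne (if_neg fun h ↦ ?_)
  have := mem_ball.mp (hR h)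
  rw [mem_sphere.mp hz] at this
  exact this.false

/-- An arc does not separate the plane. -/
theorem isPreconnected_compl_arc {γ : I → ℂ} (hγ : Continuous γ) (hi : Function.Injective γ) :
    IsPreconnected (range γ)ᶜ := by
  obtain ⟨R, hR0, hR⟩ := (isCompact_range hγ).isBounded.exists_pos_norm_le
  have hS : {z : ℂ | R < ‖z‖} ⊆ (range γ)ᶜ := fun z hz h ↦ (hR z h).not_gt hz
  have h : ∀ p ∈ (range γ)ᶜ, ∃ z, R < ‖z‖ ∧ z ∈ connectedComponentIn (range γ)ᶜ p := by
    intro p hp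
    by_contra! hc
    exact not_isBounded_connectedComponentIn_compl_arc hγ hi hp
      (isBounded_closedBall.subset fun z hz ↦
        mem_closedBall_zero_iff.mpr (not_lt.mp fun h ↦ hc z h hz))
  refine isPreconnected_of_forall_pair fun p hp q hq ↦ ?_
  obtain ⟨z, hz, hzp⟩ := h p hp
  obtain ⟨w, hw, hwq⟩ := h q hq
  have h1 : w ∈ connectedComponentIn (range γ)ᶜ z :=
    (isPreconnected_lt_norm hR0).subset_connectedComponentIn hz hS hw
  refine ⟨connectedComponentIn (range γ)ᶜ p, connectedComponentIn_subset _ _,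
    mem_connectedComponentIn hp, ?_, isPreconnected_connectedComponentIn⟩
  rw [connectedComponentIn_eq hzp, connectedComponentIn_eq h1, ← connectedComponentIn_eq hwq]
  exact mem_connectedComponentIn hq

theorem locallyPathConnectedSpace_image_Icc {E : Type*} [TopologicalSpace E] [T2Space E] {a b : ℝ}
    (hab : a ≤ b) {γ : ℝ → E} (hγ : ContinuousOn γ (Icc a b)) :
    LocallyPathConnectedSpace (γ '' Icc a b) := by
  set g : ℝ → γ '' Icc a b := fun x ↦ ⟨γ (projIcc a b hab x), mem_image_of_mem γ
      (projIcc a b hab x).2⟩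
    with hg
  have h1 : Continuous fun x : Icc a b ↦ (⟨γ x, mem_image_of_mem γ x.2⟩ : γ '' Icc a b) :=
    (continuousOn_iff_continuous_domRestrict.mp hγ).subtype_mk _
  have hq : IsQuotientMap g := by
    refine IsQuotientMap.comp (g := fun x : Icc a b ↦
        (⟨γ x, mem_image_of_mem γ x.2⟩ : γ '' Icc a b))
      ?_ (isQuotientMap_projIcc (h := hab))
    refine h1.isClosedMap.isQuotientMap h1 ?_
    rintro ⟨_, x, hx, rfl⟩
    exact ⟨⟨x, hx⟩, rfl⟩
  exact hq.locallyPathConnectedSpace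

/-- Uniform local path-connectedness of Peano continua. -/
theorem exists_forall_joinedIn_ball {E : Type*} [MetricSpace E] {a b : ℝ} (hab : a ≤ b) {γ : ℝ → E}
    (hγ : ContinuousOn γ (Icc a b)) {ε : ℝ} (hε : 0 < ε) :
    ∃ η > 0, ∀ p ∈ γ '' Icc a b, ∀ q ∈ γ '' Icc a b, dist p q < η →
      JoinedIn (γ '' Icc a b ∩ ball p ε) p q := by
  have := locallyPathConnectedSpace_image_Icc hab hγ
  have : CompactSpace (γ '' Icc a b) :=
    isCompact_iff_compactSpace.mp (isCompact_Icc.image_of_continuousOn hγ)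
  obtain ⟨δ, hδ, h⟩ := lebesgue_number_lemma_of_metric (isCompact_univ (X := γ '' Icc a b))
    (c := fun x ↦ pathComponentIn (ball x (ε / 2)) x) (fun x ↦ isOpen_ball.pathComponentIn x)
    (fun x _ ↦ mem_iUnion.mpr ⟨x, mem_pathComponentIn_self (mem_ball_self (half_pos hε))⟩)
  refine ⟨δ, hδ, fun p hp q hq hpq ↦ ?_⟩
  obtain ⟨x, hx⟩ := h ⟨p, hp⟩ (mem_univ _)
  have h1 : JoinedIn (ball x (ε / 2)) x ⟨p, hp⟩ := hx (mem_ball_self hδ)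
  have h2 : JoinedIn (ball x (ε / 2)) x ⟨q, hq⟩ := hx (by
    rw [mem_ball, dist_comm]; exact hpq)
  have hxp := h1.target_mem
  obtain ⟨Γ, hΓ⟩ := h1.symm.trans h2
  refine ⟨Γ.map continuous_subtype_val, fun t ↦ ⟨Subtype.prop _, ?_⟩⟩
  have h3 := mem_ball.mp (hΓ t)
  rw [mem_ball_comm, mem_ball] at hxp
  have : dist (Γ t) ⟨p, hp⟩ < ε := (dist_triangle _ x _).trans_lt (by linarith)
  exact this

/-- A curve which converges at infinity closes up to a loop. -/
theorem exists_image_Icc_eq_insert {E : Type*} [TopologicalSpace E] [T3Space E] {c : ℝ → E}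
    (hc : Continuous c) {l : E} (hl : Tendsto c (cocompact ℝ) (𝓝 l)) :
    ∃ a b : ℝ, a ≤ b ∧ ∃ γ : ℝ → E, ContinuousOn γ (Icc a b) ∧ γ '' Icc a b = insert l
        (range c) := by
  have hab : -(Real.pi / 2) < Real.pi / 2 := by linarith [Real.pi_pos]
  rw [cocompact_eq_atBot_atTop, tendsto_sup] at hl
  set f : ℝ → E := fun s ↦ c (Real.tan s) with hf
  have hfc : ContinuousOn f (Ioo (-(Real.pi / 2)) (Real.pi / 2)) :=
    hc.comp_continuousOn Real.continuousOn_tan_Ioo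
  have h1 : Tendsto f (𝓝[>] (-(Real.pi / 2))) (𝓝 l) := hl.1.comp Real.tendsto_tan_neg_pi_div_two
  have h2 : Tendsto f (𝓝[<] (Real.pi / 2)) (𝓝 l) := hl.2.comp Real.tendsto_tan_pi_div_two
  have hfa : ∀ u, Real.arctan u ∈ Ioo (-(Real.pi / 2)) (Real.pi / 2) ∧ f (Real.arctan u) = c u :=
    fun u ↦ ⟨Real.arctan_mem_Ioo u, by simp only [hf, Real.tan_arctan]⟩
  have hfr : ∀ s, f s ∈ range c := fun s ↦ ⟨_, rfl⟩
  generalize -(Real.pi / 2) = a at *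
  generalize Real.pi / 2 = b at *
  have e1 := eq_lim_at_left_extendFrom_Ioo hab h1
  have e2 := eq_lim_at_right_extendFrom_Ioo hab h2
  have e3 : ∀ s ∈ Ioo a b, extendFrom (Ioo a b) f s = f s := fun s hs ↦ extendFrom_extends hfc s hs
  refine ⟨a, b, hab.le, extendFrom (Ioo a b) f, continuousOn_Icc_extendFrom_Ioo hfc h1 h2, ?_⟩
  ext z
  constructor
  · rintro ⟨s, hs, rfl⟩
    rcases eq_endpoints_or_mem_Ioo_of_mem_Icc hs with rfl | rfl | hs
    · exact Or.inl e1
    · exact Or.inl e2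
    · exact Or.inr (e3 s hs ▸ hfr s)
  · rintro (rfl | ⟨u, rfl⟩)
    · exact ⟨a, left_mem_Icc.mpr hab.le, e1⟩
    · exact ⟨Real.arctan u, Ioo_subset_Icc_self (hfa u).1, (e3 _ (hfa u).1).trans (hfa u).2⟩

/-- A simple loop stays connected when a point is removed. -/
theorem isPreconnected_insert_range_diff_singleton {E : Type*} [TopologicalSpace E] {c : ℝ → E}
    (hc : Continuous c) (hi : Function.Injective c) {l : E} (hl : Tendsto c (cocompact ℝ) (𝓝 l))
    (hne : ∀ u, c u ≠ l) {p : E} (hp : p ∈ insert l (range c)) :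
    IsPreconnected (insert l (range c) \ {p}) := by
  rw [cocompact_eq_atBot_atTop, tendsto_sup] at hl
  obtain rfl | ⟨u, rfl⟩ := hp
  · rw [insert_sdiff_of_mem _ (mem_singleton p), sdiff_singleton_eq_self]
    · exact isPreconnected_range hc
    · rintro ⟨u, hu⟩; exact hne u hu
  · have h1 : IsPreconnected (insert l (c '' Iio u)) :=
      (isPreconnected_Iio.image c hc.continuousOn).subset_closure (subset_insert _ _)
        (insert_subset (mem_closure_of_tendsto hl.1
          ((eventually_lt_atBot u).mono fun x hx ↦ mem_image_of_mem c hx)) subset_closure)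
    have h2 : IsPreconnected (insert l (c '' Ioi u)) :=
      (isPreconnected_Ioi.image c hc.continuousOn).subset_closure (subset_insert _ _)
        (insert_subset (mem_closure_of_tendsto hl.2
          ((eventually_gt_atTop u).mono fun x hx ↦ mem_image_of_mem c hx)) subset_closure)
    have h3 : insert l (range c) \ {c u} = insert l (c '' Iio u) ∪ insert l (c '' Ioi u) := by
      ext z
      constructor
      · rintro ⟨rfl | ⟨v, rfl⟩, hz⟩
        · exact Or.inl (Or.inl rfl)
        · rcases lt_trichotomy v u with h | rfl | h
          · exact Or.inl (Or.inr ⟨v, h, rfl⟩)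
          · exact absurd rfl hz
          · exact Or.inr (Or.inr ⟨v, h, rfl⟩)
      · rintro ((rfl | ⟨v, hv, rfl⟩) | (rfl | ⟨v, hv, rfl⟩))
        · exact ⟨Or.inl rfl, fun h ↦ hne u h.symm⟩
        · exact ⟨Or.inr ⟨v, rfl⟩, fun h ↦ (ne_of_lt hv) (hi h)⟩
        · exact ⟨Or.inl rfl, fun h ↦ hne u h.symm⟩
        · exact ⟨Or.inr ⟨v, rfl⟩, fun h ↦ (ne_of_gt hv) (hi h)⟩
    rw [h3]
    exact h1.union l (mem_insert _ _) (mem_insert _ _) h2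

/-- A proper map of the line to the plane which folds the line at the origin and is otherwise
injective. -/
structure IsFoldedRay (B : ℝ → ℂ) : Prop where
  cont : Continuous B
  eq_iff : ∀ u v, B u = B v ↔ |u| = |v|
  zero : B 0 = 0
  tendsto : Tendsto B (cocompact ℝ) (Bornology.cobounded ℂ)

theorem IsFoldedRay.isClosed_range {B : ℝ → ℂ} (hB : IsFoldedRay B) : IsClosed (range B) := by
  have : IsProperMap B := isProperMap_iff_tendsto_cocompact.mpr
    ⟨hB.cont, Metric.cobounded_eq_cocompact (α := ℂ) ▸ hB.tendsto⟩
  exact this.isClosedMap.isClosed_range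

theorem IsFoldedRay.not_isBounded_range {B : ℝ → ℂ} (hB : IsFoldedRay B) :
    ¬ Bornology.IsBounded (range B) := by
  intro h
  obtain ⟨u, hu⟩ := (hB.tendsto.eventually (Bornology.isBounded_def.mp h)).exists
  exact hu ⟨u, rfl⟩

/-- The square root of a folded ray is a properly embedded line. -/
theorem IsFoldedRay.exists_sqrt {B : ℝ → ℂ} (hB : IsFoldedRay B) :
    ∃ c : ℝ → ℂ, (∀ u, c u ^ 2 = B u) ∧ (∀ u, c (-u) = -c u) ∧ IsClosedEmbedding c ∧
      Tendsto c (cocompact ℝ) (Bornology.cobounded ℂ) := by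
  have hsc : IsSimplyConnected (Ioi (0 : ℝ)) := by
    have : ContractibleSpace (Ioi (0 : ℝ)) := (convex_Ioi 0).contractibleSpace
        ⟨1, mem_Ioi.mpr one_pos⟩
    exact inferInstanceAs (SimplyConnectedSpace (Ioi (0 : ℝ)))
  have h0 : ∀ u, B u = 0 ↔ u = 0 := fun u ↦ by
    rw [← hB.zero, hB.eq_iff, abs_zero, abs_eq_zero]
  obtain ⟨ρ, hρ, hρ2⟩ := Complex.exists_continuousOn_pow_eq hsc isOpen_Ioi hB.cont.continuousOn
    (by rintro ⟨u, hu, h⟩; exact (ne_of_gt hu) ((h0 u).mp h)) two_ne_zero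
  have hρ0 : ρ 0 = 0 := by
    have := hρ2 0
    rw [hB.zero] at this
    simpa using this
  set c : ℝ → ℂ := fun u ↦ if 0 ≤ u then ρ u else -ρ (-u) with hc
  have hodd : ∀ u, c (-u) = -c u := fun u ↦ by
    simp only [hc]
    rcases lt_trichotomy u 0 with h | rfl | h
    · rw [if_pos (by linarith), if_neg (by linarith), neg_neg]
    · simp [hρ0]
    · rw [if_neg (by linarith), if_pos h.le, neg_neg]
  have hsq : ∀ u, c u ^ 2 = B u := fun u ↦ by
    simp only [hc]
    split_ifs
    · exact hρ2 u
    · rw [neg_sq, hρ2, hB.eq_iff, abs_neg]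
  have hpos : ∀ u, 0 < u → ContinuousAt c u := fun u hu ↦ by
    refine (hρ.continuousAt (Ioi_mem_nhds hu)).congr ?_
    filter_upwards [Ioi_mem_nhds hu] with v hv
    simp only [hc]
    rw [if_pos (le_of_lt hv)]
  have hnorm : ∀ u, ‖c u‖ = √‖B u‖ := fun u ↦ by
    rw [← hsq, norm_pow, Real.sqrt_sq (norm_nonneg _)]
  have hcont : Continuous c := by
    rw [continuous_iff_continuousAt]
    intro u
    rcases lt_trichotomy u 0 with h | rfl | h
    · have h1 : ContinuousAt c (-u) := hpos (-u) (by linarith)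
      have h2 : ContinuousAt (fun u ↦ -c (-u)) u :=
        (ContinuousAt.comp (g := c) (f := fun u : ℝ ↦ -u) h1 continuousAt_neg).neg
      refine h2.congr (Eventually.of_forall fun v ↦ ?_)
      show -c (-v) = c v
      rw [hodd, neg_neg]
    · have h1 : c 0 = 0 := by simp [hc, hρ0]
      rw [ContinuousAt, h1, tendsto_zero_iff_norm_tendsto_zero]
      simp only [hnorm]
      have h2 : Continuous fun u ↦ √‖B u‖ := hB.cont.norm.sqrt
      simpa [hB.zero] using h2.tendsto 0
    · exact hpos u h
  have htend : Tendsto c (cocompact ℝ) (Bornology.cobounded ℂ) := by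
    rw [← tendsto_norm_atTop_iff_cobounded]
    simp only [hnorm]
    exact Real.tendsto_sqrt_atTop.comp (tendsto_norm_atTop_iff_cobounded.mpr hB.tendsto)
  refine ⟨c, hsq, hodd, ?_, htend⟩
  refine IsClosedEmbedding.of_continuous_injective_isClosedMap hcont (fun u v huv ↦ ?_)
    (isProperMap_iff_tendsto_cocompact.mpr
      ⟨hcont, Metric.cobounded_eq_cocompact (α := ℂ) ▸ htend⟩).isClosedMap
  have h1 : |u| = |v| := by rw [← hB.eq_iff, ← hsq, ← hsq, huv]
  rcases abs_eq_abs.mp h1 with h | rfl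
  · exact h
  · rw [hodd] at huv
    have h2 : c v = 0 := by
      have : (2 : ℂ) * c v = 0 := by linear_combination -huv
      simpa using this
    have h3 : v = 0 := (h0 v).mp (by rw [← hsq, h2]; simp)
    rw [h3, neg_zero]

/-- A square root on a set takes no two opposite values. -/
theorem eq_of_sq_eq_sq {U : Set ℂ} {s : ℂ → ℂ} (hs : ∀ z ∈ U, s z ^ 2 = z) {z w : ℂ} (hz : z ∈ U)
    (hw : w ∈ U) (h : s z ^ 2 = s w ^ 2) : z = w := by
  rw [← hs z hz, h, hs w hw]

/-- A uniformization of one of the two sides of the square root of a folded ray, after an inversion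
which makes the image bounded. -/
theorem IsFoldedRay.exists_isUniformization {B : ℝ → ℂ} (hB : IsFoldedRay B) (h1 : 1 ∉ range B)
    (hU : IsPreconnected (range B)ᶜ) {c : ℝ → ℂ} (hc2 : ∀ u, c u ^ 2 = B u)
    (hodd : ∀ u, c (-u) = -c u) (hce : IsClosedEmbedding c)
    (hct : Tendsto c (cocompact ℝ) (Bornology.cobounded ℂ)) :
    ∃ (s Ψ : ℂ → ℂ) (e : ℂ), (∀ z ∈ (range B)ᶜ, s z ^ 2 = z) ∧ (∀ u, c u + e ≠ 0) ∧
      IsUniformization Ψ (insert 0 (range fun u ↦ (c u + e)⁻¹)) ∧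
      (∀ p ∈ insert 0 (range fun u ↦ (c u + e)⁻¹),
        IsPreconnected (insert 0 (range fun u ↦ (c u + e)⁻¹) \ {p})) ∧
      Ψ '' {z | 0 < z.im} = (fun z ↦ (s z + e)⁻¹) '' (range B)ᶜ ∧
      ∀ z ∈ (range B)ᶜ, s z + e ≠ 0 := by
  set U := (range B)ᶜ with hUdef
  have hUo : IsOpen U := hB.isClosed_range.isOpen_compl
  have hsqrt : ∀ g : ℂ → ℂ, DifferentiableOn ℂ g U → (∀ z ∈ U, g z ≠ 0) →
      ∃ s : ℂ → ℂ, DifferentiableOn ℂ s U ∧ ∀ z ∈ U, s z ^ 2 = g z := fun g hg hg0 ↦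
    exists_sqrt_compl (isPreconnected_range hB.cont) hB.isClosed_range hB.not_isBounded_range hU
        hg hg0
  have hU0 : ∀ z ∈ U, z ≠ 0 := by rintro z hz rfl; exact hz ⟨0, hB.zero⟩
  obtain ⟨s, hs, hs2⟩ := hsqrt id differentiableOn_id hU0
  simp only [id] at hs2
  have hsi : InjOn s U := fun z hz w hw h ↦ eq_of_sq_eq_sq hs2 hz hw (by rw [h])
  have h1U : (1 : ℂ) ∈ U := h1
  set e := s 1 with he
  have he2 : e ^ 2 = 1 := hs2 1 h1U
  have hopp : ∀ z ∈ U, ∀ w ∈ U, s z ≠ -s w := fun z hz w hw h ↦ by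
    have hzw := eq_of_sq_eq_sq hs2 hz hw (by rw [h, neg_sq])
    rw [hzw] at h
    have h2 : s w = 0 := by
      have : (2 : ℂ) * s w = 0 := by linear_combination h
      simpa using this
    exact hU0 w hw (by rw [← hs2 w hw, h2]; simp)
  have hse : ∀ z ∈ U, s z + e ≠ 0 := fun z hz h ↦ hopp z hz 1 h1U (eq_neg_of_add_eq_zero_left h)
  have hcU : ∀ u, ∀ z ∈ U, c u ^ 2 ≠ z := fun u z hz h ↦ hz ⟨u, by rw [← hc2, h]⟩
  have hce0 : ∀ u, c u + e ≠ 0 := fun u h ↦ hcU u 1 h1U (by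
    rw [eq_neg_of_add_eq_zero_left h, neg_sq, he2])
  have hWo : ∀ z ∈ U, ∀ᶠ w in 𝓝 (s z), w ∈ s '' U := fun z hz ↦
    image_mem_nhds_of_injOn hUo hs hsi hz (hUo.mem_nhds hz)
  have hWn : ∀ z ∈ U, ∀ᶠ w in 𝓝 (-s z), w ∉ s '' U := fun z hz ↦ by
    have h2 : Tendsto (fun w : ℂ ↦ -w) (𝓝 (-s z)) (𝓝 (s z)) := by
      simpa using (continuous_neg (G := ℂ)).tendsto (-s z)
    filter_upwards [h2.eventually (hWo z hz)] with w hw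
    rintro ⟨y, hy, rfl⟩
    obtain ⟨x, hx, hxy⟩ := hw
    exact hopp x hx y hy hxy
  obtain ⟨r, hr, hre⟩ : ∃ r > 0, ∀ z ∈ U, r ≤ ‖s z + e‖ := by
    obtain ⟨r, hr, h⟩ := Metric.eventually_nhds_iff.mp (hWn 1 h1U)
    refine ⟨r, hr, fun z hz ↦ not_lt.mp fun hlt ↦ ?_⟩
    exact h (y := s z) (by rwa [dist_eq_norm, sub_neg_eq_add]) ⟨z, hz, rfl⟩
  obtain ⟨f, hf⟩ : ∃ f : ℂ → ℂ, DifferentiableOn ℂ f U ∧ InjOn f U ∧ MapsTo f U (ball 0 1) := by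
    refine ⟨fun z ↦ (r / 2 : ℝ) / (s z + e), ?_, fun z hz w hw h ↦ ?_, fun z hz ↦ ?_⟩
    · exact (differentiableOn_const _).fun_div (hs.add_const e) hse
    · have hr' : ((r / 2 : ℝ) : ℂ) ≠ 0 := by exact_mod_cast (half_pos hr).ne'
      refine hsi hz hw ?_
      simp only [] at h
      rw [div_eq_div_iff (hse z hz) (hse w hw)] at h
      linear_combination -(mul_left_cancel₀ hr' h)
    · rw [mem_ball_zero_iff, norm_div, Complex.norm_real, Real.norm_of_nonneg (half_pos hr).le,
        div_lt_one (norm_pos_iff.mpr (hse z hz))]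
      linarith [hre z hz]
  obtain ⟨ψ, hψd, hψi, hψU⟩ := exists_riemann_map hUo hU ⟨1, h1U⟩ hsqrt ⟨f, hf⟩
  have hψm : MapsTo ψ {z | 0 < z.im} U := fun z hz ↦ hψU ▸ mem_image_of_mem ψ hz
  have himg : (fun z ↦ (s (ψ z) + e)⁻¹) '' {z | 0 < z.im} = (fun z ↦ (s z + e)⁻¹) '' U := by
    rw [← hψU, image_image]
  have hcc : Continuous fun u ↦ (c u + e)⁻¹ := (hce.continuous.add_const e).inv₀ hce0
  have hci : Function.Injective fun u ↦ (c u + e)⁻¹ := fun u v h ↦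
    hce.injective (add_right_cancel (inv_injective h))
  have hcl : Tendsto (fun u ↦ (c u + e)⁻¹) (cocompact ℝ) (𝓝 0) :=
    tendsto_inv₀_cobounded.comp ((tendsto_add_const_cobounded e).comp hct)
  have hcn : ∀ u, (c u + e)⁻¹ ≠ 0 := fun u ↦ inv_ne_zero (hce0 u)
  refine ⟨s, fun z ↦ (s (ψ z) + e)⁻¹, e, hs2, hce0, ⟨?_, ?_, ?_, ?_, ?_, ?_⟩, fun p hp ↦
    isPreconnected_insert_range_diff_singleton hcc hci hcl hcn hp, himg, hse⟩
  · exact ((hs.comp hψd hψm).add_const e).fun_inv fun z hz ↦ hse _ (hψm hz)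
  · exact fun z hz w hw h ↦ hψi hz hw (hsi (hψm hz) (hψm hw) (add_right_cancel (inv_injective h)))
  · rw [himg]
    refine isBounded_closedBall (x := (0 : ℂ)) (r := r⁻¹) |>.subset ?_
    rintro _ ⟨z, hz, rfl⟩
    rw [mem_closedBall_zero_iff, norm_inv]
    exact inv_anti₀ hr (hre z hz)
  · rw [himg]
    intro y hy
    by_contra hyX
    rw [mem_insert_iff, not_or] at hyX
    obtain ⟨hy0, hyc⟩ := hyX
    have hv : y⁻¹ - e ∈ closure (s '' U) := by
      have hcw : ContinuousWithinAt (fun y : ℂ ↦ y⁻¹ - e) ((fun z ↦ (s z + e)⁻¹) '' U) y :=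
        ((continuousAt_inv₀ hy0).sub continuousAt_const).continuousWithinAt
      refine closure_mono ?_ (hcw.mem_closure_image (frontier_subset_closure hy))
      rintro _ ⟨_, ⟨z, hz, rfl⟩, rfl⟩
      exact ⟨z, hz, by simp⟩
    have hvc : ∀ u, y⁻¹ - e ≠ c u := fun u hu ↦ hyc ⟨u, by
      show (c u + e)⁻¹ = y
      rw [← hu]; simp⟩
    have hvU : (y⁻¹ - e) ^ 2 ∈ U := by
      rintro ⟨u, hu⟩
      rw [← hc2, sq_eq_sq_iff_eq_or_eq_neg] at hu
      rcases hu with hu | hu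
      · exact hvc u hu.symm
      · exact hvc (-u) (by rw [hodd, hu, neg_neg])
    have h2 := hs2 _ hvU
    rw [sq_eq_sq_iff_eq_or_eq_neg] at h2
    rcases h2 with h2 | h2
    · have h3 : y ∈ interior ((fun z ↦ (s z + e)⁻¹) '' U) := by
        rw [mem_interior_iff_mem_nhds]
        have h4 : Tendsto (fun y : ℂ ↦ y⁻¹ - e) (𝓝 y) (𝓝 (y⁻¹ - e)) :=
          (continuousAt_inv₀ hy0).sub continuousAt_const
        rw [← h2] at h4
        refine Filter.mem_of_superset (h4.eventually (hWo _ hvU)) fun w ⟨z, hz, hzw⟩ ↦ ⟨z, hz, ?_⟩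
        show (s z + e)⁻¹ = w
        rw [hzw]; simp
      exact hy.2 h3
    · have h3 := hWn _ hvU
      rw [h2, neg_neg] at h3
      obtain ⟨w, hw1, hw2⟩ := mem_closure_iff_nhds.mp hv _ h3
      exact hw1 hw2
  · rw [himg]
    rintro p (rfl | ⟨u, rfl⟩) ⟨z, hz, h⟩
    · exact inv_ne_zero (hse z hz) h
    · have h2 : s z = c u := add_right_cancel (inv_injective h)
      exact hcU u z hz (by rw [← h2, hs2 z hz])
  · intro ε hε
    obtain ⟨a, b, hab, γ, hγ, hγX⟩ := exists_image_Icc_eq_insert hcc hcl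
    rw [← hγX]
    exact exists_forall_joinedIn_ball hab hγ hε

/-- A continuous injective function on the line cannot have the same limit at both ends. -/
theorem not_tendsto_cocompact_nhds_of_injective {κ : ℝ → ℝ} (hc : Continuous κ)
    (hi : Function.Injective κ) (k : ℝ) : ¬ Tendsto κ (cocompact ℝ) (𝓝 k) := by
  intro h
  rw [cocompact_eq_atBot_atTop, tendsto_sup] at h
  rcases hc.strictMono_of_inj hi with hm | hm
  · exact (hm zero_lt_one).not_ge
      ((hm.monotone.ge_of_tendsto h.2 1).trans (hm.monotone.le_of_tendsto h.1 0))
  · exact (hm zero_lt_one).not_ge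
      ((hm.antitone.ge_of_tendsto h.1 0).trans (hm.antitone.le_of_tendsto h.2 1))

theorem exists_homeomorph_eq {κ : ℝ → ℝ} (hc : Continuous κ) (hi : Function.Injective κ)
    (ht : Tendsto κ (cocompact ℝ) (cocompact ℝ)) : ∃ h : ℝ ≃ₜ ℝ, ∀ x, h x = κ x := by
  have hcl : IsClosedMap κ := (isProperMap_iff_tendsto_cocompact.mpr ⟨hc, ht⟩).isClosedMap
  have htt : Tendsto (fun x ↦ |κ x|) (cocompact ℝ) atTop := tendsto_norm_cocompact_atTop.comp ht
  rw [cocompact_eq_atBot_atTop, tendsto_sup] at htt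
  have hs : Function.Surjective κ := by
    intro y
    obtain ⟨a, ha0, ha1, ha2⟩ := ((eventually_lt_atBot 0).and ((htt.1.eventually_gt_atTop |y|).and
      (htt.1.eventually_gt_atTop |κ 0|))).exists
    obtain ⟨b, hb0, hb1, hb2⟩ := ((eventually_gt_atTop 0).and ((htt.2.eventually_gt_atTop |y|).and
      (htt.2.eventually_gt_atTop |κ 0|))).exists
    have hy := neg_abs_le y
    have hy' := le_abs_self y
    have h0 := neg_abs_le (κ 0)
    have h0' := le_abs_self (κ 0)
    have key : (κ a ≤ y ∧ y ≤ κ b) ∨ (κ b ≤ y ∧ y ≤ κ a) := by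
      rcases hc.strictMono_of_inj hi with hm | hm
      · have h1 := hm ha0
        have h2 := hm hb0
        rcases abs_cases (κ a) with h | h <;> rcases abs_cases (κ b) with h' | h' <;>
          [skip; skip; left; skip] <;> constructor <;> linarith
      · have h1 := hm ha0
        have h2 := hm hb0
        rcases abs_cases (κ a) with h | h <;> rcases abs_cases (κ b) with h' | h' <;>
          [skip; right; skip; skip] <;> constructor <;> linarith
    rcases key with ⟨h1, h2⟩ | ⟨h1, h2⟩
    · exact mem_range_of_exists_le_of_exists_ge hc ⟨a, h1⟩ ⟨b, h2⟩
    · exact mem_range_of_exists_le_of_exists_ge hc ⟨b, h1⟩ ⟨a, h2⟩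
  exact ⟨(IsClosedEmbedding.of_continuous_injective_isClosedMap hc hi
    hcl).isEmbedding.toHomeomorphOfSurjective hs, fun x ↦ rfl⟩

theorem tendsto_ofReal_cocompact :
    Tendsto (fun x : ℝ ↦ (x : ℂ)) (cocompact ℝ) (Bornology.cobounded ℂ ⊓ 𝓟 {z | 0 ≤ z.im}) := by
  refine tendsto_inf.mpr ⟨?_, tendsto_principal.mpr (Eventually.of_forall fun x ↦ by simp)⟩
  rw [← tendsto_norm_atTop_iff_cobounded]
  exact (tendsto_norm_cocompact_atTop (E := ℝ)).congr fun x ↦ (Complex.norm_real x).symm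

/-- A continuous function with values in a properly embedded line lifts to the line. -/
theorem exists_lift_of_isClosedEmbedding {c : ℝ → ℂ} (hc : IsClosedEmbedding c) :
    ∃ k : ℂ → ℝ, (∀ u, k (c u) = u) ∧ ContinuousOn k (range c) := by
  refine ⟨Function.invFun c, fun u ↦ Function.leftInverse_invFun hc.injective u, ?_⟩
  rw [continuousOn_iff_continuous_domRestrict]
  have : (range c).domRestrict (Function.invFun c) = hc.isEmbedding.toHomeomorph.symm := by
    ext ⟨_, u, rfl⟩
    rw [domRestrict_apply, Function.leftInverse_invFun hc.injective u]
    exact ((hc.isEmbedding.toHomeomorph.symm_apply_apply u).symm)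
  rw [this]
  exact Homeomorph.continuous _

/-- The uniformization can be normalized so that infinity goes to infinity. -/
theorem IsUniformization.exists_boundary_map_of_line {Ψ : ℂ → ℂ} {c : ℝ → ℂ} {e : ℂ}
    (hc : IsClosedEmbedding c)
    (h : IsUniformization Ψ (insert 0 (range fun u ↦ (c u + e)⁻¹)))
    (hX : ∀ p ∈ insert 0 (range fun u ↦ (c u + e)⁻¹),
      IsPreconnected (insert 0 (range fun u ↦ (c u + e)⁻¹) \ {p})) :
    ∃ φ : ℂ → ℂ, ContinuousOn φ {z | 0 ≤ z.im} ∧ InjOn φ {z | 0 < z.im} ∧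
      φ '' {z | 0 < z.im} = Ψ '' {z | 0 < z.im} ∧
      (∀ x : ℝ, φ x ∈ range fun u ↦ (c u + e)⁻¹) ∧ (Function.Injective fun x : ℝ ↦ φ x) ∧
      Tendsto φ (Bornology.cobounded ℂ ⊓ 𝓟 {z | 0 ≤ z.im}) (𝓝 0) := by
  have hlimit : ∀ Ψ' : ℂ → ℂ, IsUniformization Ψ' (insert 0 (range fun u ↦ (c u + e)⁻¹)) →
      Ψ' '' {z | 0 < z.im} = Ψ '' {z | 0 < z.im} → ∀ φ : ℂ → ℂ, ContinuousOn φ {z | 0 ≤ z.im} →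
      EqOn φ Ψ' {z | 0 < z.im} → (∀ x : ℝ, φ x ∈ insert 0 (range fun u ↦ (c u + e)⁻¹)) →
      (Function.Injective fun x : ℝ ↦ φ x) →
      Tendsto φ (Bornology.cobounded ℂ ⊓ 𝓟 {z | 0 ≤ z.im}) (𝓝 0) → (∀ x : ℝ, φ x ≠ 0) →
      ∃ φ : ℂ → ℂ, ContinuousOn φ {z | 0 ≤ z.im} ∧ InjOn φ {z | 0 < z.im} ∧
        φ '' {z | 0 < z.im} = Ψ '' {z | 0 < z.im} ∧
        (∀ x : ℝ, φ x ∈ range fun u ↦ (c u + e)⁻¹) ∧ (Function.Injective fun x : ℝ ↦ φ x) ∧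
        Tendsto φ (Bornology.cobounded ℂ ⊓ 𝓟 {z | 0 ≤ z.im}) (𝓝 0) :=
    fun Ψ' h' himg φ hφ heq hφX hinj hlim hne ↦ ⟨φ, hφ, h'.inj.congr heq.symm,
      heq.image_eq.trans himg, fun x ↦ (hφX x).resolve_left (hne x), hinj, hlim⟩
  obtain ⟨φ, hφ, heq, hφX, hinj, L, hL, hlim, hne⟩ := h.exists_boundary_map hX
  by_cases hL0 : L = 0
  · subst hL0
    exact hlimit Ψ h rfl φ hφ heq hφX hinj hlim hne
  obtain ⟨x₀, hx₀⟩ : ∃ x₀ : ℝ, φ x₀ = 0 := by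
    by_contra! hno
    obtain ⟨k, hk, hkc⟩ := exists_lift_of_isClosedEmbedding hc
    have hg : ∀ w ∈ insert 0 (range fun u ↦ (c u + e)⁻¹), w ≠ 0 → w⁻¹ - e ∈ range c := by
      rintro w (rfl | ⟨u, rfl⟩) h0
      · exact absurd rfl h0
      · exact ⟨u, by simp⟩
    have hgx : ∀ x : ℝ, (φ x)⁻¹ - e ∈ range c := fun x ↦ hg _ (hφX x) (hno x)
    have hφr : Continuous fun x : ℝ ↦ φ x :=
      hφ.comp_continuous Complex.continuous_ofReal fun x ↦ by simp
    have hgc : Continuous fun x : ℝ ↦ (φ x)⁻¹ - e := (hφr.inv₀ hno).sub continuous_const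
    refine not_tendsto_cocompact_nhds_of_injective (κ := fun x : ℝ ↦ k ((φ x)⁻¹ - e))
      (hkc.comp_continuous hgc hgx) (fun x y hxy ↦ hinj ?_) (k (L⁻¹ - e)) ?_
    · obtain ⟨u, hu⟩ := hgx x
      obtain ⟨v, hv⟩ := hgx y
      simp only [← hu, ← hv, hk] at hxy
      rw [hxy, hv] at hu
      exact (inv_injective (sub_left_injective hu)).symm
    · refine (hkc _ (hg L hL hL0)).tendsto.comp (tendsto_nhdsWithin_iff.mpr
        ⟨?_, Eventually.of_forall hgx⟩)
      exact ((hlim.comp tendsto_ofReal_cocompact).inv₀ hL0).sub_const e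
  obtain ⟨φ', hφ', heq', hφX', hinj', L', hL', hlim', hne'⟩ :=
      (h.comp_inv x₀).exists_boundary_map hX
  have hL'0 : L' = 0 := by
    have t1 : Tendsto (fun y : ℝ ↦ (y : ℂ) * Complex.I) atTop
        (Bornology.cobounded ℂ ⊓ 𝓟 {z | 0 ≤ z.im}) := by
      refine tendsto_inf.mpr ⟨?_, tendsto_principal.mpr ?_⟩
      · rw [← tendsto_norm_atTop_iff_cobounded]
        simpa using tendsto_abs_atTop_atTop (G := ℝ)
      · filter_upwards [eventually_ge_atTop 0] with y hy
        simpa using hy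
    have t2 : Tendsto (fun y : ℝ ↦ (x₀ : ℂ) - ((y : ℂ) * Complex.I)⁻¹) atTop
        (𝓝[{z | 0 ≤ z.im}] (x₀ : ℂ)) := by
      refine tendsto_nhdsWithin_iff.mpr ⟨?_, ?_⟩
      · simpa using (tendsto_inv₀_cobounded.comp (tendsto_inf.mp t1).1).const_sub (x₀ : ℂ)
      · filter_upwards [eventually_gt_atTop 0] with y hy
        exact (IsUniformization.im_sub_inv_pos x₀ (by simpa using hy)).le
    have t3 := (hφ x₀ (by simp)).tendsto.comp t2
    rw [hx₀] at t3
    refine tendsto_nhds_unique (hlim'.comp t1) (t3.congr' ?_)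
    filter_upwards [eventually_gt_atTop 0] with y hy
    have hy' : 0 < ((y : ℂ) * Complex.I).im := by simpa using hy
    show φ _ = φ' _
    rw [heq' hy', heq (IsUniformization.im_sub_inv_pos x₀ hy')]
  subst hL'0
  exact hlimit _ (h.comp_inv x₀) (IsUniformization.image_comp_inv Ψ x₀) φ' hφ' heq' hφX' hinj'
    hlim' hne'

/-- A homeomorphism of the line extends to a homeomorphism of the upper half plane with a prescribed
value at `I`. -/
theorem exists_homeomorph_halfPlane (h : ℝ ≃ₜ ℝ) {z₀ : ℂ} (hz₀ : 0 < z₀.im) :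
    ∃ J : ℂ ≃ₜ ℂ, (∀ u : ℝ, J u = h u) ∧ J Complex.I = z₀ ∧ ∀ z, (J z).im = z.im * z₀.im := by
  have hy := hz₀.ne'
  let J : ℂ ≃ₜ ℂ :=
    { toFun := fun z ↦ ⟨h (z.re + h.symm z₀.re * min z.im 1), z.im * z₀.im⟩
      invFun := fun z ↦ ⟨h.symm z.re - h.symm z₀.re * min (z.im / z₀.im) 1, z.im / z₀.im⟩
      left_inv := fun z ↦ by
        apply Complex.ext
        · simp [hy]
        · simp [hy]
      right_inv := fun z ↦ by
        apply Complex.ext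
        · simp
        · simp [hy]
      continuous_toFun := by
        simp only [Complex.mk_eq_add_mul_I]
        have := h.continuous
        fun_prop
      continuous_invFun := by
        simp only [Complex.mk_eq_add_mul_I]
        have := h.symm.continuous
        fun_prop }
  refine ⟨J, fun u ↦ ?_, ?_, fun z ↦ rfl⟩
  · apply Complex.ext <;> simp [J]
  · apply Complex.ext <;> simp [J]

theorem tendsto_cocompact_of_isClosedEmbedding {c : ℝ → ℂ} (hc : Continuous c) {κ : ℝ → ℝ}
    (h : Tendsto (fun x ↦ c (κ x)) (cocompact ℝ) (Bornology.cobounded ℂ)) :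
    Tendsto κ (cocompact ℝ) (cocompact ℝ) := by
  refine (hasBasis_cocompact.tendsto_right_iff).mpr fun K hK ↦ ?_
  filter_upwards [h.eventually (Bornology.isBounded_def.mp (hK.image hc).isBounded)] with x hx hxK
  exact hx ⟨_, hxK, rfl⟩

/-- The closed upper half plane maps onto the plane slit along a folded ray, the boundary line being
folded onto the ray. -/
theorem IsFoldedRay.exists_parametrization {B : ℝ → ℂ} (hB : IsFoldedRay B) (h1 : 1 ∉ range B)
    (hU : IsPreconnected (range B)ᶜ) :
    ∃ P : ℂ → ℂ, ContinuousOn P {z | 0 ≤ z.im} ∧ InjOn P {z | 0 < z.im} ∧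
      P '' {z | 0 < z.im} = (range B)ᶜ ∧ (∀ u : ℝ, P u = B u) ∧ P Complex.I = 1 ∧
      Tendsto P (Bornology.cobounded ℂ ⊓ 𝓟 {z | 0 ≤ z.im}) (Bornology.cobounded ℂ) := by
  obtain ⟨c, hc2, hodd, hce, hct⟩ := hB.exists_sqrt
  obtain ⟨s, Ψ, e, hs2, hce0, hΨ, hX, himg, hse⟩ :=
    hB.exists_isUniformization h1 hU hc2 hodd hce hct
  obtain ⟨φ, hφ, hφi, hφΨ, hφX, hφr, hφl⟩ := hΨ.exists_boundary_map_of_line hce hX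
  rw [himg] at hφΨ
  have hφU : ∀ z : ℂ, 0 < z.im → ∃ w ∈ (range B)ᶜ, φ z = (s w + e)⁻¹ := fun z hz ↦ by
    obtain ⟨w, hw, h⟩ := hφΨ.subset (mem_image_of_mem φ hz)
    exact ⟨w, hw, h.symm⟩
  have hreal : ∀ z : ℂ, z.im = 0 → z = (z.re : ℝ) := fun z hz ↦ Complex.ext rfl (by simp [hz])
  have hφ0 : ∀ z : ℂ, 0 ≤ z.im → φ z ≠ 0 := fun z hz ↦ by
    rcases hz.lt_or_eq with hz | hz
    · obtain ⟨w, hw, h⟩ := hφU z hz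
      exact h ▸ inv_ne_zero (hse w hw)
    · rw [hreal z hz.symm]
      obtain ⟨u, hu⟩ := hφX z.re
      exact hu ▸ inv_ne_zero (hce0 u)
  set G : ℂ → ℂ := fun z ↦ (φ z)⁻¹ - e with hG
  have hGc : ContinuousOn G {z | 0 ≤ z.im} := (hφ.inv₀ hφ0).sub continuousOn_const
  have hGU : ∀ z : ℂ, 0 < z.im → ∃ w ∈ (range B)ᶜ, G z = s w := fun z hz ↦ by
    obtain ⟨w, hw, h⟩ := hφU z hz
    exact ⟨w, hw, by simp [hG, h]⟩
  have hGl : Tendsto G (Bornology.cobounded ℂ ⊓ 𝓟 {z | 0 ≤ z.im}) (Bornology.cobounded ℂ) := by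
    have h2 : Tendsto φ (Bornology.cobounded ℂ ⊓ 𝓟 {z | 0 ≤ z.im}) (𝓝[≠] 0) :=
      tendsto_nhdsWithin_iff.mpr ⟨hφl, eventually_inf_principal.mpr (Eventually.of_forall hφ0)⟩
    exact (tendsto_sub_const_cobounded e).comp (tendsto_inv₀_nhdsNE_zero.comp h2)
  obtain ⟨k, hk, hkc⟩ := exists_lift_of_isClosedEmbedding hce
  have hGr : ∀ x : ℝ, G x ∈ range c := fun x ↦ by
    obtain ⟨u, hu⟩ := hφX x
    exact ⟨u, by simp [hG, ← hu]⟩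
  have hGk : ∀ x : ℝ, c (k (G x)) = G x := fun x ↦ by
    obtain ⟨u, hu⟩ := hGr x
    rw [← hu, hk]
  obtain ⟨κ, hκ⟩ := exists_homeomorph_eq (κ := fun x : ℝ ↦ k (G x))
    (hkc.comp_continuous (hGc.comp_continuous Complex.continuous_ofReal fun x ↦ by simp) hGr)
    (fun x y hxy ↦ hφr (by
      have h2 : G x = G y := (hGk x).symm.trans ((congrArg c hxy).trans (hGk y))
      exact inv_injective (sub_left_injective h2)))
    (tendsto_cocompact_of_isClosedEmbedding hce.continuous (by
      simp only [hGk]; exact hGl.comp tendsto_ofReal_cocompact))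
  obtain ⟨z₀, hz₀, hz₀e⟩ : ∃ z₀ : ℂ, 0 < z₀.im ∧ G z₀ = s 1 := by
    obtain ⟨z, hz, h⟩ := hφΨ.superset (mem_image_of_mem _ h1)
    exact ⟨z, hz, by simp [hG, h]⟩
  obtain ⟨J, hJ1, hJ2, hJ3⟩ := exists_homeomorph_halfPlane κ.symm hz₀
  have hJp : ∀ z : ℂ, 0 < z.im → 0 < (J z).im := fun z hz ↦ hJ3 z ▸ mul_pos hz hz₀
  have hJn : ∀ z : ℂ, 0 ≤ z.im → 0 ≤ (J z).im := fun z hz ↦ hJ3 z ▸ mul_nonneg hz hz₀.le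
  refine ⟨fun z ↦ G (J z) ^ 2, (hGc.comp J.continuous.continuousOn hJn).pow 2,
    fun z hz w hw h ↦ ?_, ?_, fun u ↦ ?_, ?_, ?_⟩
  · obtain ⟨x, hx, hxe⟩ := hGU _ (hJp z hz)
    obtain ⟨y, hy, hye⟩ := hGU _ (hJp w hw)
    simp only [hxe, hye] at h
    have hxy := eq_of_sq_eq_sq hs2 hx hy h
    rw [hxy, ← hye] at hxe
    exact J.injective (hφi (hJp z hz) (hJp w hw) (inv_injective (sub_left_injective hxe)))
  · ext w
    constructor
    · rintro ⟨z, hz, rfl⟩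
      obtain ⟨x, hx, hxe⟩ := hGU _ (hJp z hz)
      simp only [hxe, hs2 x hx]
      exact hx
    · intro hw
      obtain ⟨z, hz, h⟩ := hφΨ.superset (mem_image_of_mem _ hw)
      refine ⟨J.symm z, ?_, ?_⟩
      · have := hJ3 (J.symm z)
        rw [J.apply_symm_apply] at this
        exact pos_of_mul_pos_left (this ▸ hz) hz₀.le
      · simp only [J.apply_symm_apply, hG, h, inv_inv, add_sub_cancel_right]
        exact hs2 w hw
  · simp only [hJ1]
    rw [← hGk, ← hκ, κ.apply_symm_apply, hc2]
  · simp only [hJ2, hz₀e]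
    exact hs2 1 h1
  · have hJt : Tendsto J (Bornology.cobounded ℂ ⊓ 𝓟 {z | 0 ≤ z.im})
        (Bornology.cobounded ℂ ⊓ 𝓟 {z | 0 ≤ z.im}) := by
      refine tendsto_inf.mpr ⟨?_, tendsto_principal.mpr
        (eventually_inf_principal.mpr (Eventually.of_forall hJn))⟩
      rw [Metric.cobounded_eq_cocompact]
      exact J.isClosedEmbedding.tendsto_cocompact.mono_left inf_le_left
    have h2 := tendsto_norm_atTop_iff_cobounded.mpr (hGl.comp hJt)
    rw [← tendsto_norm_atTop_iff_cobounded]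
    simp only [norm_pow]
    exact (tendsto_pow_atTop two_ne_zero).comp h2

theorem exists_homeomorph_of_isQuotientMap {X Y Z : Type*} [TopologicalSpace X] [TopologicalSpace Y]
    [TopologicalSpace Z] {p : X → Y} {q : X → Z} (hp : IsQuotientMap p) (hq : IsQuotientMap q)
    (h : ∀ x y, p x = p y ↔ q x = q y) : ∃ e : Y ≃ₜ Z, ∀ x, e (p x) = q x := by
  choose f hf using hp.surjective
  choose g hg using hq.surjective
  have h1 : ∀ x, q (f (p x)) = q x := fun x ↦ (h _ _).mp (hf _)
  have h2 : ∀ x, p (g (q x)) = p x := fun x ↦ (h _ _).mpr (hg _)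
  refine ⟨⟨⟨fun y ↦ q (f y), fun z ↦ p (g z), fun y ↦ ?_, fun z ↦ ?_⟩, ?_, ?_⟩, h1⟩
  · show p (g (q (f y))) = y
    rw [h2, hf]
  · show q (f (p (g z))) = z
    rw [h1, hg]
  · exact hp.continuous_iff.mpr (hq.continuous.congr fun x ↦ (h1 x).symm)
  · exact hq.continuous_iff.mpr (hp.continuous.congr fun x ↦ (h2 x).symm)

theorem isQuotientMap_domRestrict_halfPlane {P : ℂ → ℂ} (hP : ContinuousOn P {z | 0 ≤ z.im})
    (ht : Tendsto P (Bornology.cobounded ℂ ⊓ 𝓟 {z | 0 ≤ z.im}) (Bornology.cobounded ℂ))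
    (hs : ∀ w, ∃ z : ℂ, 0 ≤ z.im ∧ P z = w) :
    IsQuotientMap fun z : {z : ℂ | 0 ≤ z.im} ↦ P z := by
  have hc : Continuous fun z : {z : ℂ | 0 ≤ z.im} ↦ P z :=
    continuousOn_iff_continuous_domRestrict.mp hP
  have hcl : IsClosed {z : ℂ | 0 ≤ z.im} := isClosed_le continuous_const Complex.continuous_im
  have htt : Tendsto (fun z : {z : ℂ | 0 ≤ z.im} ↦ P z) (cocompact _) (cocompact ℂ) := by
    rw [← Metric.cobounded_eq_cocompact (α := ℂ)]
    refine ht.comp (f := fun z : {z : ℂ | 0 ≤ z.im} ↦ (z : ℂ)) (tendsto_inf.mpr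
      ⟨?_, tendsto_principal.mpr (Eventually.of_forall fun z ↦ z.2)⟩)
    rw [Metric.cobounded_eq_cocompact (α := ℂ)]
    exact hcl.isClosedEmbedding_subtypeVal.tendsto_cocompact
  refine (isProperMap_iff_tendsto_cocompact.mpr ⟨hc, htt⟩).isClosedMap.isQuotientMap hc fun w ↦ ?_
  obtain ⟨z, hz, h⟩ := hs w
  exact ⟨⟨z, hz⟩, h⟩

/-- A folded ray can be straightened by a homeomorphism of the plane. -/
theorem IsFoldedRay.exists_homeomorph {B : ℝ → ℂ} (hB : IsFoldedRay B) (h1 : 1 ∉ range B)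
    (hU : IsPreconnected (range B)ᶜ) :
    ∃ h : ℂ ≃ₜ ℂ, (∀ u : ℝ, h (B u) = (u : ℂ) ^ 2) ∧ h 1 = -1 := by
  obtain ⟨P, hPc, hPi, hPU, hPB, hPI, hPt⟩ := hB.exists_parametrization h1 hU
  have hreal : ∀ z : ℂ, z.im = 0 → z = (z.re : ℝ) := fun z hz ↦ Complex.ext rfl (by simp [hz])
  have hPs : ∀ w, ∃ z : ℂ, 0 ≤ z.im ∧ P z = w := fun w ↦ by
    by_cases hw : w ∈ range B
    · obtain ⟨u, rfl⟩ := hw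
      exact ⟨u, by simp, hPB u⟩
    · obtain ⟨z, hz, h⟩ := hPU.superset hw
      exact ⟨z, (show 0 < z.im from hz).le, h⟩
  have hqs : ∀ w, ∃ z : ℂ, 0 ≤ z.im ∧ z ^ 2 = w := fun w ↦ by
    obtain ⟨z, hz⟩ := IsAlgClosed.exists_pow_nat_eq w two_pos
    rcases le_total 0 z.im with h | h
    · exact ⟨z, h, hz⟩
    · exact ⟨-z, by simpa using h, by rw [neg_sq, hz]⟩
  have hqt : Tendsto (fun z : ℂ ↦ z ^ 2) (Bornology.cobounded ℂ ⊓ 𝓟 {z | 0 ≤ z.im})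
      (Bornology.cobounded ℂ) := by
    rw [← tendsto_norm_atTop_iff_cobounded]
    simp only [norm_pow]
    exact (tendsto_pow_atTop two_ne_zero).comp (tendsto_norm_cobounded_atTop.mono_left inf_le_left)
  have hPr : ∀ z : ℂ, 0 < z.im → ∀ u : ℝ, P z ≠ B u := fun z hz u h ↦
    hPU.subset (mem_image_of_mem P hz) ⟨u, h.symm⟩
  have hqr : ∀ z : ℂ, 0 < z.im → ∀ u : ℝ, z ^ 2 ≠ (u : ℂ) ^ 2 := fun z hz u h ↦ by
    rcases sq_eq_sq_iff_eq_or_eq_neg.mp h with rfl | rfl <;> simp at hz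
  obtain ⟨h, hh⟩ := exists_homeomorph_of_isQuotientMap
    (isQuotientMap_domRestrict_halfPlane hPc hPt hPs)
    (isQuotientMap_domRestrict_halfPlane (continuous_pow 2).continuousOn hqt hqs) (by
      rintro ⟨z, hz : 0 ≤ z.im⟩ ⟨w, hw : 0 ≤ w.im⟩
      simp only []
      rcases hz.lt_or_eq with hz | hz <;> rcases hw.lt_or_eq with hw | hw
      · refine ⟨fun h ↦ by rw [hPi hz hw h], fun h ↦ ?_⟩
        rcases sq_eq_sq_iff_eq_or_eq_neg.mp h with rfl | rfl
        · rfl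
        · rw [Complex.neg_im] at hz
          linarith
      · rw [hreal w hw.symm, hPB]
        exact iff_of_false (hPr z hz _) (hqr z hz _)
      · rw [hreal z hz.symm, hPB]
        exact iff_of_false (hPr w hw _).symm (hqr w hw _).symm
      · rw [hreal z hz.symm, hreal w hw.symm, hPB, hPB, hB.eq_iff, ← sq_eq_sq_iff_abs_eq_abs]
        norm_cast)
  refine ⟨h, fun u ↦ ?_, ?_⟩
  · rw [← hPB]
    exact hh ⟨u, by simp⟩
  · simpa [hPI] using hh ⟨Complex.I, by simp⟩

theorem inv_one_add_sq_mem_Ioc (u : ℝ) : (1 + u ^ 2)⁻¹ ∈ Ioc (0 : ℝ) 1 :=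
  ⟨by positivity, inv_le_one_of_one_le₀ (by nlinarith [sq_nonneg u])⟩

theorem inv_one_add_sq_inj {u v : ℝ} : (1 + u ^ 2)⁻¹ = (1 + v ^ 2)⁻¹ ↔ |u| = |v| := by
  rw [inv_inj, add_right_inj, sq_eq_sq_iff_abs_eq_abs]

theorem exists_inv_one_add_sq_eq {t : ℝ} (ht : t ∈ Ioc (0 : ℝ) 1) : ∃ u : ℝ, (1 + u ^ 2)⁻¹ = t :=
  ⟨√(t⁻¹ - 1), by
    rw [Real.sq_sqrt (sub_nonneg.mpr ((one_le_inv₀ ht.1).mpr ht.2)), add_sub_cancel, inv_inv]⟩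

theorem tendsto_inv_one_add_sq_cocompact :
    Tendsto (fun u : ℝ ↦ (1 + u ^ 2)⁻¹) (cocompact ℝ) (𝓝 0) := by
  refine tendsto_inv_atTop_zero.comp (tendsto_atTop_add_const_left _ _ ?_)
  have := (tendsto_pow_atTop (α := ℝ) two_ne_zero).comp (tendsto_norm_cocompact_atTop (E := ℝ))
  exact this.congr fun x ↦ by simp

theorem sub_ne_zero_of_injOn_Icc {α : ℝ → ℂ} (hi : InjOn α (Icc 0 1)) {t : ℝ}
    (ht : t ∈ Ioc (0 : ℝ) 1) : α t - α 0 ≠ 0 := fun h ↦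
  ht.1.ne' (hi ⟨ht.1.le, ht.2⟩ (by simp) (sub_eq_zero.mp h))

/-- Sending the starting point of an arc to infinity turns it into a ray. -/
theorem isFoldedRay_of_injOn_Icc {α : ℝ → ℂ} (hα : ContinuousOn α (Icc 0 1))
    (hi : InjOn α (Icc 0 1)) :
    IsFoldedRay fun u ↦ 1 + (α 0 - α 1) * (α (1 + u ^ 2)⁻¹ - α 0)⁻¹ := by
  have hab := neg_sub (α 1) (α 0) ▸ neg_ne_zero.mpr (sub_ne_zero_of_injOn_Icc hi (by simp))
  have hm : ∀ u : ℝ, (1 + u ^ 2)⁻¹ ∈ Icc (0 : ℝ) 1 := fun u ↦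
    Ioc_subset_Icc_self (inv_one_add_sq_mem_Ioc u)
  have h0 : ∀ u : ℝ, α (1 + u ^ 2)⁻¹ - α 0 ≠ 0 := fun u ↦
    sub_ne_zero_of_injOn_Icc hi (inv_one_add_sq_mem_Ioc u)
  have hc : Continuous fun u : ℝ ↦ (1 + u ^ 2)⁻¹ :=
    (continuous_const.add (continuous_pow 2)).inv₀ fun u ↦ (by positivity : (0 : ℝ) < 1 + u ^ 2).ne'
  refine ⟨?_, fun u v ↦ ?_, ?_, ?_⟩
  · exact continuous_const.add (continuous_const.mul
      (((hα.comp_continuous hc hm).sub continuous_const).inv₀ h0))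
  · rw [add_right_inj, mul_right_inj' hab, inv_inj, sub_left_inj, hi.eq_iff (hm u) (hm v),
      inv_one_add_sq_inj]
  · have : α 1 - α 0 ≠ 0 := sub_ne_zero_of_injOn_Icc hi (by simp)
    norm_num
    field_simp
    ring
  · have h1 : Tendsto (fun u : ℝ ↦ α (1 + u ^ 2)⁻¹ - α 0) (cocompact ℝ) (𝓝[≠] 0) := by
      refine tendsto_nhdsWithin_iff.mpr ⟨?_, Eventually.of_forall h0⟩
      rw [← sub_self (α 0)]
      exact ((hα 0 (by simp)).tendsto.comp (tendsto_nhdsWithin_iff.mpr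
        ⟨tendsto_inv_one_add_sq_cocompact, Eventually.of_forall hm⟩)).sub_const _
    have h2 := tendsto_inv₀_nhdsNE_zero.comp h1
    exact tendsto_const_add_cobounded _ |>.comp (tendsto_mul_left_cobounded hab |>.comp h2)

theorem one_notMem_range_of_injOn_Icc {α : ℝ → ℂ} (hi : InjOn α (Icc 0 1)) :
    1 ∉ range fun u : ℝ ↦ 1 + (α 0 - α 1) * (α (1 + u ^ 2)⁻¹ - α 0)⁻¹ := by
  rintro ⟨u, hu⟩
  have hab := neg_sub (α 1) (α 0) ▸ neg_ne_zero.mpr (sub_ne_zero_of_injOn_Icc hi (by simp))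
  exact mul_ne_zero hab (inv_ne_zero (sub_ne_zero_of_injOn_Icc hi (inv_one_add_sq_mem_Ioc u)))
    (add_eq_left.mp hu)

theorem isPreconnected_compl_range_of_injOn_Icc {α : ℝ → ℂ} (hα : ContinuousOn α (Icc 0 1))
    (hi : InjOn α (Icc 0 1)) :
    IsPreconnected (range fun u : ℝ ↦ 1 + (α 0 - α 1) * (α (1 + u ^ 2)⁻¹ - α 0)⁻¹)ᶜ := by
  have hab := neg_sub (α 1) (α 0) ▸ neg_ne_zero.mpr (sub_ne_zero_of_injOn_Icc hi (by simp))
  have hγ := isPreconnected_compl_arc (γ := fun t : I ↦ α t)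
    (continuousOn_iff_continuous_domRestrict.mp hα) (injOn_iff_injective.mp hi)
  have hne : ∀ z ∈ (range fun t : I ↦ α t)ᶜ, z - α 0 ≠ 0 := fun z hz h ↦
    hz ⟨0, by simpa using (sub_eq_zero.mp h).symm⟩
  have hV := hγ.image (fun z ↦ 1 + (α 0 - α 1) * (z - α 0)⁻¹) (continuousOn_const.add
    (continuousOn_const.mul ((continuousOn_id.sub continuousOn_const).inv₀ hne)))
  refine hV.subset_closure ?_ ?_
  · rintro _ ⟨z, hz, rfl⟩ ⟨u, hu⟩
    simp only [add_right_inj, mul_right_inj' hab, inv_inj, sub_left_inj] at hu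
    exact hz ⟨⟨_, Ioc_subset_Icc_self (inv_one_add_sq_mem_Ioc u)⟩, hu⟩
  · have hO := (isFoldedRay_of_injOn_Icc hα hi).isClosed_range.isOpen_compl
    refine ((dense_compl_singleton (1 : ℂ)).open_subset_closure_inter hO).trans
      (closure_mono ?_)
    rintro y ⟨hy, hy1 : y ≠ 1⟩
    have hy1 := sub_ne_zero.mpr hy1
    refine ⟨α 0 + (α 0 - α 1) * (y - 1)⁻¹, ?_, ?_⟩
    · rintro ⟨t, ht⟩
      simp only [] at ht
      have ht0 : (t : ℝ) ≠ 0 := fun h ↦ by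
        rw [h, left_eq_add] at ht
        exact mul_ne_zero hab (inv_ne_zero hy1) ht
      obtain ⟨u, hu⟩ := exists_inv_one_add_sq_eq ⟨t.2.1.lt_of_ne' ht0, t.2.2⟩
      refine hy ⟨u, ?_⟩
      simp only [hu, ht, add_sub_cancel_left]
      field_simp
      ring
    · simp only [add_sub_cancel_left]
      field_simp
      ring

theorem Homeomorph.exists_conj_inv (k : ℂ ≃ₜ ℂ) (hk : k 0 = 0) :
    ∃ h : ℂ ≃ₜ ℂ, ∀ z, h z = (k z⁻¹)⁻¹ := by
  have hk' : k.symm 0 = 0 := by rw [← hk, k.symm_apply_apply, hk]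
  have key : ∀ k : ℂ ≃ₜ ℂ, k 0 = 0 → Continuous fun z ↦ (k z⁻¹)⁻¹ := fun k hk ↦ by
    have h0 : ∀ z, k z = 0 ↔ z = 0 := fun z ↦ by
      constructor
      · intro h
        exact k.injective (h.trans hk.symm)
      · rintro rfl
        exact hk
    refine continuous_iff_continuousAt.mpr fun z ↦ ?_
    rcases eq_or_ne z 0 with rfl | hz
    · rw [← continuousWithinAt_compl_self]
      have h1 : Tendsto (fun z : ℂ ↦ k z⁻¹) (𝓝[≠] 0) (Bornology.cobounded ℂ) := by
        refine Tendsto.comp ?_ tendsto_inv₀_nhdsNE_zero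
        rw [Metric.cobounded_eq_cocompact]
        exact k.isClosedEmbedding.tendsto_cocompact
      simpa [ContinuousWithinAt, hk, Function.comp_def] using tendsto_inv₀_cobounded.comp h1
    · exact (k.continuous.continuousAt.comp (continuousAt_inv₀ hz)).inv₀
        (by simpa [h0] using hz)
  exact ⟨⟨⟨fun z ↦ (k z⁻¹)⁻¹, fun z ↦ (k.symm z⁻¹)⁻¹, fun z ↦ by simp, fun z ↦ by simp⟩,
    key k hk, key k.symm hk'⟩, fun z ↦ rfl⟩

theorem exists_homeomorph_complex_arc {α : ℝ → ℂ} (hα : ContinuousOn α (Icc 0 1))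
    (hi : InjOn α (Icc 0 1)) : ∃ h : ℂ ≃ₜ ℂ, ∀ t ∈ Icc (0 : ℝ) 1, h (α t) = t := by
  have hab := neg_sub (α 1) (α 0) ▸ neg_ne_zero.mpr (sub_ne_zero_of_injOn_Icc hi (by simp))
  obtain ⟨g, hg, hg1⟩ := (isFoldedRay_of_injOn_Icc hα hi).exists_homeomorph
    (one_notMem_range_of_injOn_Icc hi) (isPreconnected_compl_range_of_injOn_Icc hα hi)
  obtain ⟨h, hh⟩ := Homeomorph.exists_conj_inv
    ((((Homeomorph.mulLeft₀ _ hab).trans (Homeomorph.addLeft 1)).trans g).trans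
      (Homeomorph.addLeft 1)) (by simp [hg1])
  refine ⟨(Homeomorph.addRight (-α 0)).trans h, fun t ht ↦ ?_⟩
  rcases ht.1.eq_or_lt with rfl | ht0
  · simp [hh, hg1]
  · obtain ⟨u, hu⟩ := exists_inv_one_add_sq_eq ⟨ht0, ht.2⟩
    have := hg u
    rw [hu, sub_eq_add_neg (α t)] at this
    simp only [Homeomorph.trans_apply, hh, Homeomorph.coe_addRight, Homeomorph.coe_addLeft,
      Homeomorph.coe_mulLeft₀, this]
    rw [← hu]
    push_cast
    rfl

theorem stmt_15 (α : ℝ → Plane)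
    (hcont : ContinuousOn α (Icc 0 1))
    (hinj : InjOn α (Icc 0 1)) :
    ∃ h : Plane ≃ₜ Plane, ∀ t ∈ Icc (0 : ℝ) 1,
      h (α t) = (EuclideanSpace.equiv (Fin 2) ℝ).symm ![t, 0] := by
  let e := Complex.orthonormalBasisOneI.repr.toHomeomorph
  obtain ⟨h, hh⟩ := exists_homeomorph_complex_arc (α := e.symm ∘ α)
    (e.symm.continuous.comp_continuousOn hcont) (e.symm.injective.comp_injOn hinj)
  refine ⟨(e.symm.trans h).trans e, fun t ht ↦ ?_⟩
  have : h (e.symm (α t)) = t := hh t ht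
  rw [Homeomorph.trans_apply, Homeomorph.trans_apply, this]
  ext i
  fin_cases i <;> simp [e, Complex.orthonormalBasisOneI_repr_apply]
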